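/- The σ-ideal σG₀ on the Hilbert cube I^ω satisfies the chain of inequalities ω₁ ≤ add(σG₀) ≤ cov(σG₀) ≤ add(M) ≤ cof(M) ≤ non(σG₀) ≤ cof(σG₀) ≤ 𝔠, where M is the σ-ideal of meager subsets of I^ω and 𝔠 is the cardinality of the continuum. -/

import Mathlib

open Set Topology Cardinal

/-- The Hilbert cube `[0,1]^ℕ` with the product topology. -/
abbrev HilbertCube : Type := ℕ → ↥(Set.Icc (0:ℝ) 1)

/-- An ideal of subsets: a nonempty family closed under subsets and finite unions. -/
def IsIdeal {X : Type*} (I : Set (Set X)) : Prop :=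
  I.Nonempty ∧ (∀ A ∈ I, ∀ B, B ⊆ A → B ∈ I) ∧ (∀ A ∈ I, ∀ B ∈ I, A ∪ B ∈ I)

/-- A σ-ideal: an ideal closed under countable unions. -/
def IsSigmaIdeal {X : Type*} (I : Set (Set X)) : Prop :=
  IsIdeal I ∧ ∀ A : ℕ → Set X, (∀ n, A n ∈ I) → (⋃ n, A n) ∈ I

/-- A non-trivial ideal contains an uncountable set but not the whole space. -/
def NontrivialIdeal {X : Type*} (I : Set (Set X)) : Prop :=
  (∃ A ∈ I, ¬ A.Countable) ∧ Set.univ ∉ I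

/-- An ideal on a topological space is topologically invariant if it is preserved by
all homeomorphisms of the space. -/
def TopInvariant {X : Type*} [TopologicalSpace X] (I : Set (Set X)) : Prop :=
  ∀ h : X ≃ₜ X, {B | ∃ A ∈ I, B = h '' A} = I

/-- `I` has a base all of whose members satisfy `P`. -/
def HasBaseWith {X : Type*} (I : Set (Set X)) (P : Set X → Prop) : Prop :=
  ∃ B ⊆ I, (∀ A ∈ I, ∃ C ∈ B, A ⊆ C) ∧ ∀ C ∈ B, P C

/-- A set has the Baire property if it differs from some open set by a meager set. -/
def HasBaireProperty {X : Type*} [TopologicalSpace X] (A : Set X) : Prop :=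
  ∃ U : Set X, IsOpen U ∧ IsMeagre ((A \ U) ∪ (U \ A))

/-- The σ-ideal of meager subsets of a topological space. -/
def MeagerIdeal (X : Type*) [TopologicalSpace X] : Set (Set X) := {A | IsMeagre A}

/-- The σ-ideal generated by a family `F`: all subsets of countable unions of members
of `F`. -/
def sigmaGenerated {X : Type*} (F : Set (Set X)) : Set (Set X) :=
  {A | ∃ S : ℕ → Set X, (∀ n, S n ∈ F) ∧ A ⊆ ⋃ n, S n}

/-- A Cantor set in the Hilbert cube: a subset homeomorphic to the Cantor cube. -/
def IsCantorSet (C : Set HilbertCube) : Prop := Nonempty (C ≃ₜ (ℕ → Bool))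

/-- A minimal Cantor set: one that can be mapped into any other Cantor set by an
ambient homeomorphism. -/
def IsMinimalCantorSet (A : Set HilbertCube) : Prop :=
  IsCantorSet A ∧ ∀ B : Set HilbertCube, IsCantorSet B →
    ∃ h : HilbertCube ≃ₜ HilbertCube, h '' A ⊆ B

/-- The family of all minimal Cantor sets in the Hilbert cube. -/
def CantorFamily : Set (Set HilbertCube) := {A | IsMinimalCantorSet A}

/-- The σ-ideal generated by minimal Cantor sets. -/
def sigmaC0 : Set (Set HilbertCube) := sigmaGenerated CantorFamily

/-- A minimal dense Gδ-subset of the Hilbert cube. -/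
def IsMinimalDenseGdelta (A : Set HilbertCube) : Prop :=
  IsGδ A ∧ Dense A ∧ ∀ B : Set HilbertCube, IsGδ B → Dense B →
    ∃ h : HilbertCube ≃ₜ HilbertCube, h '' A ⊆ B

/-- The family of all minimal dense Gδ-sets in the Hilbert cube. -/
def GdeltaFamily : Set (Set HilbertCube) := {A | IsMinimalDenseGdelta A}

/-- The σ-ideal generated by minimal dense Gδ-sets. -/
def sigmaG0 : Set (Set HilbertCube) := sigmaGenerated GdeltaFamily

/-- `cov(I)`: the least cardinality of a subfamily of `I` covering the space. -/
noncomputable def covIdeal {X : Type*} (I : Set (Set X)) : Cardinal :=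
  sInf {c | ∃ A : Set (Set X), A ⊆ I ∧ ⋃₀ A = Set.univ ∧ c = #A}

/-- `non(I)`: the least cardinality of a subset of the space not in `I`. -/
noncomputable def nonIdeal {X : Type*} (I : Set (Set X)) : Cardinal :=
  sInf {c | ∃ A : Set X, A ∉ I ∧ c = #A}

/-- `add(I,J)`: the least cardinality of a subfamily of `I` whose union is not in `J`. -/
noncomputable def addIdeal2 {X : Type*} (I J : Set (Set X)) : Cardinal :=
  sInf {c | ∃ A : Set (Set X), A ⊆ I ∧ ⋃₀ A ∉ J ∧ c = #A}

/-- `add(I) = add(I,I)`. -/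
noncomputable def addIdeal {X : Type*} (I : Set (Set X)) : Cardinal := addIdeal2 I I

/-- `cof(I,J)`: the least cardinality of a subfamily of `J` cofinal in `I`. -/
noncomputable def cofIdeal2 {X : Type*} (I J : Set (Set X)) : Cardinal :=
  sInf {c | ∃ A : Set (Set X), A ⊆ J ∧ (∀ B ∈ I, ∃ C ∈ A, B ⊆ C) ∧ c = #A}

/-- `cof(I) = cof(I,I)`. -/
noncomputable def cofIdeal {X : Type*} (I : Set (Set X)) : Cardinal := cofIdeal2 I I

/-- The compact-open topology on the homeomorphism group of a space, induced by the
compact-open topology of the space of continuous self-maps. -/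
noncomputable instance homeoGroupTopology (X : Type*) [TopologicalSpace X] :
    TopologicalSpace (X ≃ₜ X) :=
  TopologicalSpace.induced (fun h : X ≃ₜ X => (⟨h, h.continuous⟩ : C(X, X)))
    ContinuousMap.compactOpen

/-- A Z-set: a closed set `A` such that for every open cover `U` of the space there is a
continuous map into the complement of `A` which is `U`-near to the identity. -/
def IsZSet {X : Type*} [TopologicalSpace X] (A : Set X) : Prop :=
  IsClosed A ∧ ∀ U : Set (Set X), (∀ V ∈ U, IsOpen V) → ⋃₀ U = Set.univ →
    ∃ f : C(X, X), (∀ x, f x ∉ A) ∧ ∀ x : X, ∃ V ∈ U, x ∈ V ∧ f x ∈ V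

/-- A σZ-set: a countable union of Z-sets. -/
def IsSigmaZSet {X : Type*} [TopologicalSpace X] (A : Set X) : Prop :=
  ∃ Z : ℕ → Set X, (∀ n, IsZSet (Z n)) ∧ A = ⋃ n, Z n

/-- The cube `[0,1]^n`. -/
abbrev FinCube (n : ℕ) : Type := Fin n → ↥(Set.Icc (0:ℝ) 1)

/-- A `Z_n`-set in the Hilbert cube: a closed set `A` such that maps avoiding `A` are
dense in the space `C([0,1]^n, I^ω)` with the compact-open topology. -/
def IsZnSet (n : ℕ) (A : Set HilbertCube) : Prop :=
  IsClosed A ∧ Dense {f : C(FinCube n, HilbertCube) | ∀ x, f x ∉ A}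

/-- A `Z_ω`-set in the Hilbert cube: a closed set which is a `Z_n`-set for all `n`. -/
def IsZomegaSet (A : Set HilbertCube) : Prop :=
  IsClosed A ∧ ∀ n : ℕ, IsZnSet n A

/-- Covering dimension of a space is at most `n`: every finite open cover has a finite
open refinement (still a cover) in which no point belongs to more than `n+1` members. -/
def CovDimLE (Y : Type*) [TopologicalSpace Y] (n : ℕ) : Prop :=
  ∀ U : Set (Set Y), U.Finite → (∀ V ∈ U, IsOpen V) → ⋃₀ U = Set.univ →
    ∃ V : Set (Set Y), V.Finite ∧ (∀ W ∈ V, IsOpen W) ∧ ⋃₀ V = Set.univ ∧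
      (∀ W ∈ V, ∃ W' ∈ U, W ⊆ W') ∧
      ∀ y : Y, {W ∈ V | y ∈ W}.ncard ≤ n + 1

/-- A `G_δ`-generated topologically invariant ideal on the Hilbert cube. -/
def GdeltaGenerated (I : Set (Set HilbertCube)) : Prop :=
  HasBaseWith I IsSigmaCompact ∧
  ∃ G : Set HilbertCube, IsGδ G ∧
    (∀ K : Set HilbertCube, K ⊆ G → IsCompact K → K ∈ I) ∧
    ∀ A ∈ I, IsCompact A →
      Dense {h : HilbertCube ≃ₜ HilbertCube | h '' A ⊆ G}

/-- A `G_δ*`-generated ideal: a preimage of a `G_δ`-generated ideal under an embedding. -/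
def GdeltaStarGenerated (I : Set (Set HilbertCube)) : Prop :=
  ∃ I' : Set (Set HilbertCube), GdeltaGenerated I' ∧
    ∃ e : HilbertCube → HilbertCube, IsEmbedding e ∧ I = {S | ∃ A ∈ I', S = e ⁻¹' A}

/-- A `σG_δ*`-generated ideal. -/
def SigmaGdeltaStarGenerated (I : Set (Set HilbertCube)) : Prop :=
  ∃ In : ℕ → Set (Set HilbertCube), (∀ n, GdeltaStarGenerated (In n)) ∧
    (∀ n, In n ⊆ I) ∧
    ∀ A ∈ I, ∃ K : ℕ → Set HilbertCube,
      (∀ n, IsCompact (K n) ∧ K n ∈ In n) ∧ A ⊆ ⋃ n, K n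

open Filter

theorem exists_homeomorph_eq_of_tendstoUniformly {X : Type*} [UniformSpace X] [T2Space X]
    (h : ℕ → X ≃ₜ X) (f g : X → X)
    (hf : TendstoUniformly (fun n x => h n x) f atTop)
    (hg : TendstoUniformly (fun n x => (h n).symm x) g atTop) :
    ∃ H : X ≃ₜ X, ∀ x, H x = f x := by
  have cf : Continuous f := hf.continuous (Frequently.of_forall fun n => (h n).continuous)
  have cg : Continuous g := hg.continuous (Frequently.of_forall fun n => (h n).symm.continuous)
  have hfx : ∀ x, Tendsto (fun n => h n x) atTop (𝓝 (f x)) := fun x => hf.tendsto_at x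
  have hgx : ∀ x, Tendsto (fun n => (h n).symm x) atTop (𝓝 (g x)) := fun x => hg.tendsto_at x
  refine ⟨⟨⟨f, g, fun x => ?_, fun x => ?_⟩, cf, cg⟩, fun x => rfl⟩
  · have := hg.tendsto_comp cg.continuousAt (hfx x)
    simp only [Homeomorph.symm_apply_apply] at this
    exact (tendsto_nhds_unique this tendsto_const_nhds)
  · have := hf.tendsto_comp cf.continuousAt (hgx x)
    simp only [Homeomorph.apply_symm_apply] at this
    exact (tendsto_nhds_unique this tendsto_const_nhds)

theorem tendstoUniformly_of_dist_succ_le_geometric {X Y : Type*} [MetricSpace Y]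
    (F : ℕ → X → Y) (f : X → Y) (C r : ℝ) (hr0 : 0 ≤ r) (hr : r < 1)
    (hF : ∀ n x, dist (F n x) (F (n + 1) x) ≤ C * r ^ n)
    (hf : ∀ x, Tendsto (fun n => F n x) atTop (𝓝 (f x))) :
    TendstoUniformly F f atTop := by
  rw [Metric.tendstoUniformly_iff]
  intro e he
  have h0 : Tendsto (fun n : ℕ => C * r ^ n / (1 - r)) atTop (𝓝 0) := by
    have := ((tendsto_pow_atTop_nhds_zero_of_lt_one hr0 hr).const_mul C).div_const (1 - r)
    simpa using this
  filter_upwards [h0.eventually (gt_mem_nhds he)] with n hn x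
  rw [dist_comm]
  exact (dist_le_of_le_geometric_of_tendsto r C hr (hF · x) (hf x) n).trans_lt hn

theorem exists_homeomorph_mapsTo_of_frequently {X : Type*} [MetricSpace X] [CompactSpace X]
    (K V : ℕ → Set X) (ε : ℕ → ℝ) (hε0 : ∀ k, 0 < ε k) (hε : ∀ k, 4 * ε (k + 1) ≤ ε k)
    (hT : ∀ k, ∀ B : Set X, IsOpen B → Dense B →
      ∃ T : X ≃ₜ X, (∀ x, dist (T x) x ≤ ε k) ∧ ∀ x ∈ K k, T x ∈ B)
    (hE : ∀ k j, k ≤ j → ∃ E : X ≃ₜ X, (∀ x, dist (E x) x ≤ ε k) ∧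
      (∀ i, k ≤ i → i ≤ j → ∀ x ∈ V i, ∀ y, dist y x ≤ 4 * ε (j + 1) → E y ∈ K k) ∧
      ∀ x y, dist x y ≤ 4 * ε (j + 1) → dist (E x) (E y) ≤ 1 / ((j : ℝ) + 1))
    {B : Set X} (hB : IsGδ B) (hBd : Dense B) :
    ∃ h : X ≃ₜ X, ∀ x, (∃ᶠ j in atTop, x ∈ V j) → h x ∈ B := by
  obtain ⟨D, hDo, rfl⟩ := isGδ_iff_eq_iInter_nat.1 hB
  have step : ∀ (n : ℕ) (h : X ≃ₜ X) (k : ℕ), ∃ (S : X ≃ₜ X) (j : ℕ), k ≤ j ∧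
      (∀ x, dist (S x) x ≤ 2 * ε k) ∧
      (∀ i, k ≤ i → i ≤ j → ∀ x ∈ V i, ∀ y, dist y x ≤ 4 * ε (j + 1) →
        ∀ a ≤ n, h (S y) ∈ D a) ∧
      ∀ x y, dist x y ≤ 4 * ε (j + 1) → dist (h (S x)) (h (S y)) ≤ (1 / 2) ^ n := by
    intro n h k
    have hop : IsOpen (h ⁻¹' (⋂ a ∈ Iic n, D a)) :=
      ((finite_Iic n).isOpen_biInter fun a _ => hDo a).preimage h.continuous
    have hde : Dense (h ⁻¹' (⋂ a ∈ Iic n, D a)) := by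
      have : Dense (⋂ a ∈ Iic n, D a) := hBd.mono (by
        intro x hx
        simp only [mem_iInter] at hx ⊢
        exact fun a _ => hx a)
      exact this.preimage h.isOpenMap
    obtain ⟨T, hT1, hT2⟩ := hT k _ hop hde
    have huc : UniformContinuous (fun x => h (T x)) :=
      CompactSpace.uniformContinuous_of_continuous (h.continuous.comp T.continuous)
    obtain ⟨θ, hθ, hθ'⟩ := Metric.uniformContinuous_iff.1 huc ((1 / 2) ^ n) (by positivity)
    obtain ⟨j0, hj0⟩ := exists_nat_one_div_lt hθ
    obtain ⟨E, hE1, hE2, hE3⟩ := hE k (max k j0) (le_max_left _ _)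
    refine ⟨E.trans T, max k j0, le_max_left _ _, fun x => ?_, ?_, ?_⟩
    · have h1 := hT1 (E x)
      have h2 := hE1 x
      have h3 := dist_triangle (T (E x)) (E x) x
      simp only [Homeomorph.trans_apply]
      linarith
    · intro i hi1 hi2 x hx y hy a ha
      have := hT2 _ (hE2 i hi1 hi2 x hx y hy)
      simp only [mem_preimage, mem_iInter, mem_Iic] at this
      exact this a ha
    · intro x y hxy
      refine (hθ' ((hE3 x y hxy).trans_lt (lt_of_le_of_lt ?_ hj0))).le
      have : (j0 : ℝ) ≤ (max k j0 : ℕ) := by exact_mod_cast le_max_right _ _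
      gcongr
  choose S j hkj hS1 hS2 hS3 using step
  let st : ℕ → (X ≃ₜ X) × ℕ := fun n => Nat.rec (Homeomorph.refl X, 0)
    (fun n p => ((S n p.1 p.2).trans p.1, j n p.1 p.2 + 1)) n
  let H : ℕ → X ≃ₜ X := fun n => (st n).1
  let k : ℕ → ℕ := fun n => (st n).2
  let s : ℕ → X ≃ₜ X := fun n => S n (H n) (k n)
  have hH : ∀ n x, H (n + 1) x = H n (s n x) := fun n x => rfl
  have hk : ∀ n, k (n + 1) = j n (H n) (k n) + 1 := fun n => rfl
  have hkm : StrictMono k := strictMono_nat_of_lt_succ fun n => by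
    rw [hk]; exact Nat.lt_succ_of_le (hkj n (H n) (k n))
  have hεanti : Antitone ε := antitone_nat_of_succ_le fun n => by
    have := hε n; have := hε0 (n + 1); linarith
  have hεk : ∀ n d, ε (k (n + d)) ≤ ε (k n) * (1 / 4) ^ d := by
    intro n d
    induction d with
    | zero => simp
    | succ d ih =>
      have h1 : ε (k (n + d + 1)) ≤ ε (k (n + d) + 1) := hεanti (hkm (Nat.lt_succ_self _))
      have h2 := hε (k (n + d))
      rw [← add_assoc, pow_succ]
      linarith
  have hs : ∀ n x, dist (s n x) x ≤ 2 * ε (k n) := fun n x => hS1 n (H n) (k n) x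
  have fwd : ∀ n x, dist (H (n + 1) x) (H (n + 1 + 1) x) ≤ 1 * (1 / 2) ^ n := by
    intro n x
    rw [hH (n + 1) x, hH n, hH n, one_mul]
    refine hS3 n (H n) (k n) _ _ ?_
    rw [dist_comm, ← hk]
    have := hs (n + 1) x
    have := hε0 (k (n + 1))
    linarith
  have bwd : ∀ n x, dist ((H n).symm x) ((H (n + 1)).symm x) ≤ (2 * ε (k 0)) * (1 / 4) ^ n := by
    intro n x
    have h1 : (H n).symm x = s n ((H (n + 1)).symm x) := by
      rw [Homeomorph.symm_apply_eq, ← hH]; simp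
    rw [h1]
    have h2 := hs n ((H (n + 1)).symm x)
    have h3 := hεk 0 n
    rw [zero_add] at h3
    linarith
  have fl : ∀ x, ∃ y, Tendsto (fun n => H (n + 1) x) atTop (𝓝 y) := fun x =>
    cauchySeq_tendsto_of_complete
      (cauchySeq_of_le_geometric (1 / 2) 1 (by norm_num) (fun n => fwd n x))
  have gl : ∀ x, ∃ y, Tendsto (fun n => (H n).symm x) atTop (𝓝 y) := fun x =>
    cauchySeq_tendsto_of_complete
      (cauchySeq_of_le_geometric (1 / 4) (2 * ε (k 0)) (by norm_num) (fun n => bwd n x))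
  choose f hf using fl
  choose g hg using gl
  obtain ⟨h, hh⟩ := exists_homeomorph_eq_of_tendstoUniformly (fun n => H (n + 1)) f g
    (tendstoUniformly_of_dist_succ_le_geometric _ f 1 (1 / 2) (by norm_num) (by norm_num) fwd hf)
    (fun u hu => (tendsto_add_atTop_nat 1).eventually
      ((tendstoUniformly_of_dist_succ_le_geometric _ g _ (1 / 4) (by norm_num) (by norm_num)
        bwd hg) u hu))
  refine ⟨h, fun x hx => ?_⟩
  have near : ∀ n d x, dist ((H n).symm (H (n + d) x)) x ≤ 4 * ε (k n) * (1 - (1 / 4) ^ d) := by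
    intro n d
    induction d with
    | zero => intro x; simp
    | succ d ih =>
      intro x
      have h1 := ih (s (n + d) x)
      have h2 := hs (n + d) x
      have h3 := hεk n d
      have h4 := dist_triangle ((H n).symm (H (n + d) (s (n + d) x))) (s (n + d) x) x
      rw [← add_assoc, hH, pow_succ]
      have h5 : 0 ≤ ε (k n) * (1 / 4) ^ d := by have := (hε0 (k n)).le; positivity
      nlinarith
  rw [mem_iInter]
  intro a
  obtain ⟨i, hi, hiV⟩ := (frequently_atTop.1 hx) (k a)
  obtain ⟨n, hn1, hn2⟩ : ∃ n, k n ≤ i ∧ i < k (n + 1) := by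
    have hex : ∃ n, i < k n := ⟨i + 1, lt_of_lt_of_le (Nat.lt_succ_self i) (hkm.id_le (i + 1))⟩
    classical
    have h1 := Nat.find_spec hex
    obtain ⟨n, hn⟩ : ∃ n, Nat.find hex = n + 1 := by
      refine Nat.exists_eq_succ_of_ne_zero fun h0 => ?_
      rw [h0] at h1
      exact absurd (lt_of_lt_of_le h1 (hkm.monotone (Nat.zero_le a))) (not_lt.2 hi)
    refine ⟨n, not_lt.1 (Nat.find_min hex (by omega)), by rwa [← hn]⟩
  have han : a ≤ n := by
    by_contra hlt
    have h1 : n + 1 ≤ a := by omega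
    have : k (n + 1) ≤ k a := hkm.monotone h1
    omega
  have hy : dist ((H (n + 1)).symm (f x)) x ≤ 4 * ε (k (n + 1)) := by
    have hlim : Tendsto (fun d => dist ((H (n + 1)).symm (H (n + 1 + d) x)) x) atTop
        (𝓝 (dist ((H (n + 1)).symm (f x)) x)) := by
      refine Tendsto.dist ?_ tendsto_const_nhds
      refine ((H (n + 1)).symm.continuous.tendsto _).comp ?_
      have := (hf x).comp (tendsto_add_atTop_nat n)
      refine this.congr fun d => ?_
      simp only [Function.comp]
      rw [show n + 1 + d = d + n + 1 by omega]
    refine le_of_tendsto' hlim fun d => (near (n + 1) d x).trans ?_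
    have h1 : (0 : ℝ) ≤ (1 / 4) ^ d := by positivity
    have h2 := hε0 (k (n + 1))
    nlinarith
  have key := hS2 n (H n) (k n) i hn1 (by rw [hk] at hn2; omega) x hiV
    ((H (n + 1)).symm (f x)) (by rw [← hk]; exact hy) a han
  have e1 : H n (S n (H n) (k n) ((H (n + 1)).symm (f x))) = f x := by
    change H n (s n ((H (n + 1)).symm (f x))) = f x
    rw [← hH]; simp
  rw [e1] at key
  rw [hh]
  exact key

/-- The linear shear `(a, v) ↦ (a, s v + r a)` of the plane. -/
def planeShear (s r : ℝ) (z : ℝ × ℝ) : ℝ × ℝ := (z.1, s * z.2 + r * z.1)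

/-- The shear corrected radially so as to preserve the sup norm. -/
noncomputable def normShear (s r : ℝ) (z : ℝ × ℝ) : ℝ × ℝ :=
  (‖z‖ / ‖planeShear s r z‖) • planeShear s r z

theorem planeShear_smul (s r c : ℝ) (z : ℝ × ℝ) :
    planeShear s r (c • z) = c • planeShear s r z := by
  simp [planeShear]; ring

theorem planeShear_inv {s : ℝ} (hs : s ≠ 0) (r : ℝ) (z : ℝ × ℝ) :
    planeShear s⁻¹ (-r / s) (planeShear s r z) = z := by
  ext
  · simp [planeShear]
  · simp [planeShear]; field_simp; ring

theorem planeShear_ne_zero {s : ℝ} (hs : s ≠ 0) (r : ℝ) {z : ℝ × ℝ} (hz : z ≠ 0) :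
    planeShear s r z ≠ 0 := by
  intro h
  apply hz
  rw [← planeShear_inv hs r z, h]
  simp [planeShear]

theorem norm_normShear {s : ℝ} (hs : s ≠ 0) (r : ℝ) (z : ℝ × ℝ) : ‖normShear s r z‖ = ‖z‖ := by
  by_cases hz : z = 0
  · simp [hz, normShear]
  · have := norm_pos_iff.2 (planeShear_ne_zero hs r hz)
    rw [normShear, norm_smul, norm_div, norm_norm, norm_norm]
    field_simp

theorem normShear_smul (s r : ℝ) {c : ℝ} (hc : 0 < c) (z : ℝ × ℝ) :
    normShear s r (c • z) = c • normShear s r z := by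
  rw [normShear, planeShear_smul, norm_smul, norm_smul, normShear, smul_smul, smul_smul,
    mul_div_mul_left _ _ (norm_ne_zero_iff.2 hc.ne'), mul_comm]

theorem normShear_inv {s : ℝ} (hs : s ≠ 0) (r : ℝ) (z : ℝ × ℝ) :
    normShear s⁻¹ (-r / s) (normShear s r z) = z := by
  by_cases hz : z = 0
  · simp [hz, normShear]
  · have h1 := norm_pos_iff.2 (planeShear_ne_zero hs r hz)
    have h2 := norm_pos_iff.2 hz
    rw [normShear.eq_1 s r, normShear_smul _ _ (by positivity), normShear, planeShear_inv hs,
      smul_smul]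
    rw [show ‖z‖ / ‖planeShear s r z‖ * (‖planeShear s r z‖ / ‖z‖) = 1 by field_simp, one_smul]

theorem normShear_inv' {s : ℝ} (hs : s ≠ 0) (r : ℝ) (z : ℝ × ℝ) :
    normShear s r (normShear s⁻¹ (-r / s) z) = z := by
  have := normShear_inv (inv_ne_zero hs) (-r / s) z
  rwa [inv_inv, show -(-r / s) / s⁻¹ = r by field_simp] at this

theorem normShear_fst_nonneg (s r : ℝ) {z : ℝ × ℝ} (hz : 0 ≤ z.1) : 0 ≤ (normShear s r z).1 := by
  simp only [normShear, planeShear, Prod.smul_fst, smul_eq_mul]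
  positivity

theorem normShear_zero_fst {s : ℝ} (hs : 0 < s) (r v : ℝ) : normShear s r (0, v) = (0, v) := by
  by_cases hv : v = 0
  · rw [hv, ← Prod.zero_eq_mk]
    simp [normShear]
  · have : |v| ≠ 0 := abs_ne_zero.2 hv
    have hn : max 0 (|v| * s) = |v| * s := max_eq_right (by positivity)
    simp [normShear, planeShear, Prod.norm_def, abs_of_pos hs]
    field_simp
    rw [hn]

theorem normShear_one_zero (z : ℝ × ℝ) : normShear 1 0 z = z := by
  have h : planeShear 1 0 z = z := by simp [planeShear]
  by_cases hz : z = 0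
  · simp [hz, normShear]
  · rw [normShear, h, div_self (norm_ne_zero_iff.2 hz), one_smul]

theorem continuousOn_normShear {α : Type*} [TopologicalSpace α] {A : Set α} {s r : α → ℝ}
    {z : α → ℝ × ℝ} (hs : ContinuousOn s A) (hr : ContinuousOn r A) (hz : ContinuousOn z A)
    (hs0 : ∀ x ∈ A, s x ≠ 0) : ContinuousOn (fun x => normShear (s x) (r x) (z x)) A := by
  have hsh : ContinuousOn (fun x => planeShear (s x) (r x) (z x)) A := by
    unfold planeShear; fun_prop
  intro x hx
  by_cases h0 : z x = 0
  · have e : normShear (s x) (r x) (z x) = 0 := by simp [h0, normShear]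
    rw [ContinuousWithinAt, e, tendsto_zero_iff_norm_tendsto_zero]
    have := (hz x hx).norm
    rw [ContinuousWithinAt, h0, norm_zero] at this
    refine this.congr' ?_
    filter_upwards [self_mem_nhdsWithin] with y hy
    rw [norm_normShear (hs0 y hy)]
  · exact ((hz x hx).norm.div (hsh x hx).norm
      (norm_ne_zero_iff.2 (planeShear_ne_zero (hs0 x hx) _ h0))).smul (hsh x hx)

/-- A one-parameter family of self-bijections of the square, starting at the identity and
fixing the points whose first coordinate lies outside `U`. -/
structure SquareIsotopy (U : Set ℝ) where
  toFun : ℝ → ℝ × ℝ → ℝ × ℝ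
  inv : ℝ → ℝ × ℝ → ℝ × ℝ
  cont : ContinuousOn (fun p : ℝ × ℝ × ℝ => toFun p.1 p.2)
    (Icc 0 1 ×ˢ (Icc 0 1 ×ˢ Icc 0 1))
  maps : ∀ t ∈ Icc (0 : ℝ) 1, ∀ z ∈ Icc (0 : ℝ) 1 ×ˢ Icc (0 : ℝ) 1,
    toFun t z ∈ Icc (0 : ℝ) 1 ×ˢ Icc (0 : ℝ) 1
  maps_inv : ∀ t ∈ Icc (0 : ℝ) 1, ∀ z ∈ Icc (0 : ℝ) 1 ×ˢ Icc (0 : ℝ) 1,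
    inv t z ∈ Icc (0 : ℝ) 1 ×ˢ Icc (0 : ℝ) 1
  left_inv : ∀ t ∈ Icc (0 : ℝ) 1, ∀ z ∈ Icc (0 : ℝ) 1 ×ˢ Icc (0 : ℝ) 1, inv t (toFun t z) = z
  right_inv : ∀ t ∈ Icc (0 : ℝ) 1, ∀ z ∈ Icc (0 : ℝ) 1 ×ˢ Icc (0 : ℝ) 1, toFun t (inv t z) = z
  zero : ∀ z ∈ Icc (0 : ℝ) 1 ×ˢ Icc (0 : ℝ) 1, toFun 0 z = z
  fix : ∀ t ∈ Icc (0 : ℝ) 1, ∀ x ∈ Icc (0 : ℝ) 1, ∀ y ∈ Icc (0 : ℝ) 1, x ∉ U →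
    toFun t (x, y) = (x, y)

/-- Conjugation of a square isotopy by the reflection of the first coordinate. -/
def SquareIsotopy.flip {U : Set ℝ} (f : SquareIsotopy U) : SquareIsotopy {x | 1 - x ∈ U} where
  toFun t z := (1 - (f.toFun t (1 - z.1, z.2)).1, (f.toFun t (1 - z.1, z.2)).2)
  inv t z := (1 - (f.inv t (1 - z.1, z.2)).1, (f.inv t (1 - z.1, z.2)).2)
  cont := by
    have : ContinuousOn (fun p : ℝ × ℝ × ℝ => f.toFun p.1 (1 - p.2.1, p.2.2))
        (Icc 0 1 ×ˢ (Icc 0 1 ×ˢ Icc 0 1)) := by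
      refine f.cont.comp (f := fun p : ℝ × ℝ × ℝ => (p.1, (1 - p.2.1, p.2.2))) (by fun_prop) ?_
      rintro ⟨t, x, y⟩ ⟨h1, h2, h3⟩
      simp only [mem_prod, mem_Icc] at *
      exact ⟨h1, ⟨by linarith, by linarith⟩, h3⟩
    exact (continuousOn_const.sub this.fst).prodMk this.snd
  maps t ht z hz := by
    have := f.maps t ht (1 - z.1, z.2) (by simp only [mem_prod, mem_Icc] at *; grind)
    simp only [mem_prod, mem_Icc] at *; grind
  maps_inv t ht z hz := by
    have := f.maps_inv t ht (1 - z.1, z.2) (by simp only [mem_prod, mem_Icc] at *; grind)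
    simp only [mem_prod, mem_Icc] at *; grind
  left_inv t ht z hz := by
    have := f.left_inv t ht (1 - z.1, z.2) (by simp only [mem_prod, mem_Icc] at *; grind)
    simp [this]
  right_inv t ht z hz := by
    have := f.right_inv t ht (1 - z.1, z.2) (by simp only [mem_prod, mem_Icc] at *; grind)
    simp [this]
  zero z hz := by
    have := f.zero (1 - z.1, z.2) (by simp only [mem_prod, mem_Icc] at *; grind)
    simp [this]
  fix t ht x hx y hy hxU := by
    have := f.fix t ht (1 - x) (by simp only [mem_Icc] at *; grind) y hy hxU
    simp [this]

/-- `normShear`, in the coordinates `x = w + (1 - w) a`, `y = (1 + v) / 2` and extended by the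
identity to `x ≤ w`. -/
noncomputable def wallShear (w s r : ℝ) (z : ℝ × ℝ) : ℝ × ℝ :=
  (w + (1 - w) * ((normShear s r (max ((z.1 - w) / (1 - w)) 0, 2 * z.2 - 1)).1
      + min ((z.1 - w) / (1 - w)) 0),
    (1 + (normShear s r (max ((z.1 - w) / (1 - w)) 0, 2 * z.2 - 1)).2) / 2)

theorem wallShear_of_le {w s r : ℝ} (hw1 : w < 1) (hs : 0 < s) {z : ℝ × ℝ} (hz : z.1 ≤ w) :
    wallShear w s r z = z := by
  have h1 : (0 : ℝ) < 1 - w := by linarith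
  have h : (z.1 - w) / (1 - w) ≤ 0 := div_nonpos_of_nonpos_of_nonneg (by linarith) h1.le
  rw [wallShear, max_eq_right h, min_eq_left h, normShear_zero_fst hs]
  ext
  · simp only; field_simp; ring
  · simp

theorem wallShear_of_ge {w s r : ℝ} (hw1 : w < 1) {z : ℝ × ℝ} (hz : w ≤ z.1) :
    wallShear w s r z =
      (w + (1 - w) * (normShear s r ((z.1 - w) / (1 - w), 2 * z.2 - 1)).1,
        (1 + (normShear s r ((z.1 - w) / (1 - w), 2 * z.2 - 1)).2) / 2) := by
  have h1 : (0 : ℝ) < 1 - w := by linarith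
  have h : 0 ≤ (z.1 - w) / (1 - w) := div_nonneg (by linarith) h1.le
  rw [wallShear, max_eq_left h, min_eq_right h, add_zero]

theorem le_wallShear_fst {w s r : ℝ} (hw1 : w < 1) {z : ℝ × ℝ} (hz : w ≤ z.1) :
    w ≤ (wallShear w s r z).1 := by
  rw [wallShear_of_ge hw1 hz]
  have h1 : (0 : ℝ) < 1 - w := by linarith
  have := normShear_fst_nonneg s r (z := ((z.1 - w) / (1 - w), 2 * z.2 - 1))
    (div_nonneg (by linarith) h1.le)
  simp only
  nlinarith

theorem wallShear_mem {w s r : ℝ} (hw0 : 0 < w) (hw1 : w < 1) (hs : 0 < s) {z : ℝ × ℝ}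
    (hz : z ∈ Icc (0 : ℝ) 1 ×ˢ Icc (0 : ℝ) 1) :
    wallShear w s r z ∈ Icc (0 : ℝ) 1 ×ˢ Icc (0 : ℝ) 1 := by
  rcases le_total z.1 w with h | h
  · rwa [wallShear_of_le hw1 hs h]
  · have h1 : (0 : ℝ) < 1 - w := by linarith
    have h2 := le_wallShear_fst (s := s) (r := r) hw1 h
    rw [wallShear_of_ge hw1 h] at h2 ⊢
    simp only [mem_prod, mem_Icc] at hz h2 ⊢
    have h3 : (z.1 - w) / (1 - w) ≤ 1 := by rw [div_le_one h1]; linarith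
    have h4 : 0 ≤ (z.1 - w) / (1 - w) := div_nonneg (by linarith) h1.le
    have hn := norm_normShear hs.ne' r ((z.1 - w) / (1 - w), 2 * z.2 - 1)
    have hn1 : ‖((z.1 - w) / (1 - w), 2 * z.2 - 1)‖ ≤ 1 := by
      rw [Prod.norm_def]
      refine max_le ?_ ?_
      · simp only [Real.norm_eq_abs]; rw [abs_le]; constructor <;> linarith
      · simp only [Real.norm_eq_abs]; rw [abs_le]; constructor <;> linarith
    rw [← hn] at hn1
    have a1 := (abs_le.1 ((norm_fst_le _).trans hn1))
    have a2 := (abs_le.1 ((norm_snd_le _).trans hn1))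
    refine ⟨⟨by linarith, by nlinarith⟩, by linarith, by linarith⟩

theorem wallShear_wallShear {w s r s' r' : ℝ} (hw1 : w < 1) (hs : 0 < s) (hs' : 0 < s')
    (h : ∀ z, normShear s' r' (normShear s r z) = z) (z : ℝ × ℝ) :
    wallShear w s' r' (wallShear w s r z) = z := by
  rcases le_total z.1 w with hz | hz
  · rw [wallShear_of_le hw1 hs hz, wallShear_of_le hw1 hs' hz]
  · have h1 : (0 : ℝ) < 1 - w := by linarith
    rw [wallShear_of_ge hw1 (le_wallShear_fst hw1 hz), wallShear_of_ge hw1 hz]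
    have e : (((w + (1 - w) * (normShear s r ((z.1 - w) / (1 - w), 2 * z.2 - 1)).1) - w) / (1 - w),
        2 * ((1 + (normShear s r ((z.1 - w) / (1 - w), 2 * z.2 - 1)).2) / 2) - 1)
        = normShear s r ((z.1 - w) / (1 - w), 2 * z.2 - 1) := by
      ext
      · simp only; field_simp; ring
      · simp only; ring
    simp only [e, h]
    ext
    · simp only; field_simp; ring
    · simp only; ring

/-- The isotopy of the square through the maps `wallShear`. -/
noncomputable def wallIsotopy {w : ℝ} (hw0 : 0 < w) (hw1 : w < 1) {l : ℝ} (hl : 0 < l) (r : ℝ) :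
    SquareIsotopy (Ioi w) where
  toFun t := wallShear w (1 - t + t * l) (t * r)
  inv t := wallShear w (1 - t + t * l)⁻¹ (-(t * r) / (1 - t + t * l))
  cont := by
    have h1 : (1 : ℝ) - w ≠ 0 := by linarith
    have : ContinuousOn (fun p : ℝ × ℝ × ℝ => normShear (1 - p.1 + p.1 * l) (p.1 * r)
        (max ((p.2.1 - w) / (1 - w)) 0, 2 * p.2.2 - 1)) (Icc 0 1 ×ˢ (Icc 0 1 ×ˢ Icc 0 1)) := by
      refine continuousOn_normShear (by fun_prop) (by fun_prop) (by fun_prop) ?_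
      rintro ⟨t, z⟩ ⟨⟨ht0, ht1⟩, -⟩
      simp only at *
      rcases ht0.eq_or_lt with h | h
      · rw [← h]; simp
      · have := mul_pos h hl; linarith
    unfold wallShear
    refine ContinuousOn.prodMk ?_ ?_
    · have := this.fst
      fun_prop
    · have := this.snd
      fun_prop
  maps t ht z hz := wallShear_mem hw0 hw1 (by nlinarith [ht.1, ht.2, mul_nonneg ht.1 hl.le]) hz
  maps_inv t ht z hz := wallShear_mem hw0 hw1
    (inv_pos.2 (by nlinarith [ht.1, ht.2, mul_nonneg ht.1 hl.le])) hz
  left_inv t ht z hz := by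
    have : 0 < 1 - t + t * l := by nlinarith [ht.1, ht.2, mul_nonneg ht.1 hl.le]
    exact wallShear_wallShear hw1 this (inv_pos.2 this) (normShear_inv this.ne' _) z
  right_inv t ht z hz := by
    have : 0 < 1 - t + t * l := by nlinarith [ht.1, ht.2, mul_nonneg ht.1 hl.le]
    exact wallShear_wallShear hw1 (inv_pos.2 this) this (normShear_inv' this.ne' _) z
  zero z hz := by
    have e : ∀ z, normShear 1 0 z = z := normShear_one_zero
    have h1 : (1 : ℝ) - w ≠ 0 := by linarith
    simp only [wallShear, sub_zero, zero_mul, add_zero, e, max_add_min]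
    ext
    · simp only; field_simp; ring
    · simp only; ring
  fix t ht x hx y hy hxU := by
    have : 0 < 1 - t + t * l := by nlinarith [ht.1, ht.2, mul_nonneg ht.1 hl.le]
    exact wallShear_of_le hw1 this (not_lt.1 hxU)

/-- The end of the isotopy without slope pushes the second coordinate into the interior. -/
theorem wallShear_shrink {w d : ℝ} (hw1 : w < 1) (hd : 0 < d) {x y : ℝ}
    (hx : x ∈ Icc (0 : ℝ) 1) (hy : y ∈ Icc (0 : ℝ) 1) (hxd : w + (1 - w) * d ≤ x) :
    w + (1 - w) * d ≤ (wallShear w (d / 2) 0 (x, y)).1 ∧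
      (wallShear w (d / 2) 0 (x, y)).2 ∈ Icc (1 / 4 : ℝ) (3 / 4) := by
  have h1 : (0 : ℝ) < 1 - w := by linarith
  obtain ⟨a, rfl⟩ : ∃ a, x = w + (1 - w) * a := ⟨(x - w) / (1 - w), by field_simp; ring⟩
  have had : d ≤ a := by nlinarith
  have ha1 : a ≤ 1 := by have := hx.2; nlinarith
  have ha0 : 0 < a := by linarith
  rw [wallShear_of_ge hw1 (by simp only; nlinarith)]
  have e : (w + (1 - w) * a - w) / (1 - w) = a := by field_simp; ring
  simp only [e]
  set v := 2 * y - 1 with hv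
  have hv1 : |v| ≤ 1 := by rw [abs_le]; constructor <;> [have := hy.1; have := hy.2] <;> linarith
  have hn : ‖planeShear (d / 2) 0 (a, v)‖ = a := by
    simp only [planeShear, Prod.norm_def, zero_mul, add_zero, Real.norm_eq_abs, abs_mul,
      abs_of_pos ha0, abs_of_pos (half_pos hd)]
    apply max_eq_left
    nlinarith [abs_nonneg v]
  have hza : a ≤ ‖((a, v) : ℝ × ℝ)‖ := (le_abs_self a).trans (norm_fst_le (a, v))
  have hz1 : ‖((a, v) : ℝ × ℝ)‖ ≤ 1 := by
    rw [Prod.norm_def]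
    exact max_le (by rw [Real.norm_eq_abs, abs_of_pos ha0]; exact ha1) hv1
  rw [normShear, hn]
  set n := ‖((a, v) : ℝ × ℝ)‖
  have f1 : ((n / a) • planeShear (d / 2) 0 (a, v)).1 = n := by
    simp [planeShear]; field_simp
  have f2 : ((n / a) • planeShear (d / 2) 0 (a, v)).2 = n / a * (d / 2 * v) := by
    simp [planeShear]
  rw [f1, f2]
  refine ⟨by nlinarith, ?_⟩
  have h3 : |n / a * (d / 2 * v)| ≤ 1 / 2 := by
    rw [abs_mul, abs_mul, abs_of_pos (half_pos hd), abs_of_nonneg (by positivity)]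
    have : n / a * d ≤ 1 := by
      rw [div_mul_eq_mul_div, div_le_one ha0]; nlinarith
    have h5 : 0 ≤ n / a * d := by positivity
    nlinarith [abs_nonneg v]
  rw [abs_le] at h3
  constructor <;> linarith

/-- The end of the isotopy with positive slope pushes the first coordinate away from `1`. -/
theorem wallShear_slide {w d : ℝ} (hw1 : w < 1) (hd : 0 < d) {x y : ℝ}
    (hx : x ∈ Icc (0 : ℝ) 1) (hy : y ∈ Icc (0 : ℝ) 1) (hxd : w + (1 - w) * d ≤ x) :
    (wallShear w (d / 2) 2 (x, y)).1 ∈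
      Icc (w + (1 - w) * (2 * d / 5)) (w + (1 - w) * (2 / 3)) := by
  have h1 : (0 : ℝ) < 1 - w := by linarith
  obtain ⟨a, rfl⟩ : ∃ a, x = w + (1 - w) * a := ⟨(x - w) / (1 - w), by field_simp; ring⟩
  have had : d ≤ a := by nlinarith
  have ha1 : a ≤ 1 := by have := hx.2; nlinarith
  have ha0 : 0 < a := by linarith
  rw [wallShear_of_ge hw1 (by simp only; nlinarith)]
  have e : (w + (1 - w) * a - w) / (1 - w) = a := by field_simp; ring
  simp only [e]
  set v := 2 * y - 1 with hv
  have hv1 : |v| ≤ 1 := by rw [abs_le]; constructor <;> [have := hy.1; have := hy.2] <;> linarith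
  have hv2 := abs_le.1 hv1
  have hn : ‖planeShear (d / 2) 2 (a, v)‖ = d / 2 * v + 2 * a := by
    simp only [planeShear, Prod.norm_def, Real.norm_eq_abs, abs_of_pos ha0]
    rw [max_eq_right, abs_of_nonneg]
    · nlinarith
    · rw [abs_of_nonneg] <;> nlinarith
  have hza : a ≤ ‖((a, v) : ℝ × ℝ)‖ := (le_abs_self a).trans (norm_fst_le (a, v))
  have hz1 : ‖((a, v) : ℝ × ℝ)‖ ≤ 1 := by
    rw [Prod.norm_def]
    exact max_le (by rw [Real.norm_eq_abs, abs_of_pos ha0]; exact ha1) hv1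
  rw [normShear, hn]
  set n := ‖((a, v) : ℝ × ℝ)‖
  have hp : 0 < d / 2 * v + 2 * a := by nlinarith
  have f1 : ((n / (d / 2 * v + 2 * a)) • planeShear (d / 2) 2 (a, v)).1
      = n * a / (d / 2 * v + 2 * a) := by
    simp [planeShear]; field_simp
  rw [f1]
  have g1 : 2 * d / 5 ≤ n * a / (d / 2 * v + 2 * a) := by
    rw [le_div_iff₀ hp]
    have : d / 2 * v + 2 * a ≤ 5 / 2 * a := by nlinarith
    nlinarith [mul_le_mul_of_nonneg_left this (by positivity : 0 ≤ 2 * d / 5)]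
  have g2 : n * a / (d / 2 * v + 2 * a) ≤ 2 / 3 := by
    rw [div_le_iff₀ hp]
    nlinarith
  constructor <;> nlinarith

def SquareIsotopy.mono {U V : Set ℝ} (f : SquareIsotopy U) (h : U ⊆ V) : SquareIsotopy V :=
  { f with fix := fun t ht x hx y hy hxV => f.fix t ht x hx y hy fun hxU => hxV (h hxU) }

/-- A monotone map of the line collapsing `[l, u]` to `d`, with support in `[α, β]`. -/
noncomputable def lineCollapse (α β l u d x : ℝ) : ℝ :=
  min x α + (d - α) * max 0 (min 1 ((x - α) / (l - α)))
    + (β - d) * max 0 (min 1 ((x - u) / (β - u))) + max x β - β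

theorem monotone_lineCollapse {α β l u d : ℝ} (hl : α < l) (hu : u < β) (hd : α ≤ d)
    (hd' : d ≤ β) : Monotone (lineCollapse α β l u d) := by
  intro x y hxy
  unfold lineCollapse
  have h1 : 0 < l - α := by linarith
  have h2 : 0 < β - u := by linarith
  have h3 : 0 ≤ d - α := by linarith
  have h4 : 0 ≤ β - d := by linarith
  gcongr

theorem continuous_lineCollapse (α β l u d : ℝ) : Continuous (lineCollapse α β l u d) := by
  unfold lineCollapse; fun_prop

theorem lineCollapse_of_le {α β l u d x : ℝ} (hl : α < l) (hlu : l ≤ u) (hu : u < β) (hx : x ≤ α) :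
    lineCollapse α β l u d x = x := by
  have h1 : (x - α) / (l - α) ≤ 0 := div_nonpos_of_nonpos_of_nonneg (by linarith) (by linarith)
  have h2 : (x - u) / (β - u) ≤ 0 := div_nonpos_of_nonpos_of_nonneg (by linarith) (by linarith)
  rw [lineCollapse, min_eq_left hx, max_eq_right (by linarith : x ≤ β),
    max_eq_left ((min_le_right _ _).trans h1), max_eq_left ((min_le_right _ _).trans h2)]
  ring

theorem lineCollapse_of_ge {α β l u d x : ℝ} (hl : α < l) (hlu : l ≤ u) (hu : u < β) (hx : β ≤ x) :
    lineCollapse α β l u d x = x := by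
  have h1 : 1 ≤ (x - α) / (l - α) := by rw [le_div_iff₀] <;> linarith
  have h2 : 1 ≤ (x - u) / (β - u) := by rw [le_div_iff₀] <;> linarith
  rw [lineCollapse, min_eq_right (by linarith), max_eq_left hx, min_eq_left h1, min_eq_left h2]
  simp

theorem lineCollapse_of_mem {α β l u d x : ℝ} (hl : α < l) (hu : u < β)
    (hx : x ∈ Icc l u) : lineCollapse α β l u d x = d := by
  have h1 : 1 ≤ (x - α) / (l - α) := by rw [le_div_iff₀] <;> linarith [hx.1]
  have h2 : (x - u) / (β - u) ≤ 0 :=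
    div_nonpos_of_nonpos_of_nonneg (by linarith [hx.2]) (by linarith)
  rw [lineCollapse, min_eq_right (by linarith [hx.1] : α ≤ x),
    max_eq_right (by linarith [hx.2] : x ≤ β), min_eq_left h1,
    max_eq_left ((min_le_right _ _).trans h2)]
  simp

theorem bijective_of_strictMono_of_eq_outside {g : ℝ → ℝ} (hg : StrictMono g) (hc : Continuous g)
    {α β : ℝ} (h1 : ∀ x ≤ α, g x = x) (h2 : ∀ x, β ≤ x → g x = x) : Function.Bijective g := by
  refine ⟨hg.injective, hc.surjective ?_ ?_⟩
  · exact tendsto_id.congr' (by filter_upwards [eventually_ge_atTop β] with x hx; simp [h2 x hx])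
  · exact tendsto_id.congr' (by filter_upwards [eventually_le_atBot α] with x hx; simp [h1 x hx])

theorem exists_squareIsotopy_lineCollapse {α β l u d s : ℝ} (hα : 0 < α) (hβ : β < 1) (hl : α < l)
    (hlu : l ≤ u) (hu : u < β) (hd : α ≤ d) (hd' : d ≤ β) (hs : 0 ≤ s) (hs1 : s < 1) :
    ∃ f : SquareIsotopy (Icc α β), ∀ x ∈ Icc l u, ∀ y,
      f.toFun 1 (x, y) = ((1 - s) * x + s * d, y) := by
  set g : ℝ → ℝ → ℝ := fun t x => (1 - t * s) * x + t * s * lineCollapse α β l u d x with hg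
  have g1 : ∀ t x, x ≤ α → g t x = x := fun t x hx => by
    simp only [hg, lineCollapse_of_le hl hlu hu hx]; ring
  have g2 : ∀ t x, β ≤ x → g t x = x := fun t x hx => by
    simp only [hg, lineCollapse_of_ge hl hlu hu hx]; ring
  have hsm : ∀ t ∈ Icc (0 : ℝ) 1, StrictMono (g t) := by
    intro t ht x y hxy
    have h1 := monotone_lineCollapse hl hu hd hd' hxy.le
    have h2 : 0 ≤ t * s := mul_nonneg ht.1 hs
    have h3 : t * s < 1 := by nlinarith [ht.2]
    simp only [hg]
    nlinarith [mul_le_mul_of_nonneg_left h1 h2]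
  have hcc := continuous_lineCollapse α β l u d
  have hc : Continuous fun p : ℝ × ℝ => g p.1 p.2 := by
    simp only [hg]; fun_prop
  have hb : ∀ t ∈ Icc (0 : ℝ) 1, Function.Bijective (g t) := fun t ht =>
    bijective_of_strictMono_of_eq_outside (hsm t ht) (by simp only [hg]; fun_prop) (g1 t) (g2 t)
  have hm : ∀ t ∈ Icc (0 : ℝ) 1, ∀ x, g t x ∈ Icc (0 : ℝ) 1 ↔ x ∈ Icc (0 : ℝ) 1 := by
    intro t ht x
    have e0 := g1 t 0 hα.le
    have e1 := g2 t 1 hβ.le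
    have h0 := (hsm t ht).le_iff_le (a := 0) (b := x)
    have h1 := (hsm t ht).le_iff_le (a := x) (b := 1)
    rw [e0] at h0
    rw [e1] at h1
    rw [mem_Icc, mem_Icc, h0, h1]
  set k : ℝ → ℝ → ℝ := fun t => Function.invFun (g t) with hk
  have hr : ∀ t ∈ Icc (0 : ℝ) 1, ∀ x, g t (k t x) = x := fun t ht =>
    Function.rightInverse_invFun (hb t ht).2
  refine ⟨⟨fun t z => (g t z.1, z.2), fun t z => (k t z.1, z.2), ?_, ?_, ?_, ?_, ?_, ?_, ?_⟩, ?_⟩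
  · have : Continuous fun p : ℝ × ℝ × ℝ => g p.1 p.2.1 :=
      hc.comp (by fun_prop : Continuous fun p : ℝ × ℝ × ℝ => (p.1, p.2.1))
    exact (this.prodMk (by fun_prop)).continuousOn
  · exact fun t ht z hz => ⟨(hm t ht _).2 hz.1, hz.2⟩
  · refine fun t ht z hz => ⟨(hm t ht _).1 ?_, hz.2⟩
    simp only
    rw [hr t ht]; exact hz.1
  · intro t ht z hz
    ext
    · exact (hb t ht).1 (hr t ht _)
    · rfl
  · intro t ht z hz
    ext
    · exact hr t ht _
    · rfl
  · intro z hz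
    ext <;> simp [hg]
  · intro t ht x hx y hy hxU
    have : g t x = x := by
      by_cases h : x ≤ α
      · exact g1 t x h
      · refine g2 t x (not_lt.1 fun h' => hxU ⟨(not_le.1 h).le, h'.le⟩)
    simp [this]
  · intro x hx y
    simp only [hg, one_mul, lineCollapse_of_mem hl hu hx]

/-- A compact interval inside an open interval `U` can be moved, by an isotopy supported by `U`,
into any neighbourhood of a given point of `U`. -/
theorem exists_squareIsotopy_mapsTo {U : Set ℝ} (hU : IsOpen U) (hUc : U.OrdConnected)
    (hU01 : U ⊆ Ioo 0 1) {l u d : ℝ} (hlu : l ≤ u) (hl : l ∈ U) (hu : u ∈ U) (hd : d ∈ U)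
    {V : Set ℝ} (hV : V ∈ 𝓝 d) :
    ∃ f : SquareIsotopy U, ∀ x ∈ Icc l u, ∀ y ∈ Icc (0 : ℝ) 1, (f.toFun 1 (x, y)).1 ∈ V := by
  have hmin : min l d ∈ U := by rcases min_choice l d with h | h <;> rw [h] <;> assumption
  have hmax : max u d ∈ U := by rcases max_choice u d with h | h <;> rw [h] <;> assumption
  obtain ⟨α, hα, hαU⟩ : ∃ α < min l d, α ∈ U :=
    ((eventually_nhdsWithin_of_forall fun _ h => h).and
      (mem_nhdsWithin_of_mem_nhds (hU.mem_nhds hmin))).exists (f := 𝓝[<] (min l d))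
  obtain ⟨β, hβ, hβU⟩ : ∃ β > max u d, β ∈ U :=
    ((eventually_nhdsWithin_of_forall fun _ h => h).and
      (mem_nhdsWithin_of_mem_nhds (hU.mem_nhds hmax))).exists (f := 𝓝[>] (max u d))
  obtain ⟨δ, hδ, hδV⟩ := Metric.mem_nhds_iff.1 hV
  obtain ⟨s, hs0, hs1, hs⟩ : ∃ s : ℝ, 0 ≤ s ∧ s < 1 ∧ 1 - s < δ :=
    ⟨1 - min (δ / 2) (1 / 2), by linarith [min_le_right (δ / 2) (1 / 2)],
      by have : 0 < min (δ / 2) (1 / 2) := by positivity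
         linarith,
      by linarith [min_le_left (δ / 2) (1 / 2)]⟩
  have a1 := (lt_min_iff.1 hα)
  have b1 := (max_lt_iff.1 hβ)
  obtain ⟨f, hf⟩ := exists_squareIsotopy_lineCollapse (hU01 hαU).1 (hU01 hβU).2 a1.1 hlu b1.1
    a1.2.le b1.2.le hs0 hs1
  refine ⟨f.mono (hUc.out hαU hβU), fun x hx y hy => hδV ?_⟩
  change (f.toFun 1 (x, y)).1 ∈ _
  rw [hf x hx, Metric.mem_ball, Real.dist_eq]
  simp only
  rw [show (1 - s) * x + s * d - d = (1 - s) * (x - d) by ring, abs_mul,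
    abs_of_pos (by linarith)]
  have h3 : |x - d| ≤ 1 := by
    have := hU01 hl; have := hU01 hu; have := hU01 hd
    simp only [mem_Icc, mem_Ioo] at *
    rw [abs_le]; constructor <;> linarith
  nlinarith

/-- There is a homeomorphism of the Hilbert cube supported by the box `∏ U i` which moves the
box `∏ K i` into the box `∏ K' i`. -/
def BoxReach (U K K' : ℕ → Set ℝ) : Prop :=
  ∃ T : HilbertCube ≃ₜ HilbertCube, (∀ z, (∃ i, (z i : ℝ) ∉ U i) → T z = z) ∧
    ∀ z, (∀ i, (z i : ℝ) ∈ K i) → ∀ i, (T z i : ℝ) ∈ K' i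

theorem BoxReach.refl (U K : ℕ → Set ℝ) : BoxReach U K K :=
  ⟨Homeomorph.refl _, fun _ _ => rfl, fun _ h => h⟩

theorem BoxReach.trans {U K K' K'' : ℕ → Set ℝ} (h : BoxReach U K K') (h' : BoxReach U K' K'') :
    BoxReach U K K'' := by
  obtain ⟨T, h1, h2⟩ := h
  obtain ⟨T', h1', h2'⟩ := h'
  refine ⟨T.trans T', fun z hz => ?_, fun z hz => h2' _ (h2 z hz)⟩
  rw [Homeomorph.trans_apply, h1 z hz, h1' z hz]

theorem BoxReach.mono {U K K' L L' : ℕ → Set ℝ} (h : BoxReach U K K') (hL : ∀ i, L i ⊆ K i)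
    (hL' : ∀ i, K' i ⊆ L' i) : BoxReach U L L' := by
  obtain ⟨T, h1, h2⟩ := h
  exact ⟨T, h1, fun z hz i => hL' i (h2 z (fun i => hL i (hz i)) i)⟩

theorem exists_bump {ι : Type*} (s : Finset ι) (U K : ι → Set ℝ) (hU : ∀ j ∈ s, IsOpen (U j))
    (hK : ∀ j ∈ s, IsClosed (K j) ∧ K j ⊆ U j) :
    ∃ φ : (ι → ℝ) → ℝ, Continuous φ ∧ (∀ z, φ z ∈ Icc (0 : ℝ) 1) ∧
      (∀ z, (∃ j ∈ s, z j ∉ U j) → φ z = 0) ∧ (∀ z, (∀ j ∈ s, z j ∈ K j) → φ z = 1) ∧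
      ∀ z z', (∀ j ∈ s, z j = z' j) → φ z = φ z' := by
  have : ∀ j, ∃ f : C(ℝ, ℝ), j ∈ s →
      EqOn f 0 (U j)ᶜ ∧ EqOn f 1 (K j) ∧ ∀ x, f x ∈ Icc (0 : ℝ) 1 := by
    intro j
    by_cases hj : j ∈ s
    · obtain ⟨f, hf⟩ := exists_continuous_zero_one_of_isClosed (hU j hj).isClosed_compl (hK j hj).1
        (disjoint_compl_left_iff_subset.2 (hK j hj).2)
      exact ⟨f, fun _ => hf⟩
    · exact ⟨0, fun h => absurd h hj⟩
  choose f hf using this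
  refine ⟨fun z => ∏ j ∈ s, f j (z j), by fun_prop, fun z => ⟨?_, ?_⟩, ?_, ?_, ?_⟩
  · exact Finset.prod_nonneg fun j hj => ((hf j hj).2.2 _).1
  · exact Finset.prod_le_one (fun j hj => ((hf j hj).2.2 _).1) fun j hj => ((hf j hj).2.2 _).2
  · rintro z ⟨j, hj, hz⟩
    exact Finset.prod_eq_zero hj ((hf j hj).1 hz)
  · intro z hz
    exact Finset.prod_eq_one fun j hj => (hf j hj).2.1 (hz j hj)
  · intro z z' h
    exact Finset.prod_congr rfl fun j hj => by rw [h j hj]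

/-- Replace two coordinates of a point of the Hilbert cube. -/
def updatePair (z : HilbertCube) (i q : ℕ) (a : ℝ × ℝ) (ha : a ∈ Icc (0 : ℝ) 1 ×ˢ Icc (0 : ℝ) 1) :
    HilbertCube :=
  Function.update (Function.update z i ⟨a.1, ha.1⟩) q ⟨a.2, ha.2⟩

theorem continuous_updatePair (i q : ℕ) (a : HilbertCube → ℝ × ℝ) (hc : Continuous a)
    (ha : ∀ z, a z ∈ Icc (0 : ℝ) 1 ×ˢ Icc (0 : ℝ) 1) :
    Continuous fun z => updatePair z i q (a z) (ha z) := by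
  unfold updatePair
  exact (continuous_id.update i (hc.fst.subtype_mk _)).update q (hc.snd.subtype_mk _)

theorem boxReach_update_pair {m : ℕ} {U K : ℕ → Set ℝ} (hU : ∀ j ≤ m, IsOpen (U j))
    (hU' : ∀ j, m < j → U j = Set.univ) (hK : ∀ j ≤ m, IsClosed (K j) ∧ K j ⊆ U j)
    {i q : ℕ} (hi : i ≤ m) (hq : m < q) (f : SquareIsotopy (U i)) {A A' : Set ℝ}
    (hf : ∀ x ∈ K i ∩ Icc 0 1, ∀ y ∈ K q ∩ Icc 0 1, f.toFun 1 (x, y) ∈ A ×ˢ A') :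
    BoxReach U K (Function.update (Function.update K i A) q A') := by
  obtain ⟨φ, hφ, hφI, hφ0, hφ1, hφe⟩ := exists_bump ((Finset.range (m + 1)).erase i) U K
    (fun j hj => hU j (by simp at hj; omega)) (fun j hj => hK j (by simp at hj; omega))
  have hiq : i ≠ q := by omega
  set τ : HilbertCube → ℝ := fun z => φ fun j => (z j : ℝ) with hτ
  have hτI : ∀ z, τ z ∈ Icc (0 : ℝ) 1 := fun z => hφI _
  have hsq : ∀ z : HilbertCube, ((z i : ℝ), (z q : ℝ)) ∈ Icc (0 : ℝ) 1 ×ˢ Icc (0 : ℝ) 1 :=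
    fun z => ⟨(z i).2, (z q).2⟩
  set F : HilbertCube → HilbertCube := fun z =>
    updatePair z i q (f.toFun (τ z) (z i, z q)) (f.maps _ (hτI z) _ (hsq z)) with hF
  set G : HilbertCube → HilbertCube := fun z =>
    updatePair z i q (f.inv (τ z) (z i, z q)) (f.maps_inv _ (hτI z) _ (hsq z)) with hG
  have hτu : ∀ z a ha, τ (updatePair z i q a ha) = τ z := by
    intro z a ha
    apply hφe
    intro j hj
    simp only [Finset.mem_erase, Finset.mem_range] at hj
    have : j ≠ q := by omega
    simp [updatePair, hj.1, this]
  have hFc : Continuous F := by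
    refine continuous_updatePair i q _ ?_ _
    refine f.cont.comp_continuous (f := fun z : HilbertCube => (τ z, ((z i : ℝ), (z q : ℝ)))) ?_
      fun z => ⟨hτI z, hsq z⟩
    have : Continuous τ := hφ.comp (by fun_prop)
    fun_prop
  have hup : ∀ z a ha b hb,
      updatePair (updatePair z i q a ha) i q b hb = updatePair z i q b hb := by
    intro z a ha b hb
    simp only [updatePair]
    rw [Function.update_comm hiq, Function.update_idem, Function.update_comm hiq,
      Function.update_idem, Function.update_comm hiq.symm]
  have hself : ∀ z : HilbertCube, updatePair z i q ((z i : ℝ), (z q : ℝ)) (hsq z) = z := by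
    intro z
    simp [updatePair]
  have hpair : ∀ z a ha, (((updatePair z i q a ha i : Icc (0 : ℝ) 1) : ℝ),
      ((updatePair z i q a ha q : Icc (0 : ℝ) 1) : ℝ)) = a := by
    intro z a ha
    simp [updatePair, hiq]
  have hcongr : ∀ z a b ha hb, a = b → updatePair z i q a ha = updatePair z i q b hb := by
    rintro z a b ha hb rfl; rfl
  have hGF : ∀ z, G (F z) = z := by
    intro z
    conv_rhs => rw [← hself z]
    simp only [hG, hF, hup]
    apply hcongr
    rw [hpair, hτu, f.left_inv _ (hτI z) _ (hsq z)]
  have hFG : ∀ z, F (G z) = z := by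
    intro z
    conv_rhs => rw [← hself z]
    simp only [hG, hF, hup]
    apply hcongr
    rw [hpair, hτu, f.right_inv _ (hτI z) _ (hsq z)]
  refine ⟨Continuous.homeoOfEquivCompactToT2 (f := ⟨F, G, hGF, hFG⟩) hFc, ?_, ?_⟩
  · rintro z ⟨j, hj⟩
    change F z = z
    conv_rhs => rw [← hself z]
    apply hcongr
    have hjm : j ≤ m := by
      by_contra h
      rw [hU' j (by omega)] at hj
      exact hj trivial
    by_cases hji : j = i
    · subst hji
      exact f.fix _ (hτI z) _ (z j).2 _ (z q).2 hj
    · have : τ z = 0 := hφ0 _ ⟨j, by simp; omega, hj⟩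
      rw [this, f.zero _ (hsq z)]
  · intro z hz j
    have h1 : τ z = 1 := hφ1 _ fun j hj => hz j
    have h2 := hf _ ⟨hz i, (z i).2⟩ _ ⟨hz q, (z q).2⟩
    change (F z j : ℝ) ∈ _
    simp only [hF, updatePair, h1]
    by_cases hjq : j = q
    · subst hjq
      simpa using h2.2
    · by_cases hji : j = i
      · subst hji
        simpa [hjq] using h2.1
      · simpa [hjq, hji] using hz j

theorem boxReach_of_forall_update {m : ℕ} {U K C : ℕ → Set ℝ} (F : Finset ℕ)
    (hK : ∀ j ≤ m, IsClosed (K j) ∧ K j ⊆ U j) (hC : ∀ j ∈ F, j ≤ m → IsClosed (C j) ∧ C j ⊆ U j)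
    (hstep : ∀ i ∈ F, ∀ K' : ℕ → Set ℝ, (∀ j ≤ m, IsClosed (K' j) ∧ K' j ⊆ U j) → K' i = K i →
      (∀ j ∉ F, K' j = K j) → BoxReach U K' (Function.update K' i (C i))) :
    BoxReach U K (fun i => if i ∈ F then C i else K i) := by
  suffices H : ∀ F' ⊆ F, BoxReach U K (fun i => if i ∈ F' then C i else K i) from
    H F (Finset.Subset.refl F)
  intro F'
  induction F' using Finset.induction_on with
  | empty => intro _; simpa using BoxReach.refl U K
  | insert a s ha ih =>
    intro hs
    rw [Finset.insert_subset_iff] at hs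
    refine (ih hs.2).trans ?_
    have := hstep a hs.1 (fun i => if i ∈ s then C i else K i) ?_ (by simp [ha]) ?_
    · refine this.mono (fun _ => subset_rfl) fun i => ?_
      by_cases hia : i = a
      · subst hia; simp
      · simp [hia]
    · intro j hj
      by_cases hjs : j ∈ s
      · simpa [hjs] using hC j (hs.2 hjs) hj
      · simpa [hjs] using hK j hj
    · intro j hj
      have : j ∉ s := fun h => hj (hs.2 h)
      simp [this]

/-- `U` is an open half line whose end lies in `(0, 1)` and `K` is a smaller closed half line. -/
def IsHalfLinePair (U K : Set ℝ) : Prop :=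
  ∃ w d : ℝ, 0 < w ∧ w < 1 ∧ 0 < d ∧ d ≤ 1 ∧
    ((U = Ioi w ∧ K = Ici (w + (1 - w) * d)) ∨
      (U = {x | 1 - x ∈ Ioi w} ∧ K = {x | 1 - x ∈ Ici (w + (1 - w) * d)}))

/-- `K` is a compact interval inside `U ∩ (0, 1)`. -/
def IsIntervalPair (U K : Set ℝ) : Prop :=
  ∃ l u : ℝ, l ≤ u ∧ 0 < l ∧ u < 1 ∧ l ∈ U ∧ u ∈ U ∧ K = Icc l u

theorem IsHalfLinePair.isClosed_and_subset {U K : Set ℝ} (h : IsHalfLinePair U K) :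
    IsClosed K ∧ K ⊆ U := by
  obtain ⟨w, d, hw0, hw1, hd, hd1, ⟨rfl, rfl⟩ | ⟨rfl, rfl⟩⟩ := h
  · refine ⟨isClosed_Ici, fun x hx => ?_⟩
    simp only [mem_Ici, mem_Ioi] at *
    nlinarith
  · refine ⟨isClosed_Ici.preimage (by fun_prop), fun x hx => ?_⟩
    simp only [mem_Ici, mem_Ioi, mem_ofPred_eq] at *
    nlinarith

theorem IsHalfLinePair.exists_shrink {U K : Set ℝ} (h : IsHalfLinePair U K) :
    ∃ f : SquareIsotopy U, ∀ x ∈ K ∩ Icc 0 1, ∀ y ∈ Icc (0 : ℝ) 1,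
      f.toFun 1 (x, y) ∈ K ×ˢ Icc (1 / 4 : ℝ) (3 / 4) := by
  obtain ⟨w, d, hw0, hw1, hd, hd1, ⟨rfl, rfl⟩ | ⟨rfl, rfl⟩⟩ := h
  · refine ⟨wallIsotopy hw0 hw1 (half_pos hd) 0, fun x hx y hy => ?_⟩
    have := wallShear_shrink hw1 hd hx.2 hy hx.1
    simpa [wallIsotopy] using this
  · refine ⟨(wallIsotopy hw0 hw1 (half_pos hd) 0).flip, fun x hx y hy => ?_⟩
    have := wallShear_shrink (x := 1 - x) hw1 hd (by
      have := hx.2; simp only [mem_Icc] at *; grind) hy hx.1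
    simpa [wallIsotopy, SquareIsotopy.flip] using this

theorem IsHalfLinePair.exists_slide {U K : Set ℝ} (h : IsHalfLinePair U K) :
    ∃ C, IsIntervalPair U C ∧ ∃ f : SquareIsotopy U, ∀ x ∈ K ∩ Icc 0 1, ∀ y ∈ Icc (0 : ℝ) 1,
      (f.toFun 1 (x, y)).1 ∈ C := by
  obtain ⟨w, d, hw0, hw1, hd, hd1, ⟨rfl, rfl⟩ | ⟨rfl, rfl⟩⟩ := h
  · refine ⟨_, ⟨w + (1 - w) * (2 * d / 5), w + (1 - w) * (2 / 3), by nlinarith, by nlinarith,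
      by nlinarith, by simp only [mem_Ioi]; nlinarith, by simp only [mem_Ioi]; nlinarith, rfl⟩,
      wallIsotopy hw0 hw1 (half_pos hd) 2, fun x hx y hy => ?_⟩
    have := wallShear_slide hw1 hd hx.2 hy hx.1
    simpa [wallIsotopy] using this
  · refine ⟨_, ⟨1 - (w + (1 - w) * (2 / 3)), 1 - (w + (1 - w) * (2 * d / 5)), by nlinarith,
      by nlinarith, by nlinarith, by simp only [mem_ofPred_eq, mem_Ioi]; nlinarith,
      by simp only [mem_ofPred_eq, mem_Ioi]; nlinarith, rfl⟩,
      (wallIsotopy hw0 hw1 (half_pos hd) 2).flip, fun x hx y hy => ?_⟩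
    have := wallShear_slide (x := 1 - x) hw1 hd (by
      have := hx.2; simp only [mem_Icc] at *; grind) hy hx.1
    simp only [mem_Icc, SquareIsotopy.flip, wallIsotopy, one_mul, sub_self, zero_add] at *
    constructor <;> linarith

theorem IsIntervalPair.isClosed_and_subset {U K : Set ℝ} (hU : U.OrdConnected)
    (h : IsIntervalPair U K) : IsClosed K ∧ K ⊆ U := by
  obtain ⟨l, u, -, -, -, hl, hu, rfl⟩ := h
  exact ⟨isClosed_Icc, hU.out hl hu⟩

theorem IsIntervalPair.exists_move {U K : Set ℝ} (hUo : IsOpen U) (hU : U.OrdConnected)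
    (h : IsIntervalPair U K) {d : ℝ} (hd : d ∈ U) (hd' : d ∈ Ioo 0 1) {V : Set ℝ} (hV : V ∈ 𝓝 d) :
    ∃ f : SquareIsotopy U, ∀ x ∈ K ∩ Icc 0 1, ∀ y ∈ Icc (0 : ℝ) 1, (f.toFun 1 (x, y)).1 ∈ V := by
  obtain ⟨l, u, hlu, hl0, hu1, hl, hu, rfl⟩ := h
  obtain ⟨f, hf⟩ := exists_squareIsotopy_mapsTo (hUo.inter isOpen_Ioo)
    (hU.inter ordConnected_Ioo) inter_subset_right hlu ⟨hl, hl0, hlu.trans_lt hu1⟩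
    ⟨hu, hl0.trans_le hlu, hu1⟩ ⟨hd, hd'⟩ hV
  exact ⟨f.mono inter_subset_left, fun x hx y hy => hf x hx.1 y hy⟩

theorem dense_forall_mem_Ioo : Dense {z : HilbertCube | ∀ i, (z i : ℝ) ∈ Ioo (0 : ℝ) 1} := by
  have h : Dense ((fun x : Icc (0 : ℝ) 1 => (x : ℝ)) ⁻¹' Ioo 0 1) := by
    have : ((fun x : Icc (0 : ℝ) 1 => (x : ℝ)) ⁻¹' Ioo 0 1) = Ioo 0 1 := by
      ext x
      exact Iff.rfl
    rw [this, dense_iff_closure_eq, closure_Ioo zero_ne_one]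
    exact eq_univ_of_forall fun x => ⟨x.2.1, x.2.2⟩
  have := dense_pi Set.univ fun (i : ℕ) (_ : i ∈ Set.univ) => h
  refine this.mono ?_
  intro z hz i
  exact hz i trivial

theorem exists_homeomorph_cell {m : ℕ} {U K : ℕ → Set ℝ} (hUo : ∀ j ≤ m, IsOpen (U j))
    (hUc : ∀ j ≤ m, (U j).OrdConnected) (hU' : ∀ j, m < j → U j = Set.univ)
    (hK : ∀ j ≤ m, IsIntervalPair (U j) (K j) ∨ IsHalfLinePair (U j) (K j))
    (hKm : IsHalfLinePair (U m) (K m)) (hK' : ∀ j, m < j → K j = Set.univ)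
    {B : Set HilbertCube} (hBo : IsOpen B) (hBd : Dense B) :
    ∃ T : HilbertCube ≃ₜ HilbertCube, (∀ z, (∃ i, (z i : ℝ) ∉ U i) → T z = z) ∧
      ∀ z, (∀ i, (z i : ℝ) ∈ K i) → T z ∈ B := by
  have hKcl : ∀ j ≤ m, IsClosed (K j) ∧ K j ⊆ U j := fun j hj =>
    (hK j hj).elim (fun h => h.isClosed_and_subset (hUc j hj)) fun h => h.isClosed_and_subset
  have hslide : ∀ j, ∃ C, j ≤ m → IsIntervalPair (U j) C ∧ ((∃ f : SquareIsotopy (U j),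
      ∀ x ∈ K j ∩ Icc 0 1, ∀ y ∈ Icc (0 : ℝ) 1, (f.toFun 1 (x, y)).1 ∈ C) ∨ C = K j) := by
    intro j
    by_cases hj : j ≤ m
    · rcases hK j hj with h | h
      · exact ⟨K j, fun _ => ⟨h, Or.inr rfl⟩⟩
      · obtain ⟨C, h1, h2⟩ := h.exists_slide
        exact ⟨C, fun _ => ⟨h1, Or.inl h2⟩⟩
    · exact ⟨∅, fun h => absurd h hj⟩
  choose C hC using hslide
  -- a target point
  obtain ⟨d, hdB, hdU, hd01⟩ : ∃ d ∈ B, (∀ j ≤ m, (d j : ℝ) ∈ U j) ∧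
      ∀ j, (d j : ℝ) ∈ Ioo (0 : ℝ) 1 := by
    have hO : IsOpen {z : HilbertCube | ∀ j ≤ m, (z j : ℝ) ∈ U j} := by
      have : {z : HilbertCube | ∀ j ≤ m, (z j : ℝ) ∈ U j}
          = ⋂ j ∈ Iic m, (fun z : HilbertCube => (z j : ℝ)) ⁻¹' U j := by ext z; simp
      rw [this]
      exact (finite_Iic m).isOpen_biInter fun j hj => (hUo j hj).preimage (by fun_prop)
    have hne : (B ∩ {z : HilbertCube | ∀ j ≤ m, (z j : ℝ) ∈ U j}).Nonempty := by
      rw [inter_comm]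
      refine hBd.inter_open_nonempty _ hO ?_
      have : ∀ j, ∃ x : Icc (0 : ℝ) 1, j ≤ m → (x : ℝ) ∈ U j := by
        intro j
        by_cases hj : j ≤ m
        · obtain ⟨l, u, hlu, hl, hu, hlU, -⟩ := (hC j hj).1
          exact ⟨⟨l, hl.le, (hlu.trans_lt hu).le⟩, fun _ => hlU⟩
        · exact ⟨0, fun h => absurd h hj⟩
      choose x hx using this
      exact ⟨x, fun j hj => hx j hj⟩
    obtain ⟨d, ⟨h1, h2⟩, h3⟩ := dense_forall_mem_Ioo.inter_open_nonempty _ (hBo.inter hO) hne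
    exact ⟨d, h1, h2, h3⟩
  obtain ⟨F, V, hV, hFB⟩ := isOpen_pi_iff.1 hBo d hdB
  obtain ⟨M, hmM, hFM⟩ : ∃ M, m ≤ M ∧ ∀ j ∈ F, j ≤ M :=
    ⟨max m (F.sup id), le_max_left _ _, fun j hj =>
      (Finset.le_sup (f := id) hj).trans (le_max_right _ _)⟩
  have hW : ∀ j, ∃ W : Set ℝ, W ∈ 𝓝 (d j : ℝ) ∧ IsClosed W ∧ (j ≤ m → W ⊆ U j) ∧
      (j ∈ F → ∀ x : Icc (0 : ℝ) 1, (x : ℝ) ∈ W → x ∈ V j) := by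
    intro j
    obtain ⟨N, hN, hNV⟩ : ∃ N ∈ 𝓝 (d j : ℝ),
        j ∈ F → ∀ x : Icc (0 : ℝ) 1, (x : ℝ) ∈ N → x ∈ V j := by
      by_cases hj : j ∈ F
      · have := (hV j hj).1.mem_nhds (hV j hj).2
        rw [nhds_subtype_eq_comap] at this
        obtain ⟨N, hN, hNV⟩ := this
        exact ⟨N, hN, fun _ x hx => hNV hx⟩
      · exact ⟨Set.univ, univ_mem, fun h => absurd h hj⟩
    have hN' : {x | x ∈ N ∧ (j ≤ m → x ∈ U j)} ∈ 𝓝 (d j : ℝ) := by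
      by_cases hj : j ≤ m
      · filter_upwards [hN, (hUo j hj).mem_nhds (hdU j hj)] with x h1 h2 using ⟨h1, fun _ => h2⟩
      · filter_upwards [hN] with x h1 using ⟨h1, fun h => absurd h hj⟩
    obtain ⟨W, hW, hWc, hWN⟩ := exists_mem_nhds_isClosed_subset hN'
    exact ⟨W, hW, hWc, fun hj x hx => (hWN hx).2 hj, fun hj x hx => hNV hj x (hWN hx).1⟩
  choose W hW hWc hWU hWV using hW
  -- push the free coordinates into the interior
  set K₁ : ℕ → Set ℝ := fun j => if j ∈ Finset.Ioc m M then Icc (1 / 4) (3 / 4) else K j with hK₁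
  have r₁ : BoxReach U K K₁ := by
    refine boxReach_of_forall_update (m := m) (C := fun _ => Icc (1 / 4) (3 / 4)) _ hKcl
      (fun j hj hjm => absurd hjm (by simp at hj; omega)) ?_
    intro i hi K' hK'cl hK'i hK'm
    rw [Finset.mem_Ioc] at hi
    obtain ⟨f, hf⟩ := hKm.exists_shrink
    have e : K' m = K m := hK'm m (by simp)
    have := boxReach_update_pair hUo hU' hK'cl le_rfl hi.1 f (A := K' m) (A' := Icc (1 / 4) (3 / 4))
      (fun x hx y hy => by rw [e] at hx ⊢; exact hf x hx y hy.2)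
    rwa [Function.update_eq_self] at this
  -- push the coordinates with one wall into the interior
  set K₂ : ℕ → Set ℝ := fun j => if j ∈ Finset.range (m + 1) then C j else K₁ j with hK₂
  have hM1 : K₁ (M + 1) = Set.univ := by simp [hK₁, hK' (M + 1) (by omega)]
  have e₁ : ∀ j ≤ m, K₁ j = K j := fun j hj => by simp [hK₁, hj]
  have r₂ : BoxReach U K₁ K₂ := by
    refine boxReach_of_forall_update (m := m) _ (fun j hj => by rw [e₁ j hj]; exact hKcl j hj)
      (fun j hj hjm => (hC j hjm).1.isClosed_and_subset (hUc j hjm)) ?_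
    intro i hi K' hK'cl hK'i hK'm
    have him : i ≤ m := by simp at hi; omega
    rw [e₁ i him] at hK'i
    rcases (hC i him).2 with ⟨f, hf⟩ | h
    · have e : K' (M + 1) = Set.univ := by rw [hK'm _ (by simp; omega), hM1]
      have := boxReach_update_pair (q := M + 1) hUo hU' hK'cl him (by omega) f (A := C i)
        (A' := Set.univ) (fun x hx y hy => by rw [hK'i] at hx; exact ⟨hf x hx y hy.2, trivial⟩)
      rwa [← e, Function.update_comm (by omega), Function.update_eq_self] at this
    · rw [h, ← hK'i, Function.update_eq_self]
      exact BoxReach.refl _ _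
  -- move the coordinates to the target
  have hUo' : ∀ j ≤ M, IsOpen (U j) := fun j hj => by
    by_cases h : j ≤ m
    · exact hUo j h
    · rw [hU' j (by omega)]; exact isOpen_univ
  have hUc' : ∀ j ≤ M, (U j).OrdConnected := fun j hj => by
    by_cases h : j ≤ m
    · exact hUc j h
    · rw [hU' j (by omega)]; exact ordConnected_univ
  have hK₂p : ∀ j ≤ M, IsIntervalPair (U j) (K₂ j) := fun j hj => by
    by_cases h : j ≤ m
    · have : K₂ j = C j := by simp [hK₂]; omega
      rw [this]; exact (hC j h).1
    · have : K₂ j = Icc (1 / 4) (3 / 4) := by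
        have h2 : m < j := by omega
        simp [hK₂, hK₁, h2, hj]
      rw [this, hU' j (by omega)]
      exact ⟨1 / 4, 3 / 4, by norm_num, by norm_num, by norm_num, trivial, trivial, rfl⟩
  set K₃ : ℕ → Set ℝ := fun j => if j ∈ Finset.range (M + 1) then W j else K₂ j with hK₃
  have r₃ : BoxReach U K₂ K₃ := by
    refine boxReach_of_forall_update (m := M) _
      (fun j hj => (hK₂p j hj).isClosed_and_subset (hUc' j hj)) (fun j hj hjM => ⟨hWc j, ?_⟩) ?_
    · by_cases h : j ≤ m
      · exact hWU j h
      · rw [hU' j (by omega)]; exact subset_univ _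
    intro i hi K' hK'cl hK'i hK'm
    have hiM : i ≤ M := by simp at hi; omega
    have e : K' (M + 1) = Set.univ := by
      rw [hK'm _ (by simp)]
      have h1 : ¬ M + 1 < m + 1 := by omega
      simp only [hK₂, Finset.mem_range, h1, if_false, hM1]
    have hdi : (d i : ℝ) ∈ U i := by
      by_cases h : i ≤ m
      · exact hdU i h
      · rw [hU' i (by omega)]; trivial
    obtain ⟨f, hf⟩ := (hK₂p i hiM).exists_move (hUo' i hiM) (hUc' i hiM) hdi (hd01 i) (hW i)
    have := boxReach_update_pair (q := M + 1) hUo' (fun j hj => hU' j (by omega)) hK'cl hiM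
      (by omega) f (A := W i) (A' := Set.univ)
      (fun x hx y hy => by rw [hK'i] at hx; exact ⟨hf x hx y hy.2, trivial⟩)
    rwa [← e, Function.update_comm (by omega), Function.update_eq_self] at this
  obtain ⟨T, hT1, hT2⟩ := (r₁.trans r₂).trans r₃
  refine ⟨T, hT1, fun z hz => hFB fun j hj => hWV j hj _ ?_⟩
  have := hT2 z hz j
  have hjM := hFM j hj
  simpa [hK₃, hjM] using this

/-- The embedding `x ↦ (2⁻ⁱ xᵢ)` of the Hilbert cube into the space of bounded sequences. -/
noncomputable def cubeEmb (z : HilbertCube) : BoundedContinuousFunction ℕ ℝ :=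
  BoundedContinuousFunction.ofNormedAddCommGroupDiscrete (fun i => (1 / 2) ^ i * (z i : ℝ)) 1
    fun i => by
      rw [Real.norm_eq_abs, abs_of_nonneg (mul_nonneg (by positivity) (z i).2.1)]
      exact mul_le_one₀ (pow_le_one₀ (by norm_num) (by norm_num)) (z i).2.1 (z i).2.2

/-- The metric `sup 2⁻ⁱ |xᵢ - yᵢ|` of the Hilbert cube. -/
noncomputable def cubeDist (x y : HilbertCube) : ℝ := dist (cubeEmb x) (cubeEmb y)

theorem cubeDist_le_iff {x y : HilbertCube} {c : ℝ} (hc : 0 ≤ c) :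
    cubeDist x y ≤ c ↔ ∀ i, (1 / 2) ^ i * |(x i : ℝ) - y i| ≤ c := by
  rw [cubeDist, BoundedContinuousFunction.dist_le hc]
  refine forall_congr' fun i => ?_
  simp only [cubeEmb, BoundedContinuousFunction.coe_ofNormedAddCommGroupDiscrete, Real.dist_eq,
    ← mul_sub, abs_mul]
  rw [abs_of_nonneg (by positivity : (0 : ℝ) ≤ (1 / 2) ^ i)]

theorem cubeDist_nonneg (x y : HilbertCube) : 0 ≤ cubeDist x y := dist_nonneg

theorem le_of_cubeDist_le {x y : HilbertCube} {c : ℝ} (h : cubeDist x y ≤ c) (i : ℕ) :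
    |(x i : ℝ) - y i| ≤ 2 ^ i * c := by
  have := (cubeDist_le_iff ((cubeDist_nonneg x y).trans h)).1 h i
  rw [one_div, inv_pow] at this
  have h2 : (0 : ℝ) < 2 ^ i := by positivity
  rwa [inv_mul_le_iff₀ h2] at this

theorem isEmbedding_cubeEmb : IsEmbedding cubeEmb := by
  refine (Continuous.isClosedEmbedding ?_ ?_).isEmbedding
  · rw [continuous_iff_continuousAt]
    intro x
    rw [ContinuousAt, Metric.tendsto_nhds]
    intro ε hε
    obtain ⟨N, hN⟩ := exists_pow_lt_of_lt_one (half_pos hε) (by norm_num : (1 / 2 : ℝ) < 1)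
    have : ∀ᶠ y : HilbertCube in 𝓝 x, ∀ i ∈ Finset.range N, |(y i : ℝ) - x i| < ε / 2 := by
      rw [Filter.eventually_all_finset]
      intro i _
      have hc : Continuous fun y : HilbertCube => |(y i : ℝ) - x i| := by fun_prop
      exact hc.continuousAt.eventually_lt continuousAt_const (by simpa using half_pos hε)
    filter_upwards [this] with y hy
    refine lt_of_le_of_lt ?_ (half_lt_self hε)
    refine (cubeDist_le_iff (half_pos hε).le).2 fun i => ?_
    by_cases hi : i < N
    · have h1 := hy i (Finset.mem_range.2 hi)
      have h2 : (1 / 2 : ℝ) ^ i ≤ 1 := pow_le_one₀ (by norm_num) (by norm_num)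
      nlinarith [abs_nonneg ((y i : ℝ) - x i)]
    · have h1 : |(y i : ℝ) - x i| ≤ 1 := by
        have := (y i).2; have := (x i).2
        simp only [mem_Icc] at *
        rw [abs_le]; constructor <;> linarith
      have h2 : (1 / 2 : ℝ) ^ i ≤ (1 / 2) ^ N :=
        pow_le_pow_of_le_one (by norm_num) (by norm_num) (not_lt.1 hi)
      nlinarith [abs_nonneg ((y i : ℝ) - x i)]
  · intro x y h
    have : cubeDist x y ≤ 0 := by rw [cubeDist, h, dist_self]
    ext i
    have h := le_of_cubeDist_le this i
    rw [mul_zero] at h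
    have := abs_nonpos_iff.1 h
    linarith

theorem exists_homeomorph_cube_of_frequently
    (K V : ℕ → Set HilbertCube) (ε : ℕ → ℝ) (hε0 : ∀ k, 0 < ε k)
    (hε : ∀ k, 4 * ε (k + 1) ≤ ε k)
    (hT : ∀ k, ∀ B : Set HilbertCube, IsOpen B → Dense B →
      ∃ T : HilbertCube ≃ₜ HilbertCube, (∀ x, cubeDist (T x) x ≤ ε k) ∧ ∀ x ∈ K k, T x ∈ B)
    (hE : ∀ k j, k ≤ j → ∃ E : HilbertCube ≃ₜ HilbertCube, (∀ x, cubeDist (E x) x ≤ ε k) ∧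
      (∀ i, k ≤ i → i ≤ j → ∀ x ∈ V i, ∀ y, cubeDist y x ≤ 4 * ε (j + 1) → E y ∈ K k) ∧
      ∀ x y, cubeDist x y ≤ 4 * ε (j + 1) → cubeDist (E x) (E y) ≤ 1 / ((j : ℝ) + 1))
    {B : Set HilbertCube} (hB : IsGδ B) (hBd : Dense B) :
    ∃ h : HilbertCube ≃ₜ HilbertCube, ∀ x, (∃ᶠ j in atTop, x ∈ V j) → h x ∈ B := by
  let : MetricSpace HilbertCube := isEmbedding_cubeEmb.comapMetricSpace cubeEmb
  exact exists_homeomorph_mapsTo_of_frequently K V ε hε0 hε hT hE hB hBd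

theorem homeomorph_mem_of_support {X : Type*} [TopologicalSpace X] (T : X ≃ₜ X) {O : Set X}
    (hT : ∀ x ∉ O, T x = x) {x : X} (hx : x ∈ O) : T x ∈ O := by
  by_contra h
  have := T.injective (hT _ h)
  exact h (this.symm ▸ hx)

/-- Finitely many homeomorphisms with disjoint supports can be combined. -/
theorem exists_homeomorph_combine {X ι : Type*} [TopologicalSpace X] (s : Finset ι)
    (O : ι → Set X) (T : ι → X ≃ₜ X) (hT : ∀ i ∈ s, ∀ x ∉ O i, T i x = x)
    (hO : ∀ i ∈ s, ∀ j ∈ s, i ≠ j → Disjoint (O i) (O j)) :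
    ∃ H : X ≃ₜ X, (∀ x, (∀ i ∈ s, x ∉ O i) → H x = x) ∧ ∀ i ∈ s, ∀ x ∈ O i, H x = T i x := by
  classical
  induction s using Finset.induction_on with
  | empty => exact ⟨Homeomorph.refl _, fun _ _ => rfl, by simp⟩
  | insert a s ha ih =>
    obtain ⟨H, h1, h2⟩ := ih (fun i hi => hT i (Finset.mem_insert_of_mem hi))
      fun i hi j hj => hO i (Finset.mem_insert_of_mem hi) j (Finset.mem_insert_of_mem hj)
    have hdis : ∀ i ∈ s, Disjoint (O a) (O i) := fun i hi =>
      hO a (Finset.mem_insert_self _ _) i (Finset.mem_insert_of_mem hi) (by rintro rfl; exact ha hi)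
    refine ⟨H.trans (T a), fun x hx => ?_, fun i hi x hx => ?_⟩
    · rw [Homeomorph.trans_apply, h1 x fun i hi => hx i (Finset.mem_insert_of_mem hi),
        hT a (Finset.mem_insert_self _ _) x (hx a (Finset.mem_insert_self _ _))]
    · rw [Homeomorph.trans_apply]
      rcases Finset.mem_insert.1 hi with rfl | hi'
      · rw [h1 x fun j hj hxj => (hdis j hj).notMem_of_mem_left hx hxj]
      · rw [h2 i hi' x hx]
        refine hT a (Finset.mem_insert_self _ _) _ fun h => ?_
        exact (hdis i hi').notMem_of_mem_left h
          (homeomorph_mem_of_support (T i) (hT i hi) hx)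

/-- The open interval between the walls `A` and the walls `H \ A`. -/
def openCell (H A : Finset ℝ) : Set ℝ := {t | (∀ p ∈ A, p < t) ∧ ∀ p ∈ H, p ∉ A → t < p}

/-- The interval at distance at least `r` from the walls `A` and the walls `H \ A`. -/
def closedCell (H A : Finset ℝ) (r : ℝ) : Set ℝ :=
  {t | (∀ p ∈ A, p + r ≤ t) ∧ ∀ p ∈ H, p ∉ A → t ≤ p - r}

theorem isOpen_openCell (H A : Finset ℝ) : IsOpen (openCell H A) := by
  have : openCell H A = (⋂ p ∈ A, Ioi p) ∩ ⋂ p ∈ H.filter (· ∉ A), Iio p := by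
    ext t; simp [openCell]
  rw [this]
  exact (isOpen_biInter_finset fun _ _ => isOpen_Ioi).inter
    (isOpen_biInter_finset fun _ _ => isOpen_Iio)

theorem ordConnected_openCell (H A : Finset ℝ) : (openCell H A).OrdConnected :=
  ⟨fun _ hx _ hy _ hz => ⟨fun p hp => (hx.1 p hp).trans_le hz.1,
    fun p hp hpA => hz.2.trans_lt (hy.2 p hp hpA)⟩⟩

theorem isHalfLinePair_of_empty {H : Finset ℝ} (hH : H.Nonempty) {r : ℝ} (hr : 0 < r)
    (hHr : ∀ p ∈ H, r < p ∧ p < 1 - r) : IsHalfLinePair (openCell H ∅) (closedCell H ∅ r) := by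
  have hq := hHr _ (H.min'_mem hH)
  set q := H.min' hH with hqd
  have hq0 : 0 < q := hr.trans hq.1
  refine ⟨1 - q, r / q, by linarith, by linarith, by positivity, (div_le_one hq0).2 hq.1.le,
    Or.inr ⟨?_, ?_⟩⟩
  · ext t
    simp only [openCell, Finset.notMem_empty, IsEmpty.forall_iff, implies_true, true_and,
      mem_ofPred_eq, mem_Ioi, forall_const, not_false_eq_true]
    rw [← Finset.lt_min'_iff H hH, ← hqd]
    constructor <;> intro h <;> linarith
  · ext t
    simp only [closedCell, Finset.notMem_empty, IsEmpty.forall_iff, implies_true, true_and,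
      mem_ofPred_eq, mem_Ici, forall_const, not_false_eq_true]
    have e : 1 - q + (1 - (1 - q)) * (r / q) = 1 - q + r := by field_simp; ring
    rw [e]
    constructor
    · intro h; have := h q (H.min'_mem hH); linarith
    · intro h p hp; have := H.min'_le p hp; linarith

theorem isHalfLinePair_self {H : Finset ℝ} (hH : H.Nonempty) {r : ℝ} (hr : 0 < r)
    (hHr : ∀ p ∈ H, r < p ∧ p < 1 - r) : IsHalfLinePair (openCell H H) (closedCell H H r) := by
  have hq := hHr _ (H.max'_mem hH)
  set q := H.max' hH with hqd
  have hq1 : 0 < 1 - q := by linarith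
  refine ⟨q, r / (1 - q), by linarith, by linarith, by positivity,
    (div_le_one hq1).2 (by linarith), Or.inl ⟨?_, ?_⟩⟩
  · ext t
    exact ⟨fun h => h.1 q (H.max'_mem hH), fun h => ⟨fun p hp => (H.le_max' p hp).trans_lt h,
      fun p hp hp' => absurd hp hp'⟩⟩
  · ext t
    have e : q + (1 - q) * (r / (1 - q)) = q + r := by field_simp
    rw [e]
    refine ⟨fun h => h.1 q (H.max'_mem hH), fun h => ⟨fun p hp => ?_,
      fun p hp hp' => absurd hp hp'⟩⟩
    have := H.le_max' p hp
    simp only [mem_Ici] at h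
    linarith

theorem isIntervalPair_cell {H A : Finset ℝ} (hA : A ⊆ H) (hA0 : A.Nonempty) (hA1 : A ≠ H) {r : ℝ}
    (hr : 0 < r) (hHr : ∀ p ∈ H, r < p ∧ p < 1 - r)
    (hsep : ∀ p ∈ A, ∀ q ∈ H, q ∉ A → p + r ≤ q - r) :
    IsIntervalPair (openCell H A) (closedCell H A r) := by
  have hne : (H.filter (· ∉ A)).Nonempty := by
    by_contra h
    rw [Finset.not_nonempty_iff_eq_empty, Finset.filter_eq_empty_iff] at h
    exact hA1 (hA.antisymm fun p hp => by simpa using h hp)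
  have hp := A.max'_mem hA0
  have hq := Finset.mem_filter.1 ((H.filter (· ∉ A)).min'_mem hne)
  have hple := A.le_max'
  have hqle := (H.filter (· ∉ A)).min'_le
  set p := A.max' hA0
  set q := (H.filter (· ∉ A)).min' hne
  have h1 := hsep p hp q hq.1 hq.2
  have h2 := hHr p (hA hp)
  have h3 := hHr q hq.1
  have hpA : ∀ t, (∀ x ∈ A, x + r ≤ t) ↔ p + r ≤ t := fun t =>
    ⟨fun h => h p hp, fun h x hx => by have := hple x hx; linarith⟩
  have hqA : ∀ t, (∀ x ∈ H, x ∉ A → t ≤ x - r) ↔ t ≤ q - r := fun t =>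
    ⟨fun h => h q hq.1 hq.2, fun h x hx hxA => by
      have := hqle x (Finset.mem_filter.2 ⟨hx, hxA⟩); linarith⟩
  refine ⟨p + r, q - r, h1, by linarith, by linarith, ⟨fun x hx => ?_, fun x hx hxA => ?_⟩,
    ⟨fun x hx => ?_, fun x hx hxA => ?_⟩, ?_⟩
  · have := hple x hx; linarith
  · have := hqle x (Finset.mem_filter.2 ⟨hx, hxA⟩); linarith
  · have := hple x hx; linarith
  · have := hqle x (Finset.mem_filter.2 ⟨hx, hxA⟩); linarith
  · ext t
    simp only [closedCell, mem_ofPred_eq, mem_Icc, hpA, hqA]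

/-- The walls of a grid: `G` in the coordinates below `m` and the single wall `c` in the
coordinate `m`. -/
def gridWalls (m : ℕ) (G : Finset ℝ) (c : ℝ) (i : ℕ) : Finset ℝ :=
  if i < m then G else if i = m then {c} else ∅

theorem exists_homeomorph_grid {m : ℕ} {G : Finset ℝ} {c r ε : ℝ} (hc : c ∈ G) (hr : 0 < r)
    (hGr : ∀ p ∈ G, r < p ∧ p < 1 - r) (hsep : ∀ p ∈ G, ∀ q ∈ G, p < q → p + r ≤ q - r)
    (hmε : (1 / 2) ^ m ≤ ε)
    (hGε : ∀ s ∈ Icc (0 : ℝ) 1, ∀ t ∈ Icc (0 : ℝ) 1, (∀ p ∈ G, p < s ↔ p < t) → |s - t| ≤ ε)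
    {B : Set HilbertCube} (hBo : IsOpen B) (hBd : Dense B) :
    ∃ T : HilbertCube ≃ₜ HilbertCube, (∀ x, cubeDist (T x) x ≤ ε) ∧
      ∀ x : HilbertCube, (∀ i, ∀ p ∈ gridWalls m G c i, r ≤ |(x i : ℝ) - p|) → T x ∈ B := by
  classical
  have hε0 : 0 ≤ ε := le_trans (by positivity) hmε
  set H := gridWalls m G c with hH
  have hHG : ∀ i, H i ⊆ G := fun i p hp => by
    simp only [hH, gridWalls] at hp
    split_ifs at hp
    · exact hp
    · rw [Finset.mem_singleton] at hp; rwa [hp]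
    · simp at hp
  have hHlt : ∀ i, i < m → H i = G := fun i hi => by simp [hH, gridWalls, hi]
  have hHm : H m = {c} := by simp [hH, gridWalls]
  have hHgt : ∀ i, m < i → H i = ∅ := fun i hi => by
    have h1 : ¬ i < m := by omega
    have h2 : i ≠ m := by omega
    simp [hH, gridWalls, h1, h2]
  have hHne : ∀ i ≤ m, (H i).Nonempty := fun i hi => by
    rcases hi.lt_or_eq with h | rfl
    · rw [hHlt i h]; exact ⟨c, hc⟩
    · rw [hHm]; simp
  let S : Finset (Fin (m + 1) → Finset ℝ) := Fintype.piFinset fun i => (H i).powerset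
  let ext : (Fin (m + 1) → Finset ℝ) → ℕ → Finset ℝ := fun a i =>
    if h : i < m + 1 then a ⟨i, h⟩ else ∅
  have hext : ∀ a ∈ S, ∀ i, ext a i ⊆ H i := by
    intro a ha i
    by_cases h : i < m + 1
    · have := Fintype.mem_piFinset.1 ha ⟨i, h⟩
      simp only [ext, dif_pos h]
      simpa using this
    · simp only [ext, dif_neg h]
      exact Finset.empty_subset _
  let O : (Fin (m + 1) → Finset ℝ) → Set HilbertCube := fun a =>
    {z | ∀ i, (z i : ℝ) ∈ openCell (H i) (ext a i)}
  have key : ∀ a, ∃ T : HilbertCube ≃ₜ HilbertCube, a ∈ S → (∀ z ∉ O a, T z = z) ∧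
      ∀ z : HilbertCube, (∀ i, (z i : ℝ) ∈ closedCell (H i) (ext a i) r) → T z ∈ B := by
    intro a
    by_cases ha : a ∈ S
    swap
    · exact ⟨Homeomorph.refl _, fun h => absurd h ha⟩
    by_cases hne : ∃ z : HilbertCube, ∀ i, (z i : ℝ) ∈ closedCell (H i) (ext a i) r
    swap
    · exact ⟨Homeomorph.refl _, fun _ => ⟨fun _ _ => rfl, fun z hz => absurd ⟨z, hz⟩ hne⟩⟩
    obtain ⟨z0, hz0⟩ := hne
    have hHr : ∀ i, ∀ p ∈ H i, r < p ∧ p < 1 - r := fun i p hp => hGr p (hHG i hp)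
    have hhalf : ∀ i ≤ m, (ext a i = ∅ ∨ ext a i = H i) →
        IsHalfLinePair (openCell (H i) (ext a i)) (closedCell (H i) (ext a i) r) := by
      rintro i hi (h | h)
      · rw [h]; exact isHalfLinePair_of_empty (hHne i hi) hr (hHr i)
      · rw [h]; exact isHalfLinePair_self (hHne i hi) hr (hHr i)
    obtain ⟨T, h1, h2⟩ := exists_homeomorph_cell (m := m)
      (U := fun i => openCell (H i) (ext a i)) (K := fun i => closedCell (H i) (ext a i) r)
      (fun j _ => isOpen_openCell _ _) (fun j _ => ordConnected_openCell _ _)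
      (fun j hj => by
        have : ext a j = ∅ := by have := hext a ha j; rw [hHgt j hj] at this; simpa using this
        simp only [hHgt j hj, this]
        ext t; simp [openCell])
      (fun j hj => by
        by_cases h : ext a j = ∅ ∨ ext a j = H j
        · exact Or.inr (hhalf j hj h)
        · push Not at h
          refine Or.inl (isIntervalPair_cell (hext a ha j) h.1 h.2 hr
            (hHr j) fun p hp q hq hqA => hsep p (hHG j (hext a ha j hp)) q (hHG j hq) ?_)
          have e1 := (hz0 j).1 p hp
          have e2 := (hz0 j).2 q hq hqA
          linarith)
      (hhalf m le_rfl (by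
        have := hext a ha m
        rw [hHm] at this ⊢
        exact Finset.subset_singleton_iff.1 this))
      (fun j hj => by
        have : ext a j = ∅ := by have := hext a ha j; rw [hHgt j hj] at this; simpa using this
        simp only [hHgt j hj, this]
        ext t; simp [closedCell])
      hBo hBd
    refine ⟨T, fun _ => ⟨fun z hz => h1 z ?_, h2⟩⟩
    simpa [O] using hz
  choose T hT using key
  obtain ⟨F, hF1, hF2⟩ := exists_homeomorph_combine S O T (fun a ha => (hT a ha).1) (by
    intro a ha b hb hab
    rw [Set.disjoint_left]
    intro z hza hzb
    apply hab
    funext i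
    have e : ∀ a, ext a i = a i := fun a => by simp only [ext, dif_pos i.2]
    have hsub : ∀ a b, a ∈ S → z ∈ O a → z ∈ O b → a i ⊆ b i := by
      intro a b ha hza hzb p hp
      by_contra hpb
      rw [← e a] at hp
      rw [← e b] at hpb
      exact lt_asymm ((hza i).1 p hp) ((hzb i).2 p (hext a ha i hp) hpb)
    exact (hsub a b ha hza hzb).antisymm (hsub b a hb hzb hza))
  refine ⟨F, fun x => ?_, fun x hx => ?_⟩
  · by_cases hx : ∃ a ∈ S, x ∈ O a
    · obtain ⟨a, ha, hxa⟩ := hx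
      have hFx : F x ∈ O a := by
        rw [hF2 a ha x hxa]
        exact homeomorph_mem_of_support _ (hT a ha).1 hxa
      refine (cubeDist_le_iff hε0).2 fun i => ?_
      rcases lt_or_ge i m with hi | hi
      · have h1 : (1 / 2 : ℝ) ^ i ≤ 1 := pow_le_one₀ (by norm_num) (by norm_num)
        have h2 : |(F x i : ℝ) - x i| ≤ ε := by
          refine hGε _ (F x i).2 _ (x i).2 fun p hp => ?_
          rw [← hHlt i hi] at hp
          by_cases hpa : p ∈ ext a i
          · exact iff_of_true ((hFx i).1 p hpa) ((hxa i).1 p hpa)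
          · exact iff_of_false ((hFx i).2 p hp hpa).not_gt ((hxa i).2 p hp hpa).not_gt
        nlinarith [abs_nonneg ((F x i : ℝ) - x i)]
      · have h1 : (1 / 2 : ℝ) ^ i ≤ (1 / 2) ^ m :=
          pow_le_pow_of_le_one (by norm_num) (by norm_num) hi
        have h2 : |(F x i : ℝ) - x i| ≤ 1 := by
          have := (F x i).2; have := (x i).2
          simp only [mem_Icc] at *
          rw [abs_le]; constructor <;> linarith
        have h3 : (0 : ℝ) ≤ (1 / 2) ^ i := by positivity
        nlinarith [abs_nonneg ((F x i : ℝ) - x i)]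
    · push Not at hx
      rw [hF1 x hx]
      exact (cubeDist_le_iff hε0).2 fun i => by simpa using hε0
  · let a : Fin (m + 1) → Finset ℝ := fun i => (H i).filter (· < (x i : ℝ))
    have ha : a ∈ S := Fintype.mem_piFinset.2 fun i =>
      Finset.mem_powerset.2 (Finset.filter_subset _ _)
    have hcl : ∀ i, (x i : ℝ) ∈ closedCell (H i) (ext a i) r := by
      intro i
      by_cases hi : i < m + 1
      · have e : ext a i = (H i).filter (· < (x i : ℝ)) := by
          simp only [ext, a, dif_pos hi]
        rw [e]
        refine ⟨fun p hp => ?_, fun p hp hpA => ?_⟩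
        · have h1 := hx i p (Finset.mem_filter.1 hp).1
          rw [abs_of_pos (by linarith [(Finset.mem_filter.1 hp).2])] at h1
          linarith
        · have h1 := hx i p hp
          have h2 : (x i : ℝ) ≤ p := not_lt.1 fun h => hpA (Finset.mem_filter.2 ⟨hp, h⟩)
          rw [abs_of_nonpos (by linarith)] at h1
          linarith
      · rw [hHgt i (by omega)]
        simp only [ext, dif_neg hi]
        simp [closedCell]
    have hO : x ∈ O a := fun i => ⟨fun p hp => by linarith [(hcl i).1 p hp],
      fun p hp hpA => by linarith [(hcl i).2 p hp hpA]⟩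
    rw [hF2 a ha x hO]
    exact (hT a ha).2 x hcl

/-- An increasing map of the line, linear near `0` and fixing all points at distance at least `2r`
from `0`. -/
noncomputable def stretch (R r s : ℝ) : ℝ :=
  max (min s (max (R * s) (-r + s / 2))) (min (R * s) (r + s / 2))

theorem continuous_stretch (R r : ℝ) : Continuous (stretch R r) := by
  unfold stretch; fun_prop

theorem strictMono_stretch {R : ℝ} (r : ℝ) (hR : 1 ≤ R) : StrictMono (stretch R r) := by
  intro s t hst
  have h1 : R * s < R * t := by nlinarith
  exact max_lt_max (min_lt_min hst (max_lt_max h1 (by linarith))) (min_lt_min h1 (by linarith))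

theorem stretch_of_nonneg {R r s : ℝ} (hR : 1 ≤ R) (hs : 0 ≤ s) :
    stretch R r s = max s (min (R * s) (r + s / 2)) := by
  have h : s ≤ R * s := by nlinarith
  rw [stretch, min_eq_left (h.trans (le_max_left _ _))]

theorem stretch_of_nonpos {R r s : ℝ} (hR : 1 ≤ R) (hs : s ≤ 0) :
    stretch R r s = min s (max (R * s) (-r + s / 2)) := by
  have h : R * s ≤ s := by nlinarith
  rw [stretch, max_eq_left]
  exact (min_le_left _ _).trans (le_min h (le_max_left _ _))

theorem stretch_eq_self {R r s : ℝ} (hR : 1 ≤ R) (hs : 2 * r ≤ |s|) : stretch R r s = s := by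
  rcases le_total 0 s with h | h
  · rw [abs_of_nonneg h] at hs
    rw [stretch_of_nonneg hR h, max_eq_left]
    exact (min_le_right _ _).trans (by linarith)
  · rw [abs_of_nonpos h] at hs
    rw [stretch_of_nonpos hR h, min_eq_left]
    exact le_trans (by linarith) (le_max_right _ _)

theorem abs_stretch_le {R r s : ℝ} (hR : 1 ≤ R) (hr : 0 ≤ r) (hs : |s| ≤ 2 * r) :
    |stretch R r s| ≤ 2 * r := by
  rw [abs_le] at hs ⊢
  have h1 : |2 * r| = 2 * r := abs_of_nonneg (by linarith)
  have e1 := stretch_eq_self (R := R) (r := r) (s := 2 * r) hR h1.ge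
  have e2 := stretch_eq_self (R := R) (r := r) (s := -(2 * r)) hR (by rw [abs_neg, h1])
  have := (strictMono_stretch r hR).monotone hs.1
  have := (strictMono_stretch r hR).monotone hs.2
  constructor <;> linarith

theorem le_abs_stretch {R r s : ℝ} (hR : 1 ≤ R) (hs : r ≤ R * |s|) : r ≤ |stretch R r s| := by
  rcases le_total 0 s with h | h
  · rw [abs_of_nonneg h] at hs
    rw [stretch_of_nonneg hR h]
    exact (le_trans (le_min hs (by linarith)) (le_max_right _ _)).trans (le_abs_self _)
  · rw [abs_of_nonpos h] at hs
    rw [stretch_of_nonpos hR h]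
    refine le_trans ?_ (neg_le_abs _)
    rw [le_neg]
    exact (min_le_right _ _).trans (max_le (by linarith) (by linarith))

theorem abs_stretch_sub_le {R r : ℝ} (hR : 1 ≤ R) (s t : ℝ) :
    |stretch R r s - stretch R r t| ≤ R * |s - t| := by
  have h0 := abs_nonneg (s - t)
  have h1 : |R * s - R * t| = R * |s - t| := by
    rw [← mul_sub, abs_mul, abs_of_nonneg (by linarith : (0 : ℝ) ≤ R)]
  have h2 : |(-r + s / 2) - (-r + t / 2)| ≤ R * |s - t| := by
    rw [show (-r + s / 2) - (-r + t / 2) = (s - t) / 2 by ring, abs_div, abs_two]; nlinarith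
  have h3 : |(r + s / 2) - (r + t / 2)| ≤ R * |s - t| := by
    rw [show (r + s / 2) - (r + t / 2) = (s - t) / 2 by ring, abs_div, abs_two]; nlinarith
  have h4 : |s - t| ≤ R * |s - t| := by nlinarith
  refine (abs_max_sub_max_le_max _ _ _ _).trans (max_le ?_ ?_)
  · refine (abs_min_sub_min_le_max _ _ _ _).trans (max_le h4 ?_)
    exact (abs_max_sub_max_le_max _ _ _ _).trans (max_le h1.le h2)
  · exact (abs_min_sub_min_le_max _ _ _ _).trans (max_le h1.le h3)

theorem exists_homeomorph_stretch {p r R : ℝ} (hr : 0 < r) (hR : 1 ≤ R) (hp : 2 * r < p)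
    (hp1 : p < 1 - 2 * r) :
    ∃ e : Icc (0 : ℝ) 1 ≃ₜ Icc (0 : ℝ) 1, ∀ x, (e x : ℝ) = p + stretch R r (x - p) := by
  have h0 : stretch R r (0 - p) = 0 - p := stretch_eq_self hR (by
    rw [abs_of_neg (by linarith)]; linarith)
  have h1 : stretch R r (1 - p) = 1 - p := stretch_eq_self hR (by
    rw [abs_of_pos (by linarith)]; linarith)
  have hm := strictMono_stretch r hR
  let f : Icc (0 : ℝ) 1 → Icc (0 : ℝ) 1 := fun x => ⟨p + stretch R r (x - p), by
    have ha := hm.monotone (sub_le_sub_right x.2.1 p)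
    have hb := hm.monotone (sub_le_sub_right x.2.2 p)
    constructor <;> linarith⟩
  have hf : StrictMono f := fun x y hxy => by
    have := hm (sub_lt_sub_right (show (x : ℝ) < y from hxy) p)
    show p + stretch R r (x - p) < p + stretch R r (y - p)
    linarith
  have hfc : Continuous f := Continuous.subtype_mk
    (continuous_const.add ((continuous_stretch R r).comp (by fun_prop))) _
  have hsurj : Function.Surjective f := by
    intro y
    refine mem_range_of_exists_le_of_exists_ge hfc ⟨⟨0, by simp⟩, ?_⟩ ⟨⟨1, by simp⟩, ?_⟩
    · show p + stretch R r (0 - p) ≤ y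
      rw [h0]; linarith [y.2.1]
    · show (y : ℝ) ≤ p + stretch R r (1 - p)
      rw [h1]; linarith [y.2.2]
  exact ⟨(hf.orderIsoOfSurjective f hsurj).toHomeomorph, fun x => rfl⟩

theorem exists_homeomorph_stretch_finset {r R : ℝ} (hr : 0 < r) (hR : 1 ≤ R) (G : Finset ℝ)
    (hG : ∀ p ∈ G, 2 * r < p ∧ p < 1 - 2 * r)
    (hsep : ∀ p ∈ G, ∀ q ∈ G, p ≠ q → 4 * r ≤ |p - q|) :
    ∃ e : Icc (0 : ℝ) 1 ≃ₜ Icc (0 : ℝ) 1,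
      (∀ x : Icc (0 : ℝ) 1, (∀ q ∈ G, 2 * r ≤ |(x : ℝ) - q|) → e x = x) ∧
      (∀ x, e x = x ∨ ∃ q ∈ G, |(x : ℝ) - q| ≤ 2 * r ∧ |(e x : ℝ) - q| ≤ 2 * r) ∧
      (∀ x : Icc (0 : ℝ) 1, ∀ q ∈ G, r ≤ R * |(x : ℝ) - q| → r ≤ |(e x : ℝ) - q|) ∧
      ∀ x y : Icc (0 : ℝ) 1, |(e x : ℝ) - e y| ≤ R ^ G.card * |(x : ℝ) - y| := by
  classical
  induction G using Finset.induction_on with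
  | empty => exact ⟨Homeomorph.refl _, by simp, by simp, by simp, by simp⟩
  | insert p G hpG ih =>
    obtain ⟨E, E1, E2, E3, E4⟩ := ih (fun q hq => hG q (Finset.mem_insert_of_mem hq))
      fun q hq q' hq' => hsep q (Finset.mem_insert_of_mem hq) q' (Finset.mem_insert_of_mem hq')
    obtain ⟨e, he⟩ := exists_homeomorph_stretch hr hR (hG p (Finset.mem_insert_self _ _)).1
      (hG p (Finset.mem_insert_self _ _)).2
    have hep : ∀ x, (e x : ℝ) - p = stretch R r (x - p) := fun x => by rw [he]; ring
    have hfar : ∀ x : Icc (0 : ℝ) 1, 2 * r ≤ |(x : ℝ) - p| → e x = x := fun x hx => by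
      apply Subtype.ext
      rw [he, stretch_eq_self hR hx]; ring
    have hpq : ∀ q ∈ G, 4 * r ≤ |p - q| := fun q hq =>
      hsep p (Finset.mem_insert_self _ _) q (Finset.mem_insert_of_mem hq)
        (by rintro rfl; exact hpG hq)
    have haway : ∀ t : ℝ, ∀ q ∈ G, |t - p| ≤ 2 * r → 2 * r ≤ |t - q| := fun t q hq ht => by
      have h1 := hpq q hq
      have h2 := abs_sub_le p t q
      rw [abs_sub_comm p t] at h2
      linarith
    have haway' : ∀ t : ℝ, ∀ q ∈ G, |t - q| ≤ 2 * r → 2 * r ≤ |t - p| := fun t q hq ht => by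
      have h1 := hpq q hq
      have h2 := abs_sub_le p t q
      rw [abs_sub_comm p t] at h2
      linarith
    have hnear : ∀ x : Icc (0 : ℝ) 1, |(x : ℝ) - p| ≤ 2 * r → |(e x : ℝ) - p| ≤ 2 * r ∧
        E (e x) = e x := fun x hx => by
      have h1 : |(e x : ℝ) - p| ≤ 2 * r := by rw [hep]; exact abs_stretch_le hR hr.le hx
      exact ⟨h1, E1 _ fun q hq => haway _ q hq h1⟩
    refine ⟨e.trans E, fun x hx => ?_, fun x => ?_, fun x q hq hxq => ?_, fun x y => ?_⟩
    · rw [Homeomorph.trans_apply, hfar x (hx p (Finset.mem_insert_self _ _))]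
      exact E1 x fun q hq => hx q (Finset.mem_insert_of_mem hq)
    · rw [Homeomorph.trans_apply]
      rcases le_total (|(x : ℝ) - p|) (2 * r) with h | h
      · rw [(hnear x h).2]
        exact Or.inr ⟨p, Finset.mem_insert_self _ _, h, (hnear x h).1⟩
      · rw [hfar x h]
        refine (E2 x).imp id ?_
        rintro ⟨q, hq, h'⟩
        exact ⟨q, Finset.mem_insert_of_mem hq, h'⟩
    · rw [Homeomorph.trans_apply]
      rcases le_total (|(x : ℝ) - p|) (2 * r) with h | h
      · rw [(hnear x h).2]
        rcases Finset.mem_insert.1 hq with rfl | hq'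
        · rw [hep]; exact le_abs_stretch hR hxq
        · have := haway _ q hq' (hnear x h).1; linarith
      · rw [hfar x h]
        rcases Finset.mem_insert.1 hq with rfl | hq'
        · rcases E2 x with h' | ⟨q', hq', _, h'⟩
          · rw [h']; linarith
          · have := haway' _ q' hq' h'; linarith
        · exact E3 x q hq' hxq
    · rw [Homeomorph.trans_apply, Homeomorph.trans_apply, Finset.card_insert_of_notMem hpG]
      refine (E4 _ _).trans ?_
      rw [pow_succ, mul_assoc]
      refine mul_le_mul_of_nonneg_left ?_ (by positivity)
      have := abs_stretch_sub_le (r := r) hR (x - p) (y - p)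
      rw [he, he]
      rwa [show p + stretch R r (x - p) - (p + stretch R r (y - p)) =
        stretch R r (x - p) - stretch R r (y - p) by ring,
        show (x : ℝ) - y = x - p - (y - p) by ring]

/-- The data of a minimal dense `Gδ`-set: walls `G k` in the first `m k + 1` coordinates, with
neighbourhoods of radius `η k`. -/
structure GridScheme where
  m : ℕ → ℕ
  G : ℕ → Finset ℝ
  η : ℕ → ℝ
  ε : ℕ → ℝ
  mono_m : Monotone m
  mono_G : Monotone G
  anti_η : Antitone η
  η_pos : ∀ k, 0 < η k
  η_le : ∀ k, η k ≤ 1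
  G_nonempty : ∀ k, (G k).Nonempty
  G_mem : ∀ k, ∀ p ∈ G k, 0 < p ∧ p < 1
  ε_pos : ∀ k, 0 < ε k
  ε_succ : ∀ k, 4 * ε (k + 1) ≤ ε k
  m_large : ∀ k, (1 / 2) ^ m k ≤ ε k
  G_fine : ∀ k, ∀ s ∈ Icc (0 : ℝ) 1, ∀ t ∈ Icc (0 : ℝ) 1, (∀ p ∈ G k, p < s ↔ p < t) →
    |s - t| ≤ ε k
  ε_η : ∀ k, 2 ^ m k * (4 * ε (k + 1)) ≤ η k / 2
  ε_lip : ∀ k, (2 / η k) ^ (G k).card * (4 * ε (k + 1)) ≤ 1 / ((k : ℝ) + 1)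

namespace GridScheme

variable (σ : GridScheme)

/-- The points that are `η j`-far from the walls at stage `j`. -/
def window (j : ℕ) : Set HilbertCube :=
  {x | ∀ i ≤ σ.m j, ∀ p ∈ σ.G j, σ.η j < |(x i : ℝ) - p|}

/-- The points belonging to infinitely many windows. -/
def limsupSet : Set HilbertCube := {x | ∃ᶠ j in atTop, x ∈ σ.window j}

theorem exists_homeomorph_of_isGδ {B : Set HilbertCube} (hB : IsGδ B) (hBd : Dense B) :
    ∃ h : HilbertCube ≃ₜ HilbertCube, h '' σ.limsupSet ⊆ B := by
  have hr : ∀ k, ∃ r : ℝ, 0 < r ∧ 4 * r ≤ σ.ε k ∧ (∀ p ∈ σ.G k, 2 * r < p ∧ p < 1 - 2 * r) ∧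
      ∀ p ∈ σ.G k, ∀ q ∈ σ.G k, p ≠ q → 4 * r ≤ |p - q| := by
    intro k
    have hlt : ∀ a : ℝ, 0 < a → ∀ᶠ r : ℝ in 𝓝[>] 0, 4 * r ≤ a := fun a ha => by
      filter_upwards [Ioo_mem_nhdsGT (show (0 : ℝ) < a / 4 by linarith)] with r hr
      linarith [hr.2]
    have : ∀ᶠ r : ℝ in 𝓝[>] 0, 0 < r ∧ 4 * r ≤ σ.ε k ∧
        (∀ p ∈ σ.G k, 2 * r < p ∧ p < 1 - 2 * r) ∧
        ∀ p ∈ σ.G k, ∀ q ∈ σ.G k, p ≠ q → 4 * r ≤ |p - q| := by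
      refine eventually_mem_nhdsWithin.and ((hlt _ (σ.ε_pos k)).and (Eventually.and ?_ ?_))
      · rw [Filter.eventually_all_finset]
        intro p hp
        filter_upwards [hlt p (σ.G_mem k p hp).1, hlt (1 - p) (by linarith [(σ.G_mem k p hp).2]),
          self_mem_nhdsWithin] with r h1 h2 (h3 : 0 < r)
        constructor <;> linarith
      · rw [Filter.eventually_all_finset]
        intro p hp
        rw [Filter.eventually_all_finset]
        intro q hq
        by_cases hpq : p = q
        · simp [hpq]
        · filter_upwards [hlt |p - q| (abs_pos.2 (sub_ne_zero.2 hpq))] with r h _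
          exact h
    exact this.exists
  choose r hr0 hrε hrG hrsep using hr
  choose c hc using σ.G_nonempty
  have hGsub : ∀ k i, gridWalls (σ.m k) (σ.G k) (c k) i ⊆ σ.G k := fun k i p hp => by
    simp only [gridWalls] at hp
    split_ifs at hp
    · exact hp
    · rw [Finset.mem_singleton] at hp; rw [hp]; exact hc k
    · simp at hp
  obtain ⟨h, hh⟩ := exists_homeomorph_cube_of_frequently
    (fun k => {x | ∀ i, ∀ p ∈ gridWalls (σ.m k) (σ.G k) (c k) i, r k ≤ |(x i : ℝ) - p|})
    σ.window σ.ε σ.ε_pos σ.ε_succ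
    (fun k B hBo hBd => by
      refine exists_homeomorph_grid (hc k) (hr0 k) (fun p hp => ?_) (fun p hp q hq hpq => ?_)
        (σ.m_large k) (σ.G_fine k) hBo hBd
      · have := hrG k p hp; have := hr0 k; constructor <;> linarith
      · have := hrsep k p hp q hq hpq.ne
        rw [abs_of_neg (by linarith)] at this
        linarith [hr0 k])
    (fun k j hkj => by
      have hη := σ.η_pos j
      have hη1 := σ.η_le j
      have hR : 1 ≤ 2 / σ.η j := by rw [le_div_iff₀ hη]; linarith
      have hε := σ.ε_pos (j + 1)
      obtain ⟨e, -, e2, e3, e4⟩ := exists_homeomorph_stretch_finset (hr0 k) hR (σ.G k) (hrG k)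
        (hrsep k)
      refine ⟨Homeomorph.piCongrRight fun _ => e, fun x => ?_,
        fun i hki hij x hx y hyx a p hp => ?_,
        fun x y hxy => ?_⟩
      · refine (cubeDist_le_iff (σ.ε_pos k).le).2 fun i => ?_
        have h1 : (1 / 2 : ℝ) ^ i ≤ 1 := pow_le_one₀ (by norm_num) (by norm_num)
        have h2 : |(e (x i) : ℝ) - x i| ≤ σ.ε k := by
          rcases e2 (x i) with h | ⟨q, hq, h, h'⟩
          · rw [h]; simpa using (σ.ε_pos k).le
          · have := abs_sub_le (e (x i) : ℝ) q (x i)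
            rw [abs_sub_comm q] at this
            linarith [hrε k]
        show (1 / 2 : ℝ) ^ i * |(e (x i) : ℝ) - x i| ≤ σ.ε k
        nlinarith [abs_nonneg ((e (x i) : ℝ) - x i)]
      · have ham : a ≤ σ.m k := by
          by_contra h
          have h1 : ¬ a < σ.m k := by omega
          have h2 : a ≠ σ.m k := by omega
          simp [gridWalls, h1, h2] at hp
        have hpk := hGsub k a hp
        show r k ≤ |(e (y a) : ℝ) - p|
        refine e3 _ p hpk ?_
        have h1 := hx a (ham.trans (σ.mono_m hki)) p (σ.mono_G hki hpk)
        have h2 := le_of_cubeDist_le hyx a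
        have h3 : (2 : ℝ) ^ a ≤ 2 ^ σ.m j :=
          pow_le_pow_right₀ (by norm_num) (ham.trans (σ.mono_m hkj))
        have h4 := σ.ε_η j
        have h5 := σ.anti_η hij
        have h6 : (2 : ℝ) ^ a * (4 * σ.ε (j + 1)) ≤ 2 ^ σ.m j * (4 * σ.ε (j + 1)) := by gcongr
        have h7 := abs_sub_le (x a : ℝ) (y a) p
        rw [abs_sub_comm (x a : ℝ) (y a)] at h7
        have h8 : σ.η j / 2 ≤ |(y a : ℝ) - p| := by linarith
        have h9 : 1 ≤ 2 / σ.η j * |(y a : ℝ) - p| := by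
          rw [div_mul_eq_mul_div, le_div_iff₀ hη]; linarith
        have := hrG k p hpk
        linarith [hr0 k]
      · refine (cubeDist_le_iff (by positivity)).2 fun i => ?_
        show (1 / 2 : ℝ) ^ i * |(e (x i) : ℝ) - e (y i)| ≤ _
        have h1 := (cubeDist_le_iff (by positivity)).1 hxy i
        have h2 : (2 / σ.η j) ^ (σ.G k).card ≤ (2 / σ.η j) ^ (σ.G j).card :=
          pow_le_pow_right₀ hR (Finset.card_le_card (σ.mono_G hkj))
        calc (1 / 2 : ℝ) ^ i * |(e (x i) : ℝ) - e (y i)|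
            ≤ (1 / 2 : ℝ) ^ i * ((2 / σ.η j) ^ (σ.G k).card * |(x i : ℝ) - y i|) := by
              gcongr; exact e4 _ _
          _ = (2 / σ.η j) ^ (σ.G k).card * ((1 / 2 : ℝ) ^ i * |(x i : ℝ) - y i|) := by ring
          _ ≤ (2 / σ.η j) ^ (σ.G j).card * (4 * σ.ε (j + 1)) := by gcongr
          _ ≤ _ := σ.ε_lip j)
    hB hBd
  exact ⟨h, image_subset_iff.2 hh⟩

theorem isOpen_window (j : ℕ) : IsOpen (σ.window j) := by
  have : σ.window j = ⋂ i ∈ Finset.range (σ.m j + 1), ⋂ p ∈ σ.G j,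
      {x : HilbertCube | σ.η j < |(x i : ℝ) - p|} := by
    ext x; simp [window]
  rw [this]
  exact isOpen_biInter_finset fun i _ => isOpen_biInter_finset fun p _ =>
    isOpen_lt continuous_const (by fun_prop)

theorem limsupSet_eq : σ.limsupSet = ⋂ n, ⋃ j ≥ n, σ.window j := by
  ext x; simp [limsupSet, frequently_atTop]

theorem isGδ_limsupSet : IsGδ σ.limsupSet := by
  rw [limsupSet_eq]
  exact .iInter_of_isOpen fun n => isOpen_biUnion fun j _ => σ.isOpen_window j

theorem dense_limsupSet (h : ∀ j : ℕ, ∀ t ∈ Icc (0 : ℝ) 1, ∃ s ∈ Icc (0 : ℝ) 1,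
    |s - t| ≤ 1 / ((j : ℝ) + 1) ∧ ∀ p ∈ σ.G j, σ.η j < |s - p|) : Dense σ.limsupSet := by
  rw [limsupSet_eq]
  refine dense_iInter_of_isOpen (fun n => isOpen_biUnion fun j _ => σ.isOpen_window j) fun n => ?_
  intro x
  rw [mem_closure_iff_seq_limit]
  choose! f hf1 hf2 hf3 using h
  refine ⟨fun j i => ⟨f (n + j) (x i), hf1 _ _ (x i).2⟩, fun j => ?_, ?_⟩
  · simp only [mem_iUnion]
    exact ⟨n + j, by simp, fun i _ p hp => hf3 _ _ (x i).2 p hp⟩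
  · rw [tendsto_pi_nhds]
    intro i
    rw [tendsto_subtype_rng]
    rw [tendsto_iff_dist_tendsto_zero]
    refine squeeze_zero (fun _ => dist_nonneg) (fun j => ?_)
      tendsto_one_div_add_atTop_nhds_zero_nat
    refine (hf2 (n + j) (x i) (x i).2).trans ?_
    apply one_div_le_one_div_of_le (by positivity)
    push_cast; linarith [(Nat.cast_nonneg n : (0 : ℝ) ≤ n)]

theorem limsupSet_mem (h : ∀ j : ℕ, ∀ t ∈ Icc (0 : ℝ) 1, ∃ s ∈ Icc (0 : ℝ) 1,
    |s - t| ≤ 1 / ((j : ℝ) + 1) ∧ ∀ p ∈ σ.G j, σ.η j < |s - p|) :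
    σ.limsupSet ∈ GdeltaFamily :=
  ⟨σ.isGδ_limsupSet, σ.dense_limsupSet h, fun _ => σ.exists_homeomorph_of_isGδ⟩

end GridScheme

theorem exists_fine_finset {P : Set ℝ}
    (hP : ∀ a b : ℝ, 0 ≤ a → a < b → b ≤ 1 → ∃ p ∈ P, a < p ∧ p < b)
    {ε : ℝ} (hε : 0 < ε) : ∃ G : Finset ℝ, G.Nonempty ∧ ↑G ⊆ P ∧
      ∀ s ∈ Icc (0 : ℝ) 1, ∀ t ∈ Icc (0 : ℝ) 1, (∀ p ∈ G, p < s ↔ p < t) → |s - t| ≤ ε := by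
  classical
  obtain ⟨n, hn⟩ := exists_nat_gt (2 / ε)
  have hn0 : (0 : ℝ) < n := (by positivity : (0 : ℝ) < 2 / ε).trans hn
  have hnε : 2 / (n : ℝ) < ε := by rw [div_lt_iff₀ hε] at hn; rw [div_lt_iff₀ hn0]; linarith
  have hn1 : 0 < n := by exact_mod_cast hn0
  have h : ∀ j : ℕ, ∃ p, j < n → p ∈ P ∧ (j : ℝ) / n < p ∧ p < ((j : ℝ) + 1) / n := by
    intro j
    by_cases hj : j < n
    · obtain ⟨p, hp, h⟩ := hP (j / n) ((j + 1) / n) (by positivity) (by gcongr; linarith)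
        (by rw [div_le_one hn0]; exact_mod_cast hj)
      exact ⟨p, fun _ => ⟨hp, h⟩⟩
    · exact ⟨0, fun h => absurd h hj⟩
  choose p hp using h
  refine ⟨(Finset.range n).image p, ⟨p 0, Finset.mem_image_of_mem _ (by simpa using hn1)⟩, ?_, ?_⟩
  · intro x hx
    obtain ⟨j, hj, rfl⟩ := Finset.mem_image.1 hx
    exact (hp j (by simpa using hj)).1
  · have key : ∀ s ∈ Icc (0 : ℝ) 1, ∀ t ∈ Icc (0 : ℝ) 1,
        (∀ q ∈ (Finset.range n).image p, q < s ↔ q < t) → t - s ≤ ε := by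
      intro s hs t ht h
      by_contra hst
      push Not at hst
      set j := ⌊s * n⌋₊ + 1 with hj
      have h1 : s * n < j := by rw [hj]; exact_mod_cast Nat.lt_floor_add_one _
      have h2 : (j : ℝ) ≤ s * n + 1 := by
        have := Nat.floor_le (mul_nonneg hs.1 hn0.le)
        rw [hj]; push_cast; linarith
      have h3 : (j : ℝ) + 1 < t * n := by
        have : 2 / (n : ℝ) < t - s := hnε.trans hst
        rw [div_lt_iff₀ hn0] at this
        linarith
      have h4 : j < n := by
        have : (j : ℝ) < n := by nlinarith [ht.2]
        exact_mod_cast this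
      obtain ⟨-, h5, h6⟩ := hp j h4
      have h7 : s < p j := lt_of_lt_of_le (by rwa [lt_div_iff₀ hn0]) h5.le
      have h8 : p j < t := h6.trans (by rwa [div_lt_iff₀ hn0])
      exact lt_asymm h7 ((h _ (Finset.mem_image_of_mem _ (by simpa using h4))).2 h8)
    intro s hs t ht h
    rw [abs_le]
    have := key s hs t ht h
    have := key t ht s hs fun q hq => (h q hq).symm
    constructor <;> linarith

theorem eventually_exists_far (G : Finset ℝ) {δ : ℝ} (hδ : 0 < δ) :
    ∀ᶠ η in 𝓝[>] (0 : ℝ), ∀ t ∈ Icc (0 : ℝ) 1, ∃ s ∈ Icc (0 : ℝ) 1, |s - t| ≤ δ ∧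
      ∀ p ∈ G, η < |s - p| := by
  obtain ⟨n, hn⟩ := exists_nat_gt (1 / δ)
  have hn0 : (0 : ℝ) < n := (by positivity : (0 : ℝ) < 1 / δ).trans hn
  have hnδ : 1 / (n : ℝ) < δ := by rw [div_lt_iff₀ hδ] at hn; rw [div_lt_iff₀ hn0]; linarith
  have hn1 : 0 < n := by exact_mod_cast hn0
  have h : ∀ j : ℕ, ∃ s : ℝ, s ∉ G ∧ (j : ℝ) / n < s ∧ s < ((j : ℝ) + 1) / n := by
    intro j
    have : (Ioo ((j : ℝ) / n) (((j : ℝ) + 1) / n)).Infinite :=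
      Ioo_infinite (by gcongr; linarith)
    obtain ⟨s, hs, hs'⟩ := this.exists_notMem_finset G
    exact ⟨s, hs', hs.1, hs.2⟩
  choose f hfG hf1 hf2 using h
  have : ∀ᶠ η in 𝓝[>] (0 : ℝ), ∀ j ∈ Finset.range n, ∀ p ∈ G, η < |f j - p| := by
    rw [Filter.eventually_all_finset]
    intro j _
    rw [Filter.eventually_all_finset]
    intro p hp
    have : 0 < |f j - p| := abs_pos.2 (sub_ne_zero.2 fun h => hfG j (h ▸ hp))
    filter_upwards [Ioo_mem_nhdsGT this] with η hη using hη.2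
  filter_upwards [this] with η hη t ht
  have hj : ∃ j < n, (j : ℝ) / n ≤ t ∧ t ≤ ((j : ℝ) + 1) / n := by
    rcases ht.2.lt_or_eq with h | h
    · refine ⟨⌊t * n⌋₊, ?_, ?_, ?_⟩
      · rw [Nat.floor_lt (mul_nonneg ht.1 hn0.le)]; nlinarith
      · rw [div_le_iff₀ hn0]; exact Nat.floor_le (mul_nonneg ht.1 hn0.le)
      · rw [le_div_iff₀ hn0]; exact (Nat.lt_floor_add_one _).le
    · refine ⟨n - 1, by omega, ?_, ?_⟩
      · rw [h, div_le_one hn0]; exact_mod_cast Nat.sub_le _ _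
      · rw [h, Nat.cast_sub hn1, le_div_iff₀ hn0]; simp
  obtain ⟨j, hjn, h1, h2⟩ := hj
  have h3 := hf1 j
  have h4 := hf2 j
  have h5 : ((j : ℝ) + 1) / n = j / n + 1 / n := by ring
  refine ⟨f j, ⟨?_, ?_⟩, ?_, hη j (by simpa using hjn)⟩
  · have : 0 ≤ (j : ℝ) / n := by positivity
    linarith
  · have : ((j : ℝ) + 1) / n ≤ 1 := by rw [div_le_one hn0]; exact_mod_cast hjn
    linarith
  · rw [abs_le]; constructor <;> linarith

/-- The points `η`-far from the walls `G` in the coordinates up to `m`. -/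
def farSet (m : ℕ) (G : Finset ℝ) (η : ℝ) : Set HilbertCube :=
  {x | ∀ i ≤ m, ∀ p ∈ G, η < |(x i : ℝ) - p|}

/-- `G` is an `ε`-fine set of walls in `P`, and `m` is large with respect to `G` and `ε`. -/
structure GridStage (P : Set ℝ) (J : Finset ℝ → ℕ) where
  m : ℕ
  G : Finset ℝ
  ε : ℝ
  G_nonempty : G.Nonempty
  G_subset : ↑G ⊆ P
  ε_pos : 0 < ε
  le_m : J G ≤ m
  m_large : (1 / 2) ^ m ≤ ε
  G_fine : ∀ s ∈ Icc (0 : ℝ) 1, ∀ t ∈ Icc (0 : ℝ) 1, (∀ p ∈ G, p < s ↔ p < t) → |s - t| ≤ ε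

theorem exists_gridStage {P : Set ℝ}
    (hP : ∀ a b : ℝ, 0 ≤ a → a < b → b ≤ 1 → ∃ p ∈ P, a < p ∧ p < b) (J : Finset ℝ → ℕ)
    {ε : ℝ} (hε : 0 < ε) (m : ℕ) (G : Finset ℝ) (hG : ↑G ⊆ P) :
    ∃ D : GridStage P J, D.ε = ε ∧ m < D.m ∧ G ⊆ D.G := by
  classical
  obtain ⟨G', h1, h2, h3⟩ := exists_fine_finset hP hε
  obtain ⟨a, ha⟩ := exists_pow_lt_of_lt_one hε (by norm_num : (1 / 2 : ℝ) < 1)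
  refine ⟨⟨max (max (m + 1) a) (J (G ∪ G')), G ∪ G', ε, h1.mono Finset.subset_union_right, ?_, hε,
    le_max_right _ _, ?_, ?_⟩, rfl, ?_, Finset.subset_union_left⟩
  · rw [Finset.coe_union]; exact union_subset hG h2
  · exact (pow_le_pow_of_le_one (by norm_num) (by norm_num)
      ((le_max_right _ _).trans (le_max_left _ _))).trans ha.le
  · exact fun s hs t ht h => h3 s hs t ht fun p hp => h p (Finset.mem_union_right _ hp)
  · exact lt_of_lt_of_le (Nat.lt_succ_self m) ((le_max_left _ _).trans (le_max_left _ _))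

theorem exists_interleaved_schemes {P : Set ℝ} (hP01 : ∀ p ∈ P, 0 < p ∧ p < 1)
    (hP : ∀ a b : ℝ, 0 ≤ a → a < b → b ≤ 1 → ∃ p ∈ P, a < p ∧ p < b) (J : Finset ℝ → ℕ)
    (R : Finset ℝ → ℕ → ℝ → Prop) (hR : ∀ G m, ↑G ⊆ P → ∀ᶠ η in 𝓝[>] (0 : ℝ), R G m η) :
    ∃ (m : ℕ → ℕ) (G : ℕ → Finset ℝ) (η : ℕ → ℝ), StrictMono m ∧
      (∀ n, J (G n) ≤ m n ∧ R (G n) (m (n + 1)) (η n)) ∧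
      ∀ a, {x | ∃ᶠ k in atTop, x ∈ farSet (m (2 * k + a)) (G (2 * k + a)) (η (2 * k + a))} ∈
        GdeltaFamily := by
  let Inv : GridStage P J × GridStage P J × ℝ → Prop := fun s =>
    s.1.m < s.2.1.m ∧ s.1.G ⊆ s.2.1.G ∧ 0 < s.2.2 ∧ s.2.2 ≤ 1 ∧ R s.1.G s.2.1.m s.2.2 ∧
      ∀ t ∈ Icc (0 : ℝ) 1, ∃ u ∈ Icc (0 : ℝ) 1, |u - t| ≤ 1 / ((s.2.1.m : ℝ) + 1) ∧
        ∀ p ∈ s.1.G, s.2.2 < |u - p|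
  have hη : ∀ (D D' : GridStage P J) (b : ℝ), 0 < b → D.m < D'.m → D.G ⊆ D'.G →
      ∃ η ≤ b, Inv (D, D', η) := by
    intro D D' b hb h1 h2
    have := (hR D.G D'.m D.G_subset).and (eventually_exists_far D.G
      (by positivity : (0 : ℝ) < 1 / ((D'.m : ℝ) + 1)))
    obtain ⟨η, ⟨h3, h4⟩, h5⟩ := (this.and (Ioo_mem_nhdsGT (lt_min hb one_pos))).exists
    exact ⟨η, h5.2.le.trans (min_le_left _ _), h1, h2, h5.1, h5.2.le.trans (min_le_right _ _), h3,
      h4⟩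
  have hstep : ∀ s : {s // Inv s}, ∃ t : {s // Inv s}, t.1.1 = s.1.2.1 ∧ t.1.2.2 ≤ s.1.2.2 ∧
      4 * t.1.2.1.ε ≤ s.1.1.ε ∧ 2 ^ s.1.1.m * (4 * t.1.2.1.ε) ≤ s.1.2.2 / 2 ∧
      (2 / s.1.2.2) ^ s.1.1.G.card * (4 * t.1.2.1.ε) ≤ 1 / ((s.1.1.m : ℝ) + 1) := by
    rintro ⟨⟨D, D', η⟩, h1, h2, h3, h4, -⟩
    simp only at h1 h2 h3 h4 ⊢
    set e := min (D.ε / 4) (min (η / 2 / (2 ^ D.m * 4))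
      (1 / ((D.m : ℝ) + 1) / ((2 / η) ^ D.G.card * 4))) with he
    have hD := D.ε_pos
    have he0 : 0 < e := lt_min (by positivity) (lt_min (by positivity) (by positivity))
    obtain ⟨E, hEe, hE1, hE2⟩ := exists_gridStage hP J he0 D'.m D'.G D'.G_subset
    obtain ⟨η', h5, h6⟩ := hη D' E η h3 hE1 hE2
    refine ⟨⟨_, h6⟩, rfl, h5, ?_, ?_, ?_⟩
    · have : E.ε ≤ D.ε / 4 := (hEe.trans he).le.trans (min_le_left _ _)
      show 4 * E.ε ≤ _
      linarith
    · have : E.ε ≤ _ := (hEe.trans he).le.trans ((min_le_right _ _).trans (min_le_left _ _))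
      rw [le_div_iff₀ (by positivity)] at this
      show _ * (4 * E.ε) ≤ _
      linarith
    · have : E.ε ≤ _ := (hEe.trans he).le.trans ((min_le_right _ _).trans (min_le_right _ _))
      rw [le_div_iff₀ (by positivity)] at this
      show _ * (4 * E.ε) ≤ _
      linarith
  choose next hn using hstep
  obtain ⟨D0, -⟩ := exists_gridStage hP J one_pos 0 ∅ (by simp)
  obtain ⟨D1, -, hD1, hD1'⟩ := exists_gridStage hP J one_pos D0.m D0.G D0.G_subset
  obtain ⟨η0, -, h0⟩ := hη D0 D1 1 one_pos hD1 hD1'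
  let s : ℕ → {s // Inv s} := fun n => Nat.rec ⟨_, h0⟩ (fun _ => next) n
  have hs : ∀ n, s (n + 1) = next (s n) := fun n => rfl
  let D : ℕ → GridStage P J := fun n => (s n).1.1
  let η : ℕ → ℝ := fun n => (s n).1.2.2
  have hD : ∀ n, (s n).1.2.1 = D (n + 1) := fun n => by
    simp only [D, hs]; exact (hn (s n)).1.symm
  have hmono : StrictMono fun n => (D n).m := strictMono_nat_of_lt_succ fun n => by
    have := (s n).2.1
    rwa [hD] at this
  have hG : Monotone fun n => (D n).G := monotone_nat_of_le_succ fun n => by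
    have := (s n).2.2.1
    rwa [hD] at this
  have hanti : Antitone η := antitone_nat_of_succ_le fun n => (hn (s n)).2.1
  have hεη : ∀ n, 4 * (D (n + 2)).ε ≤ (D n).ε ∧ 2 ^ (D n).m * (4 * (D (n + 2)).ε) ≤ η n / 2 ∧
      (2 / η n) ^ (D n).G.card * (4 * (D (n + 2)).ε) ≤ 1 / (((D n).m : ℝ) + 1) := fun n => by
    have := (hn (s n)).2.2
    rwa [← hs, hD (n + 1)] at this
  have hle : ∀ n, 1 / (((D n).m : ℝ) + 1) ≤ 1 / ((n : ℝ) + 1) := fun n => by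
    apply one_div_le_one_div_of_le (by positivity)
    have : n ≤ (D n).m := hmono.id_le n
    have : (n : ℝ) ≤ (D n).m := by exact_mod_cast this
    linarith
  have hle' : ∀ k a : ℕ, 1 / (((2 * k + a : ℕ) : ℝ) + 1) ≤ 1 / ((k : ℝ) + 1) := fun k a => by
    apply one_div_le_one_div_of_le (by positivity)
    push_cast
    linarith [(Nat.cast_nonneg k : (0 : ℝ) ≤ k), (Nat.cast_nonneg a : (0 : ℝ) ≤ a)]
  refine ⟨fun n => (D n).m, fun n => (D n).G, η, hmono, fun n => ⟨(D n).le_m, ?_⟩, fun a => ?_⟩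
  · have := (s n).2.2.2.2.2.1
    rwa [hD] at this
  · have hidx : StrictMono fun k => 2 * k + a := fun k l h => by simp only; omega
    let σ : GridScheme :=
      { m := fun k => (D (2 * k + a)).m
        G := fun k => (D (2 * k + a)).G
        η := fun k => η (2 * k + a)
        ε := fun k => (D (2 * k + a)).ε
        mono_m := hmono.monotone.comp hidx.monotone
        mono_G := hG.comp hidx.monotone
        anti_η := hanti.comp_monotone hidx.monotone
        η_pos := fun k => (s (2 * k + a)).2.2.2.1
        η_le := fun k => (s (2 * k + a)).2.2.2.2.1
        G_nonempty := fun k => (D _).G_nonempty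
        G_mem := fun k p hp => hP01 p ((D _).G_subset hp)
        ε_pos := fun k => (D _).ε_pos
        ε_succ := fun k => by
          rw [show 2 * (k + 1) + a = 2 * k + a + 2 by ring]; exact (hεη _).1
        m_large := fun k => (D _).m_large
        G_fine := fun k => (D _).G_fine
        ε_η := fun k => by
          rw [show 2 * (k + 1) + a = 2 * k + a + 2 by ring]; exact (hεη _).2.1
        ε_lip := fun k => by
          rw [show 2 * (k + 1) + a = 2 * k + a + 2 by ring]
          exact (hεη _).2.2.trans ((hle _).trans (hle' k a)) }
    exact σ.limsupSet_mem fun k t ht => by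
      obtain ⟨u, hu, h1, h2⟩ := (s (2 * k + a)).2.2.2.2.2.2 t ht
      rw [hD] at h1
      refine ⟨u, hu, h1.trans (le_trans ?_ ((hle (2 * k + a)).trans (hle' k a))), h2⟩
      apply one_div_le_one_div_of_le (by positivity)
      have : (D (2 * k + a)).m ≤ (D (2 * k + a + 1)).m := (hmono (Nat.lt_succ_self _)).le
      have : ((D (2 * k + a)).m : ℝ) ≤ (D (2 * k + a + 1)).m := by exact_mod_cast this
      linarith

/-- The index of a dyadic interval of length `2⁻ⁿ` containing `t`. -/
noncomputable def dyadicIndex (n : ℕ) (t : ℝ) : ℕ := min ⌊2 ^ n * t⌋₊ (2 ^ n - 1)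

/-- The `n`-th binary digit of `t`. -/
def dyadicBit (n : ℕ) (t : ℝ) : Prop := Odd (dyadicIndex (n + 1) t)

theorem dyadicIndex_succ_div_two (n : ℕ) (t : ℝ) :
    dyadicIndex (n + 1) t / 2 = dyadicIndex n t := by
  have h1 : ⌊2 ^ (n + 1) * t⌋₊ / 2 = ⌊2 ^ n * t⌋₊ := by
    rw [← Nat.floor_div_natCast]
    congr 1
    push_cast
    rw [pow_succ]; ring
  have h2 : (2 ^ (n + 1) - 1) / 2 = 2 ^ n - 1 := by
    have := Nat.one_le_two_pow (n := n)
    rw [pow_succ]; omega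
  rw [dyadicIndex, dyadicIndex, ← h1, ← h2]
  omega

theorem dyadicIndex_eq_of_bits {n : ℕ} {s t : ℝ}
    (h : ∀ k < n, (dyadicBit k s ↔ dyadicBit k t)) : dyadicIndex n s = dyadicIndex n t := by
  induction n with
  | zero => simp [dyadicIndex]
  | succ n ih =>
    have h1 := ih fun k hk => h k (hk.trans (Nat.lt_succ_self n))
    have h2 := h n (Nat.lt_succ_self n)
    rw [← dyadicIndex_succ_div_two, ← dyadicIndex_succ_div_two n t] at h1
    simp only [dyadicBit, Nat.odd_iff] at h2
    omega

theorem dyadicIndex_bounds (n : ℕ) {t : ℝ} (ht : t ∈ Icc (0 : ℝ) 1) :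
    (dyadicIndex n t : ℝ) ≤ 2 ^ n * t ∧ 2 ^ n * t ≤ dyadicIndex n t + 1 := by
  have h0 : (0 : ℝ) ≤ 2 ^ n * t := mul_nonneg (by positivity) ht.1
  constructor
  · exact le_trans (Nat.cast_le.2 (min_le_left _ _)) (Nat.floor_le h0)
  · rw [dyadicIndex]
    rcases le_total ⌊2 ^ n * t⌋₊ (2 ^ n - 1) with h | h
    · rw [min_eq_left h]; exact (Nat.lt_floor_add_one _).le
    · rw [min_eq_right h, Nat.cast_sub Nat.one_le_two_pow]
      push_cast
      have : (0 : ℝ) < 2 ^ n := by positivity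
      nlinarith [ht.2]

theorem abs_sub_le_of_dyadicBit {n : ℕ} {s t : ℝ} (hs : s ∈ Icc (0 : ℝ) 1)
    (ht : t ∈ Icc (0 : ℝ) 1) (h : ∀ k < n, (dyadicBit k s ↔ dyadicBit k t)) :
    |s - t| ≤ (1 / 2) ^ n := by
  have h1 := dyadicIndex_bounds n hs
  have h2 := dyadicIndex_bounds n ht
  rw [dyadicIndex_eq_of_bits h] at h1
  have h3 : (0 : ℝ) < 2 ^ n := by positivity
  rw [one_div, inv_pow, ← one_div, le_div_iff₀ h3, ← abs_of_pos h3, ← abs_mul, abs_le]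
  constructor <;> linarith

open Classical in
/-- The number with the binary digits `β n, β (n + 1), …`. -/
noncomputable def binaryTail (β : ℕ → Prop) (n : ℕ) : ℝ :=
  ∑' k, (if β (n + k) then 1 else 0) * (1 / 2 : ℝ) ^ (k + 1)

open Classical in
theorem summable_binaryTail (β : ℕ → Prop) (n : ℕ) :
    Summable fun k => (if β (n + k) then 1 else 0) * (1 / 2 : ℝ) ^ (k + 1) := by
  refine Summable.of_nonneg_of_le (fun k => ?_) (fun k => ?_)
    ((summable_nat_add_iff 1).2 summable_geometric_two)
  · split_ifs <;> positivity
  · have : (0 : ℝ) ≤ (1 / 2) ^ (k + 1) := by positivity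
    split_ifs <;> simp

open Classical in
theorem binaryTail_eq (β : ℕ → Prop) (n : ℕ) :
    2 * binaryTail β n = (if β n then 1 else 0) + binaryTail β (n + 1) := by
  rw [binaryTail, (summable_binaryTail β n).tsum_eq_zero_add, binaryTail, mul_add, ← tsum_mul_left]
  congr 1
  · simp
  · refine tsum_congr fun k => ?_
    rw [show n + (k + 1) = n + 1 + k by ring, pow_succ _ (k + 1)]
    ring

theorem binaryTail_mem (β : ℕ → Prop) (n : ℕ) : 0 ≤ binaryTail β n ∧ binaryTail β n ≤ 1 := by
  classical
  constructor
  · exact tsum_nonneg fun k => by split_ifs <;> positivity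
  · have h : ∑' k : ℕ, (1 / 2 : ℝ) ^ (k + 1) = 1 := by
      have h2 : ∑' k : ℕ, (1 / 2 : ℝ) ^ k = 2 := tsum_geometric_two
      rw [summable_geometric_two.tsum_eq_zero_add] at h2
      simp only [pow_zero] at h2
      linarith
    rw [← h, binaryTail]
    refine (summable_binaryTail β n).tsum_le_tsum (fun k => ?_)
      ((summable_nat_add_iff 1).2 summable_geometric_two)
    have : (0 : ℝ) ≤ (1 / 2) ^ (k + 1) := by positivity
    split_ifs <;> simp

theorem binaryTail_mem_Ioo {β : ℕ → Prop} (h1 : ∀ n, ∃ k, β (n + k)) (h0 : ∀ n, ∃ k, ¬ β (n + k))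
    (n : ℕ) : 0 < binaryTail β n ∧ binaryTail β n < 1 := by
  have key1 : ∀ k n, β (n + k) → 0 < binaryTail β n := by
    intro k
    induction k with
    | zero =>
      intro n h
      have := binaryTail_eq β n
      rw [if_pos (by simpa using h)] at this
      linarith [(binaryTail_mem β (n + 1)).1]
    | succ k ih =>
      intro n h
      have := ih (n + 1) (by rwa [show n + 1 + k = n + (k + 1) by ring])
      have := binaryTail_eq β n
      split_ifs at this <;> linarith
  have key0 : ∀ k n, ¬ β (n + k) → binaryTail β n < 1 := by
    intro k
    induction k with
    | zero =>
      intro n h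
      have := binaryTail_eq β n
      rw [if_neg (by simpa using h)] at this
      linarith [(binaryTail_mem β (n + 1)).2]
    | succ k ih =>
      intro n h
      have := ih (n + 1) (by rwa [show n + 1 + k = n + (k + 1) by ring])
      have := binaryTail_eq β n
      split_ifs at this <;> linarith
  obtain ⟨k, hk⟩ := h1 n
  obtain ⟨l, hl⟩ := h0 n
  exact ⟨key1 k n hk, key0 l n hl⟩

theorem exists_eventually_dyadicBit {β : ℕ → Prop} (h1 : ∀ n, ∃ k, β (n + k))
    (h0 : ∀ n, ∃ k, ¬ β (n + k)) {N j : ℕ} (hj : j < 2 ^ N) :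
    ∃ t : ℝ, (j : ℝ) < 2 ^ N * t ∧ 2 ^ N * t < j + 1 ∧
      ∀ n ≥ N, ∀ᶠ s in 𝓝 t, (dyadicBit n s ↔ β n) := by
  classical
  have hT := binaryTail_mem_Ioo h1 h0
  set t : ℝ := (j + binaryTail β N) / 2 ^ N with ht
  have htN : 2 ^ N * t = j + binaryTail β N := by rw [ht]; field_simp
  have key : ∀ k, ∃ M : ℕ, M < 2 ^ (N + k) ∧ 2 ^ (N + k) * t = M + binaryTail β (N + k) ∧
      ∀ l, k = l + 1 → (Odd M ↔ β (N + l)) := by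
    intro k
    induction k with
    | zero => exact ⟨j, hj, htN, fun l hl => absurd hl (by omega)⟩
    | succ k ih =>
      obtain ⟨M, hM, h, -⟩ := ih
      have e := binaryTail_eq β (N + k)
      have e2 : (2 : ℝ) ^ (N + (k + 1)) = 2 * 2 ^ (N + k) := by rw [← add_assoc, pow_succ]; ring
      have e3 : (2 : ℕ) ^ (N + (k + 1)) = 2 * 2 ^ (N + k) := by rw [← add_assoc, pow_succ]; ring
      by_cases hb : β (N + k)
      · rw [if_pos hb] at e
        refine ⟨2 * M + 1, by omega, ?_, fun l hl => ?_⟩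
        · rw [e2, mul_assoc, h, ← add_assoc]; push_cast; linarith
        · obtain rfl : l = k := by omega
          simp [hb]
      · rw [if_neg hb] at e
        refine ⟨2 * M, by omega, ?_, fun l hl => ?_⟩
        · rw [e2, mul_assoc, h, ← add_assoc]; push_cast; linarith
        · obtain rfl : l = k := by omega
          simp [hb]
  refine ⟨t, by linarith [(hT N).1], by linarith [(hT N).2], fun n hn => ?_⟩
  obtain ⟨k, rfl⟩ := Nat.exists_eq_add_of_le hn
  obtain ⟨M, hM, h, hodd⟩ := key (k + 1)
  have hT' := hT (N + (k + 1))
  have hc : ContinuousAt (fun s : ℝ => 2 ^ (N + (k + 1)) * s) t := by fun_prop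
  have := hc.eventually_mem (Ioo_mem_nhds (a := (M : ℝ)) (b := (M : ℝ) + 1)
    (by linarith) (by linarith))
  filter_upwards [this] with s hs
  rw [dyadicBit, ← hodd k rfl]
  have hfl : ⌊2 ^ (N + (k + 1)) * s⌋₊ = M := by
    rw [Nat.floor_eq_iff (le_trans (by positivity) hs.1.le)]
    exact ⟨hs.1.le, hs.2⟩
  rw [add_assoc, dyadicIndex, hfl, min_eq_left (by omega)]

/-- The index of the first `1` in the `m`-th row of binary digits of `t`. -/
noncomputable def firstOne (m : ℕ) (t : ℝ) : ℕ := sInf {l | dyadicBit (Nat.pair m l) t}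

theorem exists_dense_firstOne (Z : ℕ → ℕ) : ∃ (P : Set ℝ) (J : ℝ → ℕ),
    (∀ p ∈ P, 0 < p ∧ p < 1) ∧ (∀ a b : ℝ, 0 ≤ a → a < b → b ≤ 1 → ∃ p ∈ P, a < p ∧ p < b) ∧
      ∀ p ∈ P, ∀ m ≥ J p, ∀ᶠ s in 𝓝 p, firstOne m s = Z m := by
  let β : ℕ → Prop := fun n => n.unpair.2 = Z n.unpair.1
  have h1 : ∀ n, ∃ k, β (n + k) := fun n =>
    ⟨Nat.pair n (Z n) - n, by
      rw [Nat.add_sub_cancel' (Nat.left_le_pair _ _)]; simp [β]⟩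
  have h0 : ∀ n, ∃ k, ¬ β (n + k) := fun n =>
    ⟨Nat.pair n (Z n + 1) - n, by
      rw [Nat.add_sub_cancel' (Nat.left_le_pair _ _)]; simp [β]⟩
  let Q : ℝ → ℕ → Prop := fun p N => ∀ n ≥ N, ∀ᶠ s in 𝓝 p, (dyadicBit n s ↔ β n)
  have hJ : ∀ p, ∃ N, (∃ N, Q p N) → Q p N := fun p => by
    by_cases h : ∃ N, Q p N
    · exact ⟨h.choose, fun _ => h.choose_spec⟩
    · exact ⟨0, fun h' => absurd h' h⟩
  choose J hJ using hJ
  refine ⟨{p | 0 < p ∧ p < 1 ∧ ∃ N, Q p N}, J, fun p hp => ⟨hp.1, hp.2.1⟩, fun a b ha hab hb => ?_,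
    fun p hp m hm => ?_⟩
  · obtain ⟨N, hN⟩ := exists_nat_gt (2 / (b - a))
    have hN2 : 2 / (b - a) < 2 ^ N := hN.trans (by exact_mod_cast Nat.lt_two_pow_self)
    rw [div_lt_iff₀ (by linarith)] at hN2
    have h2N : (0 : ℝ) < 2 ^ N := by positivity
    set j := ⌊2 ^ N * a⌋₊ + 1 with hj
    have e1 : 2 ^ N * a < j := by rw [hj]; exact_mod_cast Nat.lt_floor_add_one _
    have e2 : (j : ℝ) ≤ 2 ^ N * a + 1 := by
      have := Nat.floor_le (mul_nonneg h2N.le ha)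
      rw [hj]; push_cast; linarith
    have e3 : (j : ℝ) + 1 < 2 ^ N * b := by linarith
    have hjN : j < 2 ^ N := by
      have : (j : ℝ) < 2 ^ N := by nlinarith
      exact_mod_cast this
    obtain ⟨t, t1, t2, t3⟩ := exists_eventually_dyadicBit h1 h0 hjN
    have ta : a < t := lt_of_mul_lt_mul_left (e1.trans t1) h2N.le
    have tb : t < b := lt_of_mul_lt_mul_left (t2.trans e3) h2N.le
    exact ⟨t, ⟨ha.trans_lt ta, tb.trans_le hb, N, t3⟩, ta, tb⟩
  · have h := hJ p hp.2.2
    have : ∀ᶠ s in 𝓝 p, ∀ l ∈ Finset.range (Z m + 1),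
        (dyadicBit (Nat.pair m l) s ↔ β (Nat.pair m l)) := by
      rw [Filter.eventually_all_finset]
      exact fun l _ => h _ (hm.le.trans (Nat.left_le_pair _ _))
    filter_upwards [this] with s hs
    have hβ : ∀ l, β (Nat.pair m l) ↔ l = Z m := fun l => by simp [β]
    simp only [hβ, Finset.mem_range] at hs
    refine le_antisymm (Nat.sInf_le ((hs _ (by omega)).2 rfl)) ?_
    refine le_csInf ⟨Z m, (hs _ (by omega)).2 rfl⟩ fun l hl => ?_
    by_contra hlt
    exact (not_le.1 hlt).ne ((hs l (by omega)).1 hl)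

theorem subset_mem_sigmaG0 {A B : Set HilbertCube} (hA : A ∈ sigmaG0) (h : B ⊆ A) :
    B ∈ sigmaG0 := by
  obtain ⟨S, hS, hAS⟩ := hA
  exact ⟨S, hS, h.trans hAS⟩

theorem iUnion_mem_sigmaG0 {A : ℕ → Set HilbertCube} (hA : ∀ n, A n ∈ sigmaG0) :
    (⋃ n, A n) ∈ sigmaG0 := by
  choose S hS hAS using hA
  refine ⟨fun n => S n.unpair.1 n.unpair.2, fun n => hS _ _, iUnion_subset fun n x hx => ?_⟩
  obtain ⟨k, hk⟩ := mem_iUnion.1 (hAS n hx)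
  exact mem_iUnion.2 ⟨Nat.pair n k, by simpa using hk⟩

theorem GdeltaFamily_subset_sigmaG0 {A : Set HilbertCube} (hA : A ∈ GdeltaFamily) :
    A ∈ sigmaG0 := ⟨fun _ => A, fun _ => hA, subset_iUnion (fun _ : ℕ => A) 0⟩

theorem union_mem_sigmaG0 {A B : Set HilbertCube} (hA : A ∈ sigmaG0) (hB : B ∈ sigmaG0) :
    A ∪ B ∈ sigmaG0 := by
  have := iUnion_mem_sigmaG0 (A := fun n => if n = 0 then A else B) fun n => by
    split_ifs <;> assumption
  exact subset_mem_sigmaG0 this (union_subset (subset_iUnion_of_subset 0 (by simp))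
    (subset_iUnion_of_subset 1 (by simp)))

theorem exists_mem_sigmaG0_firstOne (Z : ℕ → ℕ) : ∃ S ∈ sigmaG0, ∀ x ∉ S,
    ∀ᶠ m in atTop, ∃ i ≤ m, firstOne m (x i) = Z m := by
  obtain ⟨P, J, hP01, hP, hJ⟩ := exists_dense_firstOne Z
  obtain ⟨m, G, η, hm, hR, hA⟩ := exists_interleaved_schemes hP01 hP (fun G => G.sup J)
    (fun G m' η => ∀ m ∈ Finset.Ico (G.sup J) m', ∀ p ∈ G, ∀ s, |s - p| ≤ η → firstOne m s = Z m)
    (fun G m' hG => by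
      rw [Filter.eventually_all_finset]
      intro m hm
      rw [Filter.eventually_all_finset]
      intro p hp
      obtain ⟨δ, hδ, h⟩ := Metric.eventually_nhds_iff.1
        (hJ p (hG hp) m ((Finset.le_sup hp).trans (Finset.mem_Ico.1 hm).1))
      filter_upwards [Ioo_mem_nhdsGT hδ] with η hη s hs
      exact h (hs.trans_lt hη.2))
  refine ⟨_, union_mem_sigmaG0 (GdeltaFamily_subset_sigmaG0 (hA 0))
    (GdeltaFamily_subset_sigmaG0 (hA 1)), fun x hx => ?_⟩
  simp only [mem_union, mem_ofPred_eq, not_or, not_frequently, eventually_atTop] at hx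
  obtain ⟨⟨a, ha⟩, b, hb⟩ := hx
  have hN : ∀ n ≥ 2 * (a + b) + 1, x ∉ farSet (m n) (G n) (η n) := fun n hn => by
    rcases Nat.even_or_odd' n with ⟨k, rfl | rfl⟩
    · exact ha k (by omega)
    · exact hb k (by omega)
  rw [eventually_atTop]
  refine ⟨m (2 * (a + b) + 1), fun k hk => ?_⟩
  have hex : ∃ n ≥ 2 * (a + b) + 1, m n ≤ k ∧ k < m (n + 1) := by
    let n := Nat.findGreatest (fun n => m n ≤ k) k
    have h1 : 2 * (a + b) + 1 ≤ k := (hm.id_le _).trans hk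
    have h2 : m n ≤ k := Nat.findGreatest_spec (P := fun n => m n ≤ k) h1 hk
    refine ⟨n, Nat.le_findGreatest h1 hk, h2, not_le.1 fun h => ?_⟩
    have := Nat.le_findGreatest (P := fun n => m n ≤ k) ((hm.id_le _).trans h) h
    exact absurd this (by simp [n])
  obtain ⟨n, hn, hn1, hn2⟩ := hex
  have := hN n hn
  simp only [farSet, mem_ofPred_eq, not_forall, not_lt] at this
  obtain ⟨i, hi, p, hp, h⟩ := this
  exact ⟨i, hi.trans hn1, (hR n).2 k (Finset.mem_Ico.2 ⟨(hR n).1.trans hn1, hn2⟩) p hp _ h⟩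

theorem exists_mem_GdeltaFamily (x : HilbertCube) : ∃ A ∈ GdeltaFamily, x ∈ A := by
  obtain ⟨m, G, η, hm, hR, hA⟩ := exists_interleaved_schemes
    (P := {p | 0 < p ∧ p < 1 ∧ ∀ i, p ≠ x i}) (fun p hp => ⟨hp.1, hp.2.1⟩)
    (fun a b ha hab hb => by
      have h1 : (range fun i => (x i : ℝ)).Countable := countable_range _
      obtain ⟨p, hp, h2, h3⟩ := (h1.dense_compl ℝ).exists_between hab
      exact ⟨p, ⟨ha.trans_lt h2, h3.trans_le hb, fun i h => hp ⟨i, h.symm⟩⟩, h2, h3⟩)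
    (fun _ => 0) (fun G m η => ∀ i ∈ Finset.range (m + 1), ∀ p ∈ G, η < |(x i : ℝ) - p|)
    (fun G m hG => by
      rw [Filter.eventually_all_finset]
      intro i _
      rw [Filter.eventually_all_finset]
      intro p hp
      have : 0 < |(x i : ℝ) - p| := abs_pos.2 (sub_ne_zero.2 ((hG hp).2.2 i).symm)
      filter_upwards [Ioo_mem_nhdsGT this] with η hη using hη.2)
  refine ⟨_, hA 0, Frequently.of_forall fun k i hi p hp => ?_⟩
  exact (hR (2 * k + 0)).2 i (Finset.mem_range.2
    (Nat.lt_succ_of_le (hi.trans (hm (Nat.lt_succ_self _)).le))) p hp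

/-- The binary digits of all coordinates of a point of the Hilbert cube. -/
def cubeBit (z : HilbertCube) (k : ℕ) : Prop := dyadicBit k.unpair.2 (z k.unpair.1)

theorem exists_eventually_cubeBit (B : ℕ) (w : ℕ → Prop) :
    ∃ z : HilbertCube, ∀ n < B, ∀ᶠ z' in 𝓝 z, (cubeBit z' n ↔ w n) := by
  have h : ∀ i, ∃ t : Icc (0 : ℝ) 1, ∀ n, Nat.pair i n < B →
      ∀ᶠ s in 𝓝 (t : ℝ), (dyadicBit n s ↔ w (Nat.pair i n)) := by
    intro i
    let β : ℕ → Prop := fun n => (Nat.pair i n < B ∧ w (Nat.pair i n)) ∨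
      (B ≤ Nat.pair i n ∧ Even n)
    have hβ : ∀ n, B ≤ n → (β n ↔ Even n) := fun n hn => by
      have := hn.trans (Nat.right_le_pair i n)
      simp [β, this, this.not_gt]
    obtain ⟨t, h1, h2, h3⟩ := exists_eventually_dyadicBit (β := β) (N := 0) (j := 0)
      (fun n => ⟨2 * B + n, (hβ _ (by omega)).2 ⟨B + n, by ring⟩⟩)
      (fun n => ⟨2 * B + n + 1, fun h => by
        have := (hβ _ (by omega)).1 h
        rw [Nat.even_iff] at this; omega⟩) (by norm_num)
    simp only [pow_zero, one_mul, Nat.cast_zero, zero_add] at h1 h2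
    refine ⟨⟨t, h1.le, h2.le⟩, fun n hn => ?_⟩
    have e : β n ↔ w (Nat.pair i n) := by simp [β, hn, hn.not_ge]
    rw [← e]
    exact h3 n (Nat.zero_le _)
  choose z hz using h
  refine ⟨z, fun n hn => ?_⟩
  have h1 := hz n.unpair.1 n.unpair.2 (by rwa [Nat.pair_unpair])
  rw [Nat.pair_unpair] at h1
  have hc : Continuous fun z : HilbertCube => (z n.unpair.1 : ℝ) := by fun_prop
  exact hc.continuousAt.eventually h1

theorem exists_cubeBit_forces {U : Set HilbertCube} (hU : IsOpen U) {z : HilbertCube} (hz : z ∈ U) :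
    ∃ b, ∀ z', (∀ n < b, (cubeBit z' n ↔ cubeBit z n)) → z' ∈ U := by
  obtain ⟨I, u, hu, hI⟩ := isOpen_pi_iff.1 hU z hz
  have h : ∀ i, ∃ N : ℕ, i ∈ I → ∀ s : Icc (0 : ℝ) 1, |(s : ℝ) - z i| ≤ (1 / 2) ^ N → s ∈ u i := by
    intro i
    by_cases hi : i ∈ I
    swap
    · exact ⟨0, fun h => absurd h hi⟩
    obtain ⟨ε, hε, hball⟩ := Metric.isOpen_iff.1 (hu i hi).1 _ (hu i hi).2
    obtain ⟨N, hN⟩ := exists_pow_lt_of_lt_one hε (by norm_num : (1 / 2 : ℝ) < 1)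
    exact ⟨N, fun _ s hs => hball (hs.trans_lt hN)⟩
  choose N hN using h
  refine ⟨I.sup fun i => Nat.pair i (N i), fun z' hz' => hI fun i hi => ?_⟩
  refine hN i hi _ (abs_sub_le_of_dyadicBit (z' i).2 (z i).2 fun k hk => ?_)
  have h1 : Nat.pair i k < I.sup fun i => Nat.pair i (N i) :=
    (Nat.pair_lt_pair_right i hk).trans_le (Finset.le_sup (f := fun i => Nat.pair i (N i)) hi)
  simpa [cubeBit] using hz' _ h1

/-- The block `(a, b, y)` prescribes `w` on the interval `[a, b)`. -/
def BlockSat (p : ℕ × ℕ × Finset ℕ) (w : ℕ → Prop) : Prop :=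
  ∀ n, p.1 ≤ n → n < p.2.1 → (w n ↔ n ∈ p.2.2)

theorem exists_block_of_prefix {O : Set HilbertCube} (hO : IsOpen O) (hOd : Dense O) (b : ℕ)
    (w : ℕ → Prop) : ∃ b' ≥ b, ∃ y : Finset ℕ, ∀ z, (∀ n < b, (cubeBit z n ↔ w n)) →
      BlockSat (b, b', y) (cubeBit z) → z ∈ O := by
  classical
  obtain ⟨z0, hz0⟩ := exists_eventually_cubeBit b w
  have h1 : ∀ᶠ z' in 𝓝 z0, ∀ n ∈ Finset.range b, (cubeBit z' n ↔ w n) := by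
    rw [Filter.eventually_all_finset]
    exact fun n hn => hz0 n (by simpa using hn)
  obtain ⟨z1, hz1, hz1O⟩ := mem_closure_iff_nhds.1 (hOd z0) _ h1
  obtain ⟨b1, hb1⟩ := exists_cubeBit_forces hO hz1O
  refine ⟨max b b1, le_max_left _ _, (Finset.range (max b b1)).filter (cubeBit z1),
    fun z hz hs => hb1 z fun n hn => ?_⟩
  rcases lt_or_ge n b with h | h
  · rw [hz n h]; exact (hz1 n (by simpa using h)).symm
  · rw [hs n h (lt_max_of_lt_right hn)]
    simp [hn]

theorem exists_block_of_prefixes {O : Set HilbertCube} (hO : IsOpen O) (hOd : Dense O) (a : ℕ)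
    (T : Finset (Finset ℕ)) : ∃ b ≥ a, ∃ y : Finset ℕ, ∀ u ∈ T, ∀ z,
      (∀ n < a, (cubeBit z n ↔ n ∈ u)) → BlockSat (a, b, y) (cubeBit z) → z ∈ O := by
  classical
  induction T using Finset.induction_on with
  | empty => exact ⟨a, le_rfl, ∅, by simp⟩
  | insert u T _ ih =>
    obtain ⟨b, hab, y, hy⟩ := ih
    obtain ⟨b', hbb', y', hy'⟩ := exists_block_of_prefix hO hOd b
      fun n => if n < a then n ∈ u else n ∈ y
    refine ⟨b', hab.trans hbb', (Finset.range b').filter fun n => if n < b then n ∈ y else n ∈ y',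
      fun v hv z hz hs => ?_⟩
    have hs1 : ∀ n, a ≤ n → n < b → (cubeBit z n ↔ n ∈ y) := fun n h1 h2 => by
      have h3 : n < b' := h2.trans_le hbb'
      rw [hs n h1 h3]; simp [h2, h3]
    have hs2 : ∀ n, b ≤ n → n < b' → (cubeBit z n ↔ n ∈ y') := fun n h1 h2 => by
      rw [hs n (hab.trans h1) h2]; simp [h2, h1.not_gt]
    rcases Finset.mem_insert.1 hv with rfl | hv
    · refine hy' z (fun n hn => ?_) hs2
      by_cases h : n < a
      · rw [if_pos h]; exact hz n h
      · rw [if_neg h]; exact hs1 n (not_lt.1 h) hn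
    · exact hy v hv z hz hs1

theorem exists_block {O : Set HilbertCube} (hO : IsOpen O) (hOd : Dense O) (a : ℕ) :
    ∃ b ≥ a, ∃ y : Finset ℕ, ∀ z, BlockSat (a, b, y) (cubeBit z) → z ∈ O := by
  classical
  obtain ⟨b, hab, y, h⟩ := exists_block_of_prefixes hO hOd a (Finset.range a).powerset
  refine ⟨b, hab, y, fun z hz => h ((Finset.range a).filter (cubeBit z)) ?_ z ?_ hz⟩
  · exact Finset.mem_powerset.2 (Finset.filter_subset _ _)
  · intro n hn; simp [hn]

/-- A list of consecutive blocks starting not before `a`. -/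
def IsBlockList (a : ℕ) (l : List (ℕ × ℕ × Finset ℕ)) : Prop :=
  l.Pairwise (fun p q => p.2.1 ≤ q.1) ∧ ∀ p ∈ l, a ≤ p.1 ∧ p.1 ≤ p.2.1

theorem exists_blockList {O : Set HilbertCube} (hO : IsOpen O) (hOd : Dense O) (k a : ℕ) :
    ∃ l, IsBlockList a l ∧ l.length = k ∧ ∀ p ∈ l, ∀ z, BlockSat p (cubeBit z) → z ∈ O := by
  induction k generalizing a with
  | zero => exact ⟨[], ⟨List.Pairwise.nil, by simp⟩, rfl, by simp⟩
  | succ k ih =>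
    obtain ⟨b, hab, y, hy⟩ := exists_block hO hOd a
    obtain ⟨l, ⟨h1, h2⟩, h3, h4⟩ := ih b
    refine ⟨(a, b, y) :: l, ⟨List.pairwise_cons.2 ⟨fun p hp => (h2 p hp).1, h1⟩, ?_⟩,
      by simp [h3], ?_⟩
    · intro p hp
      rcases List.mem_cons.1 hp with rfl | hp
      · exact ⟨le_rfl, hab⟩
      · exact ⟨hab.trans (h2 p hp).1, (h2 p hp).2⟩
    · intro p hp
      rcases List.mem_cons.1 hp with rfl | hp
      · exact hy
      · exact h4 p hp

theorem exists_forall_exists_blockSat {ι : Type*} (s : Finset ι) (L : ι → List (ℕ × ℕ × Finset ℕ))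
    (B : ℕ) (hL : ∀ i ∈ s, IsBlockList B (L i) ∧ s.card ≤ (L i).length) (w0 : ℕ → Prop) :
    ∃ w : ℕ → Prop, (∀ n < B, (w n ↔ w0 n)) ∧ ∀ i ∈ s, ∃ p ∈ L i, BlockSat p w := by
  classical
  induction hk : s.card generalizing s L B w0 with
  | zero =>
    rw [Finset.card_eq_zero] at hk
    subst hk
    exact ⟨w0, fun _ _ => Iff.rfl, by simp⟩
  | succ k ih =>
    have hne : ∀ i ∈ s, ∃ p l, L i = p :: l := fun i hi =>
      List.exists_cons_of_length_pos (by have := (hL i hi).2; omega)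
    have hs : s.Nonempty := Finset.card_pos.1 (by omega)
    choose! p l hpl using hne
    obtain ⟨i, hi, hmin⟩ := s.exists_min_image (fun i => (p i).2.1) hs
    have hpi := (hL i hi).1.2 (p i) (by rw [hpl i hi]; simp)
    obtain ⟨w, hw1, hw2⟩ := ih (s.erase i) l (p i).2.1 (fun j hj => by
        have hjs := Finset.mem_of_mem_erase hj
        have hmj := hmin j hjs
        obtain ⟨⟨h1, h2⟩, h3⟩ := hL j hjs
        rw [hpl j hjs] at h1 h2 h3
        rw [List.pairwise_cons] at h1
        refine ⟨⟨h1.2, fun q hq => ⟨hmj.trans (h1.1 q hq), (h2 q (List.mem_cons_of_mem _ hq)).2⟩⟩,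
          ?_⟩
        rw [Finset.card_erase_of_mem hi]
        simp only [List.length_cons] at h3
        omega)
      (fun n => if n < B then w0 n else n ∈ (p i).2.2) (by rw [Finset.card_erase_of_mem hi]; omega)
    refine ⟨w, fun n hn => ?_, fun j hj => ?_⟩
    · rw [hw1 n (by omega), if_pos hn]
    · by_cases hji : j = i
      · subst hji
        refine ⟨p j, by rw [hpl j hj]; simp, fun n h1 h2 => ?_⟩
        rw [hw1 n h2, if_neg (by omega)]
      · obtain ⟨q, hq, h⟩ := hw2 j (Finset.mem_erase.2 ⟨hji, hj⟩)
        exact ⟨q, by rw [hpl j hj]; exact List.mem_cons_of_mem _ hq, h⟩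

theorem exists_code_meagre : ∃ Φ : (ℕ → ℕ → ℕ) → Set HilbertCube, (∀ g, IsMeagre (Φ g)) ∧
    ∀ M : Set HilbertCube, IsMeagre M → ∃ Z : ℕ → ℕ, ∀ g : ℕ → ℕ → ℕ,
      (∀ᶠ m in atTop, ∃ i ≤ m, g m i = Z m) → M ⊆ Φ g := by
  obtain ⟨dec, hdec⟩ := exists_surjective_nat (List (ℕ × ℕ × Finset ℕ))
  let valid : ℕ → List (ℕ × ℕ × Finset ℕ) → Prop := fun m l => IsBlockList m l ∧ m + 1 ≤ l.length
  let Y : (ℕ → ℕ → ℕ) → ℕ → Set HilbertCube := fun g m =>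
    {z | ∀ i ≤ m, valid m (dec (g m i)) → ∃ p ∈ dec (g m i), BlockSat p (cubeBit z)}
  refine ⟨fun g => (⋂ n, ⋃ m ≥ n, interior (Y g m))ᶜ, fun g => ?_, fun M hM => ?_⟩
  · rw [IsMeagre, compl_compl]
    have hopen : ∀ n, IsOpen (⋃ m ≥ n, interior (Y g m)) := fun n =>
      isOpen_biUnion fun m _ => isOpen_interior
    refine residual_of_dense_Gδ (.iInter_of_isOpen hopen)
      (dense_iInter_of_isOpen hopen fun n => ?_)
    rw [dense_iff_inter_open]
    rintro U hU ⟨z0, hz0⟩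
    obtain ⟨b, hb⟩ := exists_cubeBit_forces hU hz0
    set m := max n b with hm
    classical
    let s := (Finset.range (m + 1)).filter fun i => valid m (dec (g m i))
    have hs : s.card ≤ m + 1 := (Finset.card_filter_le _ _).trans (by simp)
    obtain ⟨w, hw1, hw2⟩ := exists_forall_exists_blockSat s (fun i => dec (g m i)) m
      (fun i hi => ⟨(Finset.mem_filter.1 hi).2.1, hs.trans (Finset.mem_filter.1 hi).2.2⟩)
      (cubeBit z0)
    choose! p hp1 hp2 using hw2
    set C := max m (s.sup fun i => (p i).2.1) with hC
    obtain ⟨z, hz⟩ := exists_eventually_cubeBit C w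
    have hev : ∀ᶠ z' in 𝓝 z, ∀ k ∈ Finset.range C, (cubeBit z' k ↔ w k) := by
      rw [Filter.eventually_all_finset]
      exact fun k hk => hz k (by simpa using hk)
    refine ⟨z, hb z fun k hk => ?_, ?_⟩
    · have hkm : k < m := hk.trans_le (le_max_right _ _)
      rw [← hw1 k hkm]
      exact hev.self_of_nhds k (by simp [hC, hkm])
    · simp only [mem_iUnion]
      refine ⟨m, le_max_left _ _, mem_interior_iff_mem_nhds.2 ?_⟩
      filter_upwards [hev] with z' hz' i hi hv
      have his : i ∈ s := by simp [s, Nat.lt_succ_of_le hi, hv]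
      refine ⟨p i, hp1 i his, fun k h1 h2 => ?_⟩
      rw [← hp2 i his k h1 h2]
      refine hz' k (Finset.mem_range.2 ?_)
      exact h2.trans_le ((Finset.le_sup (f := fun i => (p i).2.1) his).trans (le_max_right _ _))
  · obtain ⟨t, htM, htG, htd⟩ := mem_residual.1 hM
    obtain ⟨f, hfo, rfl⟩ := isGδ_iff_eq_iInter_nat.1 htG
    let O : ℕ → Set HilbertCube := fun n => ⋂ k ∈ Finset.range (n + 1), f k
    have hO : ∀ n, IsOpen (O n) := fun n => isOpen_biInter_finset fun k _ => hfo k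
    have hOd : ∀ n, Dense (O n) := fun n =>
      htd.mono (subset_iInter₂ fun k _ => iInter_subset f k)
    have hZ : ∀ m, ∃ c, IsBlockList m (dec c) ∧ (dec c).length = m + 1 ∧
        ∀ p ∈ dec c, ∀ z, BlockSat p (cubeBit z) → z ∈ O m := fun m => by
      obtain ⟨l, hl⟩ := exists_blockList (hO m) (hOd m) (m + 1) m
      obtain ⟨c, rfl⟩ := hdec l
      exact ⟨c, hl⟩
    choose Z hZ1 hZ2 hZ3 using hZ
    refine ⟨Z, fun g hg z hzM hz => ?_⟩
    refine htM ?_ hzM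
    refine mem_iInter.2 fun k => ?_
    obtain ⟨N, hN⟩ := eventually_atTop.1 hg
    obtain ⟨m, hm, hzm⟩ := mem_iUnion₂.1 (mem_iInter.1 hz (max N k))
    obtain ⟨i, hi, e⟩ := hN m ((le_max_left _ _).trans hm)
    obtain ⟨p, hp, hps⟩ := interior_subset hzm i hi (by
      rw [e]; exact ⟨hZ1 m, (hZ2 m).ge⟩)
    rw [e] at hp
    exact mem_iInter₂.1 (hZ3 m p hp z hps) k
      (Finset.mem_range.2 (Nat.lt_succ_of_le ((le_max_right _ _).trans hm)))

/-- The Tukey connection behind the inequalities `cov(σG₀) ≤ add(M)` and `cof(M) ≤ non(σG₀)`. -/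
theorem exists_tukey_connection : ∃ (φ : HilbertCube → Set HilbertCube)
    (ψ : Set HilbertCube → Set HilbertCube), (∀ x, IsMeagre (φ x)) ∧
      ∀ M, IsMeagre M → ψ M ∈ sigmaG0 ∧ ∀ x ∉ ψ M, M ⊆ φ x := by
  obtain ⟨Φ, hΦ, h⟩ := exists_code_meagre
  have : ∀ M : Set HilbertCube, ∃ S, IsMeagre M → S ∈ sigmaG0 ∧
      ∀ x ∉ S, M ⊆ Φ fun m i => firstOne m (x i) := by
    intro M
    by_cases hM : IsMeagre M
    · obtain ⟨Z, hZ⟩ := h M hM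
      obtain ⟨S, hS, hSx⟩ := exists_mem_sigmaG0_firstOne Z
      exact ⟨S, fun _ => ⟨hS, fun x hx => hZ _ (hSx x hx)⟩⟩
    · exact ⟨∅, fun h => absurd h hM⟩
  choose ψ hψ using this
  exact ⟨_, ψ, fun x => hΦ _, hψ⟩

section DiscretePoincareMiranda

variable {ι : Type*} [DecidableEq ι]

/-- The lattice point after `z` in direction `j`. -/
def latticeStep (z : ι → ℕ) (j : ι) : ι → ℕ := Function.update z j (z j + 1)

theorem latticeStep_comm (z : ι → ℕ) (i j : ι) :
    latticeStep (latticeStep z i) j = latticeStep (latticeStep z j) i := by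
  by_cases h : i = j
  · rw [h]
  · funext k
    simp only [latticeStep, Function.update_apply]
    split_ifs <;> simp_all

/-- The mod 2 coboundary of a cubical cochain, a cube being given by its least vertex and its
set of directions. -/
def cubeCoboundary (c : Finset ι → (ι → ℕ) → ZMod 2) (J : Finset ι) (z : ι → ℕ) : ZMod 2 :=
  ∑ j ∈ J, (c (J.erase j) (latticeStep z j) + c (J.erase j) z)

/-- The cup product of the coboundaries of the `0`-cochains `s i`, for `i` in a list. -/
def cubeCup (s : ι → (ι → ℕ) → ZMod 2) : List ι → Finset ι → (ι → ℕ) → ZMod 2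
  | [], J, _ => if J = ∅ then 1 else 0
  | i :: L, J, z =>
    ∑ j ∈ J, (s i (latticeStep z j) + s i z) * cubeCup s L (J.erase j) (latticeStep z j)

theorem sum_sum_erase_eq_zero (J : Finset ι) (f : ι → ι → ZMod 2) (hf : ∀ i j, f i j = f j i) :
    ∑ i ∈ J, ∑ j ∈ J.erase i, f i j = 0 := by
  rw [Finset.sum_sigma']
  refine Finset.sum_involution (fun p _ => ⟨p.2, p.1⟩) ?_ ?_ ?_ ?_
  · intro p _
    simp only
    rw [hf]; exact CharTwo.add_self_eq_zero _
  · intro p hp _ h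
    simp only [Finset.mem_sigma, Finset.mem_erase] at hp
    exact hp.2.1 (congrArg Sigma.fst h)
  · intro p hp
    simp only [Finset.mem_sigma, Finset.mem_erase] at hp ⊢
    exact ⟨hp.2.2, hp.2.1.symm, hp.1⟩
  · intro p _; rfl

theorem cubeCoboundary_cubeCoboundary (c : Finset ι → (ι → ℕ) → ZMod 2) (J : Finset ι)
    (z : ι → ℕ) : cubeCoboundary (cubeCoboundary c) J z = 0 := by
  simp only [cubeCoboundary, ← Finset.sum_add_distrib]
  refine sum_sum_erase_eq_zero J _ fun i j => ?_
  rw [Finset.erase_right_comm, latticeStep_comm z i j]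
  ring

theorem cubeCoboundary_mul (t : (ι → ℕ) → ZMod 2) (c : Finset ι → (ι → ℕ) → ZMod 2)
    (J : Finset ι) (z : ι → ℕ) :
    cubeCoboundary (fun J z => t z * c J z) J z =
      ∑ j ∈ J, (t (latticeStep z j) + t z) * c (J.erase j) (latticeStep z j) +
        t z * cubeCoboundary c J z := by
  simp only [cubeCoboundary, Finset.mul_sum, ← Finset.sum_add_distrib]
  refine Finset.sum_congr rfl fun j _ => ?_
  have := CharTwo.add_self_eq_zero (t z * c (J.erase j) (latticeStep z j))
  linear_combination -this

theorem cubeCoboundary_cubeCup (s : ι → (ι → ℕ) → ZMod 2) (L : List ι) (J : Finset ι)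
    (z : ι → ℕ) : cubeCoboundary (cubeCup s L) J z = 0 := by
  induction L generalizing J z with
  | nil => simp [cubeCoboundary, cubeCup, CharTwo.add_self_eq_zero]
  | cons i L ih =>
    have h : cubeCup s (i :: L) = cubeCoboundary (fun J z => s i z * cubeCup s L J z) := by
      funext J z
      rw [cubeCoboundary_mul, ih, mul_zero, add_zero, cubeCup]
    rw [h, cubeCoboundary_cubeCoboundary]

theorem cubeCup_cons (s : ι → (ι → ℕ) → ZMod 2) (i : ι) (L : List ι) (J : Finset ι)
    (z : ι → ℕ) :
    cubeCup s (i :: L) J z = ∑ j ∈ J, (s i (latticeStep z j) * cubeCup s L (J.erase j)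
      (latticeStep z j) + s i z * cubeCup s L (J.erase j) z) := by
  have h := cubeCoboundary_mul (s i) (cubeCup s L) J z
  rw [cubeCoboundary_cubeCup, mul_zero, add_zero] at h
  rw [cubeCup, ← h, cubeCoboundary]

theorem exists_ne_of_cubeCup_ne_zero {s : ι → (ι → ℕ) → ZMod 2} {L : List ι} {J : Finset ι}
    {z : ι → ℕ} (h : cubeCup s L J z ≠ 0) {i : ι} (hi : i ∈ L) :
    ∃ u v : ι → ℕ, (∀ l, z l ≤ u l ∧ u l ≤ z l + 1 ∧ z l ≤ v l ∧ v l ≤ z l + 1) ∧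
      (∀ l ∉ J, u l = z l ∧ v l = z l) ∧ s i u ≠ s i v := by
  induction L generalizing J z with
  | nil => simp at hi
  | cons k L ih =>
    obtain ⟨j, hj, hne⟩ := Finset.exists_ne_zero_of_sum_ne_zero h
    have h1 := left_ne_zero_of_mul hne
    have h2 := right_ne_zero_of_mul hne
    have hstep : ∀ l, l ≠ j → latticeStep z j l = z l := fun l hl => by simp [latticeStep, hl]
    have hstepj : latticeStep z j j = z j + 1 := by simp [latticeStep]
    rcases List.mem_cons.1 hi with rfl | hi
    · refine ⟨latticeStep z j, z, fun l => ?_, fun l hl => ⟨hstep l ?_, rfl⟩, fun h => h1 ?_⟩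
      · rcases eq_or_ne l j with rfl | hl
        · omega
        · have := hstep l hl; omega
      · rintro rfl; exact hl hj
      · rw [h]; exact CharTwo.add_self_eq_zero _
    · obtain ⟨u, v, hb, ho, hne⟩ := ih h2 hi
      have hoj := ho j (Finset.notMem_erase j J)
      refine ⟨u, v, fun l => ?_, fun l hl => ?_, hne⟩
      · rcases eq_or_ne l j with rfl | hl
        · omega
        · have := hb l; rw [hstep l hl] at this; exact this
      · have hlj : l ≠ j := by rintro rfl; exact hl hj
        have := ho l fun h => hl (Finset.mem_of_mem_erase h)
        rwa [hstep l hlj] at this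

variable [Fintype ι]

theorem sum_piFinset_eq_sum_update {M : Type*} [AddCommMonoid M] (A : ι → Finset ℕ) (j : ι)
    (g : (ι → ℕ) → M) :
    ∑ z ∈ Fintype.piFinset A, g z =
      ∑ w ∈ Fintype.piFinset (Function.update A j {0}), ∑ a ∈ A j, g (Function.update w j a) := by
  rw [Finset.sum_sigma']
  refine Finset.sum_bij' (fun z _ => ⟨Function.update z j 0, z j⟩)
    (fun p _ => Function.update p.1 j p.2) ?_ ?_ ?_ ?_ ?_
  · intro z hz
    rw [Fintype.mem_piFinset] at hz
    simp only [Finset.mem_sigma, Fintype.mem_piFinset]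
    refine ⟨fun k => ?_, hz j⟩
    rcases eq_or_ne k j with rfl | hk
    · simp
    · simpa [hk] using hz k
  · rintro ⟨w, a⟩ hp
    simp only [Finset.mem_sigma, Fintype.mem_piFinset] at hp ⊢
    intro k
    rcases eq_or_ne k j with rfl | hk
    · simpa using hp.2
    · simpa [hk] using hp.1 k
  · intro z _; simp
  · rintro ⟨w, a⟩ hp
    simp only [Finset.mem_sigma, Fintype.mem_piFinset] at hp
    have h0 : w j = 0 := by simpa using hp.1 j
    simp [← h0]
  · intro z _; simp

theorem sum_piFinset_latticeStep (A : ι → Finset ℕ) (j : ι) {n : ℕ} (hA : A j = Finset.range n)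
    (f : (ι → ℕ) → ZMod 2) :
    ∑ z ∈ Fintype.piFinset A, (f (latticeStep z j) + f z) =
      ∑ z ∈ Fintype.piFinset (Function.update A j {n}), f z +
        ∑ z ∈ Fintype.piFinset (Function.update A j {0}), f z := by
  have hface := sum_piFinset_eq_sum_update (Function.update A j {n}) j f
  simp only [Function.update_idem, Function.update_self, Finset.sum_singleton] at hface
  rw [hface, sum_piFinset_eq_sum_update A j, ← Finset.sum_add_distrib, hA]
  refine Finset.sum_congr rfl fun w hw => ?_
  have hwj : w j = 0 := by simpa using Fintype.mem_piFinset.1 hw j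
  have h := Finset.sum_range_sub (fun a => f (Function.update w j a)) n
  rw [← hwj, Function.update_eq_self, CharTwo.sub_eq_add] at h
  rw [← h]
  refine Finset.sum_congr rfl fun a _ => ?_
  simp [latticeStep, CharTwo.sub_eq_add]

theorem sum_cubeCup_eq_one {n : ℕ} {s : ι → (ι → ℕ) → ZMod 2} (h0 : ∀ i z, z i = 0 → s i z = 0)
    (h1 : ∀ i z, z i = n → s i z = 1) {L : List ι} (hL : L.Nodup) :
    ∑ z ∈ Fintype.piFinset (fun i => if i ∈ L then Finset.range n else {n}),
      cubeCup s L L.toFinset z = 1 := by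
  induction L with
  | nil => simp [cubeCup]
  | cons i L ih =>
    have hiL : i ∉ L := (List.nodup_cons.1 hL).1
    set A : ι → Finset ℕ := fun k => if k ∈ i :: L then Finset.range n else {n} with hA
    have hAi : Function.update A i {n} = fun k => if k ∈ L then Finset.range n else {n} := by
      funext k
      rcases eq_or_ne k i with rfl | hk
      · simp [hiL]
      · simp [hA, hk]
    have hface : ∀ j ∈ L, ∀ a, (a = 0 ∨ a = n) →
        ∑ z ∈ Fintype.piFinset (Function.update A j {a}),
          s i z * cubeCup s L ((i :: L).toFinset.erase j) z = 0 := by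
      intro j hj a ha
      refine Finset.sum_eq_zero fun z hz => ?_
      by_contra hne
      obtain ⟨u, v, -, ho, huv⟩ := exists_ne_of_cubeCup_ne_zero (right_ne_zero_of_mul hne) hj
      obtain ⟨hu, hv⟩ := ho j (Finset.notMem_erase _ _)
      have hz : z j = a := by simpa using Fintype.mem_piFinset.1 hz j
      rcases ha with rfl | rfl
      · exact huv (by rw [h0 j u (by omega), h0 j v (by omega)])
      · exact huv (by rw [h1 j u (by omega), h1 j v (by omega)])
    simp only [cubeCup_cons]
    rw [Finset.sum_comm, ← Finset.add_sum_erase _ _ (show i ∈ (i :: L).toFinset by simp),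
      Finset.sum_eq_zero (s := (i :: L).toFinset.erase i), add_zero]
    · rw [sum_piFinset_latticeStep A i (n := n) (by simp [hA])
        (fun z => s i z * cubeCup s L ((i :: L).toFinset.erase i) z),
        Finset.sum_eq_zero (s := Fintype.piFinset (Function.update A i {0})), add_zero, hAi,
        ← ih (List.nodup_cons.1 hL).2]
      · refine Finset.sum_congr rfl fun z hz => ?_
        have hz : z i = n := by simpa [hiL] using Fintype.mem_piFinset.1 hz i
        rw [h1 i z hz, one_mul, List.toFinset_cons, Finset.erase_insert (by simpa using hiL)]
      · intro z hz
        have hz : z i = 0 := by simpa using Fintype.mem_piFinset.1 hz i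
        rw [h0 i z hz, zero_mul]
    · intro j hj
      have hjL : j ∈ L := by
        simp only [List.toFinset_cons, Finset.mem_erase, Finset.mem_insert, List.mem_toFinset] at hj
        tauto
      rw [sum_piFinset_latticeStep A j (n := n) (by simp [hA, hjL])
        (fun z => s i z * cubeCup s L ((i :: L).toFinset.erase j) z),
        hface j hjL n (Or.inr rfl), hface j hjL 0 (Or.inl rfl), add_zero]

/-- The discrete Poincaré–Miranda theorem. -/
theorem exists_cube_forall_ne {n : ℕ} {s : ι → (ι → ℕ) → ZMod 2}
    (h0 : ∀ i z, z i = 0 → s i z = 0) (h1 : ∀ i z, z i = n → s i z = 1) :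
    ∃ z : ι → ℕ, (∀ i, z i < n) ∧ ∀ i, ∃ u v : ι → ℕ,
      (∀ l, z l ≤ u l ∧ u l ≤ z l + 1 ∧ z l ≤ v l ∧ v l ≤ z l + 1) ∧ s i u ≠ s i v := by
  have h := sum_cubeCup_eq_one h0 h1 (Finset.nodup_toList (Finset.univ : Finset ι))
  obtain ⟨z, hz, hne⟩ := Finset.exists_ne_zero_of_sum_ne_zero (h.trans_ne one_ne_zero)
  refine ⟨z, fun i => by simpa using Fintype.mem_piFinset.1 hz i, fun i => ?_⟩
  obtain ⟨u, v, hb, -, huv⟩ := exists_ne_of_cubeCup_ne_zero hne (i := i) (by simp)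
  exact ⟨u, v, hb, huv⟩

end DiscretePoincareMiranda

/-- A sequence of sets separating the opposite faces of the Hilbert cube has a common frontier
point. -/
theorem nonempty_iInter_frontier {W : ℕ → Set HilbertCube} (h0 : ∀ i x, x i = 0 → x ∈ W i)
    (h1 : ∀ i x, x i = 1 → x ∉ W i) : (⋂ i, frontier (W i)).Nonempty := by
  classical
  let q : (n : ℕ) → (Fin n → ℕ) → HilbertCube := fun n u k =>
    if h : k < n then projIcc 0 1 zero_le_one ((u ⟨k, h⟩ : ℝ) / (n + 1)) else 0
  have hq : ∀ n, ∃ z : Fin n → ℕ, ∀ i < n, ∃ u v : Fin n → ℕ,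
      (∀ l, z l ≤ u l ∧ u l ≤ z l + 1 ∧ z l ≤ v l ∧ v l ≤ z l + 1) ∧ q n u ∈ W i ∧
        q n v ∉ W i := by
    intro n
    obtain ⟨z, -, hz⟩ := exists_cube_forall_ne (ι := Fin n) (n := n + 1)
      (s := fun i u => if q n u ∈ W i then 0 else 1)
      (fun i u hu => if_pos (h0 _ _ (by simp [q, hu])))
      (fun i u hu => if_neg (h1 _ _ (by
        have : ((n : ℝ) + 1) ≠ 0 := by positivity
        simp only [q, i.2, dite_true, hu]
        push_cast
        rw [div_self this]
        exact projIcc_right _)))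
    refine ⟨z, fun i hi => ?_⟩
    obtain ⟨u, v, hb, huv⟩ := hz ⟨i, hi⟩
    simp only at huv
    by_cases hu : q n u ∈ W i <;> by_cases hv : q n v ∈ W i
    · simp [hu, hv] at huv
    · exact ⟨u, v, hb, hu, hv⟩
    · exact ⟨v, u, fun l => ⟨(hb l).2.2.1, (hb l).2.2.2, (hb l).1, (hb l).2.1⟩, hv, hu⟩
    · simp [hu, hv] at huv
  choose z hz using hq
  obtain ⟨p, φ, hφ, hp⟩ := CompactSpace.tendsto_subseq fun n => q n (z n)
  have hlim : ∀ w : (n : ℕ) → Fin n → ℕ, (∀ n l, z n l ≤ w n l ∧ w n l ≤ z n l + 1) →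
      Tendsto (fun m => q (φ m) (w (φ m))) atTop (𝓝 p) := by
    intro w hw
    rw [tendsto_pi_nhds] at hp ⊢
    intro k
    refine tendsto_of_tendsto_of_dist (hp k) ?_
    refine squeeze_zero (fun _ => dist_nonneg) (fun m => ?_)
      (tendsto_one_div_add_atTop_nhds_zero_nat.comp hφ.tendsto_atTop)
    simp only [Function.comp, q]
    split_ifs with h
    · have hpos : (0 : ℝ) < (φ m : ℝ) + 1 := by positivity
      refine ((LipschitzWith.projIcc zero_le_one).dist_le_mul _ _).trans ?_
      rw [NNReal.coe_one, one_mul, Real.dist_eq, ← sub_div, abs_div, abs_of_pos hpos]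
      gcongr
      have h1 : ((z (φ m) ⟨k, h⟩ : ℕ) : ℝ) ≤ w (φ m) ⟨k, h⟩ := by exact_mod_cast (hw _ _).1
      have h2 : ((w (φ m) ⟨k, h⟩ : ℕ) : ℝ) ≤ z (φ m) ⟨k, h⟩ + 1 := by exact_mod_cast (hw _ _).2
      rw [abs_le]
      constructor <;> linarith
    · rw [dist_self]; positivity
  refine ⟨p, mem_iInter.2 fun i => ?_⟩
  have hi : ∀ n, ∃ u v : Fin n → ℕ,
      (∀ l, z n l ≤ u l ∧ u l ≤ z n l + 1) ∧ (∀ l, z n l ≤ v l ∧ v l ≤ z n l + 1) ∧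
        (i < n → q n u ∈ W i ∧ q n v ∉ W i) := by
    intro n
    by_cases hin : i < n
    · obtain ⟨u, v, hb, h⟩ := hz n i hin
      exact ⟨u, v, fun l => ⟨(hb l).1, (hb l).2.1⟩, fun l => (hb l).2.2, fun _ => h⟩
    · exact ⟨z n, z n, fun l => by omega, fun l => by omega, fun h => absurd h hin⟩
  choose u v hu hv huv using hi
  have hev : ∀ᶠ m in atTop, i < φ m := hφ.tendsto_atTop.eventually_gt_atTop i
  rw [frontier_eq_closure_inter_closure]
  exact ⟨mem_closure_of_tendsto (hlim u hu) (hev.mono fun m hm => (huv _ hm).1),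
    mem_closure_of_tendsto (hlim v hv) (hev.mono fun m hm => (huv _ hm).2)⟩

/-- The points of the Hilbert cube all of whose coordinates are irrational. -/
def irrationalCube : Set HilbertCube := {x | ∀ i, Irrational (x i : ℝ)}

theorem isGδ_irrationalCube : IsGδ irrationalCube := by
  have : irrationalCube = ⋂ i : ℕ, (fun x : HilbertCube => (x i : ℝ)) ⁻¹' {t | Irrational t} := by
    ext x; simp [irrationalCube]
  rw [this]
  exact IsGδ.iInter fun i => IsGδ.setOfPred_irrational.preimage (by fun_prop)

theorem dense_irrationalCube : Dense irrationalCube := by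
  have h : Dense {t : Icc (0 : ℝ) 1 | Irrational (t : ℝ)} := by
    rw [Metric.dense_iff]
    intro x r hr
    obtain ⟨a, ha, h1, h2⟩ := exists_irrational_btwn
      (show max 0 ((x : ℝ) - r) < min 1 ((x : ℝ) + r) by
        have := x.2.1
        have := x.2.2
        simp only [max_lt_iff, lt_min_iff]
        refine ⟨⟨one_pos, by linarith⟩, ⟨by linarith, by linarith⟩⟩)
    simp only [max_lt_iff, lt_min_iff] at h1 h2
    refine ⟨⟨a, h1.1.le, h2.1.le⟩, ?_, ha⟩
    rw [Metric.mem_ball, Subtype.dist_eq, Real.dist_eq, abs_lt]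
    constructor <;> linarith
  refine (dense_pi Set.univ fun (i : ℕ) (_ : i ∈ Set.univ) => h).mono ?_
  intro z hz i
  exact hz i trivial

theorem exists_isOpen_frontier_disjoint {U : Set (Icc (0 : ℝ) 1)} (hU : IsOpen U)
    {y : Icc (0 : ℝ) 1} (hy : y ∈ U) :
    ∃ V : Set (Icc (0 : ℝ) 1), IsOpen V ∧ y ∈ V ∧ V ⊆ U ∧
      ∀ t ∈ frontier V, ¬ Irrational (t : ℝ) := by
  obtain ⟨r, hr, hrU⟩ := Metric.isOpen_iff.1 hU y hy
  obtain ⟨a, ha1, ha2⟩ := exists_rat_btwn (show (y : ℝ) - r < y by linarith)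
  obtain ⟨b, hb1, hb2⟩ := exists_rat_btwn (show (y : ℝ) < y + r by linarith)
  refine ⟨(fun t : Icc (0 : ℝ) 1 => (t : ℝ)) ⁻¹' Ioo a b, isOpen_Ioo.preimage (by fun_prop),
    ⟨ha2, hb1⟩, fun t ht => hrU ?_, fun t ht => ?_⟩
  · rw [Metric.mem_ball, Subtype.dist_eq, Real.dist_eq, abs_lt]
    have := ht.1
    have := ht.2
    constructor <;> linarith
  · have h := (show Continuous fun t : Icc (0 : ℝ) 1 => (t : ℝ) by
      fun_prop).frontier_preimage_subset _ ht
    rw [mem_preimage, frontier_Ioo (ha2.trans hb1)] at h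
    rcases h with h | h
    · rw [h]; exact Rat.not_irrational a
    · rw [mem_singleton_iff.1 h]; exact Rat.not_irrational b

theorem exists_box_frontier_disjoint {O : Set HilbertCube} (hO : IsOpen O) {y : HilbertCube}
    (hy : y ∈ O) :
    ∃ V : Set HilbertCube, IsOpen V ∧ y ∈ V ∧ V ⊆ O ∧ Disjoint (frontier V) irrationalCube := by
  obtain ⟨F, U, hU, hUO⟩ := isOpen_pi_iff.1 hO y hy
  suffices h : ∃ V : Set HilbertCube, IsOpen V ∧ y ∈ V ∧ V ⊆ (F : Set ℕ).pi U ∧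
      Disjoint (frontier V) irrationalCube by
    obtain ⟨V, h1, h2, h3, h4⟩ := h
    exact ⟨V, h1, h2, h3.trans hUO, h4⟩
  clear hUO
  induction F using Finset.induction_on with
  | empty => exact ⟨Set.univ, isOpen_univ, trivial, by simp, by simp⟩
  | insert i F _ ih =>
    obtain ⟨V, h1, h2, h3, h4⟩ := ih fun k hk => hU k (Finset.mem_insert_of_mem hk)
    have hUi := hU i (Finset.mem_insert_self i F)
    obtain ⟨T, hTo, hyT, hTU, hT⟩ := exists_isOpen_frontier_disjoint hUi.1 hUi.2
    refine ⟨(fun x : HilbertCube => x i) ⁻¹' T ∩ V, (hTo.preimage (continuous_apply i)).inter h1,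
      ⟨hyT, h2⟩, ?_, ?_⟩
    · rintro x ⟨hx1, hx2⟩ k hk
      rcases Finset.mem_insert.1 hk with rfl | hk
      · exact hTU hx1
      · exact h3 hx2 k hk
    · rw [Set.disjoint_left] at h4 ⊢
      intro x hx hirr
      rcases frontier_inter_subset _ _ hx with h | h
      · have hc : Continuous fun x : HilbertCube => x i := continuous_apply i
        exact hT (x i) (hc.frontier_preimage_subset T h.1) (hirr i)
      · exact h4 h.2 hirr

theorem exists_nhds_frontier_disjoint {K O : Set HilbertCube} (hK : IsCompact K) (hO : IsOpen O)
    (hKO : K ⊆ O) : ∃ V : Set HilbertCube, K ⊆ V ∧ V ⊆ O ∧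
      Disjoint (frontier V) irrationalCube := by
  refine hK.induction_on (p := fun K => ∃ V : Set HilbertCube, K ⊆ V ∧ V ⊆ O ∧
      Disjoint (frontier V) irrationalCube) ⟨∅, subset_rfl, empty_subset _, by simp⟩ ?_ ?_ ?_
  · rintro s t hst ⟨V, h1, h2⟩
    exact ⟨V, hst.trans h1, h2⟩
  · rintro s t ⟨V, h1, h2, h3⟩ ⟨V', h1', h2', h3'⟩
    refine ⟨V ∪ V', union_subset_union h1 h1', union_subset h2 h2', ?_⟩
    rw [Set.disjoint_left] at h3 h3' ⊢
    intro x hx hirr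
    rcases frontier_union_subset _ _ hx with h | h
    · exact h3 h.1 hirr
    · exact h3' h.2 hirr
  · intro x hx
    obtain ⟨V, hV, hxV, hVO, hd⟩ := exists_box_frontier_disjoint hO (hKO hx)
    exact ⟨V, mem_nhdsWithin_of_mem_nhds (hV.mem_nhds hxV), V, subset_rfl, hVO, hd⟩

theorem univ_notMem_sigmaG0 : Set.univ ∉ sigmaG0 := by
  rintro ⟨A, hA, hcov⟩
  have key : ∀ i, ∃ W : Set HilbertCube, (∀ x, x i = 0 → x ∈ W) ∧ (∀ x, x i = 1 → x ∉ W) ∧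
      Disjoint (frontier W) (A i) := by
    intro i
    obtain ⟨-, -, h⟩ := hA i
    obtain ⟨h, hh⟩ := h _ isGδ_irrationalCube dense_irrationalCube
    have hclosed : ∀ a : Icc (0 : ℝ) 1, IsClosed {x : HilbertCube | x i = a} := fun a =>
      isClosed_eq (continuous_apply i) continuous_const
    obtain ⟨V, hKV, hVO, hd⟩ := exists_nhds_frontier_disjoint
      (K := h '' {x | x i = 0}) (O := (h '' {x | x i = 1})ᶜ)
      ((hclosed 0).isCompact.image h.continuous)
      (h.isClosedMap _ (hclosed 1)).isOpen_compl (by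
        rintro _ ⟨x, hx, rfl⟩ ⟨y, hy, hxy⟩
        rw [h.injective hxy] at hy
        exact zero_ne_one (hx.symm.trans hy))
    refine ⟨h ⁻¹' V, fun x hx => hKV ⟨x, hx, rfl⟩, fun x hx hxV => hVO hxV ⟨x, hx, rfl⟩, ?_⟩
    rw [← h.preimage_frontier, Set.disjoint_left]
    intro x hx hxA
    exact Set.disjoint_left.1 hd hx (hh ⟨x, hxA, rfl⟩)
  choose W h0 h1 hd using key
  obtain ⟨p, hp⟩ := nonempty_iInter_frontier h0 h1
  obtain ⟨i, hi⟩ := mem_iUnion.1 (hcov (Set.mem_univ p))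
  exact Set.disjoint_left.1 (hd i) (mem_iInter.1 hp i) hi

section IdealCardinals

variable {X : Type*} {I J : Set (Set X)}

theorem aleph_one_le_addIdeal (hempty : ∅ ∈ I)
    (hunion : ∀ A : ℕ → Set X, (∀ n, A n ∈ I) → ⋃ n, A n ∈ I) (hI : ⋃₀ I ∉ I) :
    ℵ₁ ≤ addIdeal I := by
  refine le_csInf ⟨_, I, subset_rfl, hI, rfl⟩ ?_
  rintro _ ⟨A, hA, hU, rfl⟩
  by_contra! h
  rw [lt_aleph_one_iff, le_aleph0_iff_set_countable] at h
  rcases A.eq_empty_or_nonempty with rfl | hne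
  · exact hU (by simpa using hempty)
  · obtain ⟨f, rfl⟩ := h.exists_eq_range hne
    exact hU (by simpa [sUnion_range] using hunion f fun n => hA ⟨n, rfl⟩)

theorem addIdeal_le_covIdeal (hcov : ⋃₀ I = Set.univ) (hI : Set.univ ∉ I) :
    addIdeal I ≤ covIdeal I := by
  refine le_csInf ⟨_, I, subset_rfl, hcov, rfl⟩ ?_
  rintro _ ⟨A, hA, hU, rfl⟩
  exact csInf_le' ⟨A, hA, by rwa [hU], rfl⟩

theorem addIdeal_le_cofIdeal (hcov : ⋃₀ I = Set.univ) (hI : Set.univ ∉ I) :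
    addIdeal I ≤ cofIdeal I := by
  refine le_csInf ⟨_, I, subset_rfl, fun B hB => ⟨B, hB, subset_rfl⟩, rfl⟩ ?_
  rintro _ ⟨A, hA, hc, rfl⟩
  refine csInf_le' ⟨A, hA, fun h => hI ?_, rfl⟩
  convert h
  refine (eq_univ_of_forall fun x => ?_).symm
  obtain ⟨B, hB, hx⟩ := mem_sUnion.1 (hcov.ge (Set.mem_univ x))
  obtain ⟨C, hC, hBC⟩ := hc B hB
  exact ⟨C, hC, hBC hx⟩

theorem nonIdeal_le_cofIdeal (hI : Set.univ ∉ I) :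
    nonIdeal I ≤ cofIdeal I := by
  refine le_csInf ⟨_, I, subset_rfl, fun B hB => ⟨B, hB, subset_rfl⟩, rfl⟩ ?_
  rintro _ ⟨A, hA, hc, rfl⟩
  have h : ∀ C : A, ∃ x, x ∉ (C : Set X) := by
    rintro ⟨C, hC⟩
    by_contra! hx
    exact hI (eq_univ_of_forall hx ▸ hA hC)
  choose f hf using h
  suffices hr : range f ∉ I from
    (show nonIdeal I ≤ #(range f) from csInf_le' ⟨range f, hr, rfl⟩).trans mk_range_le
  intro hr
  obtain ⟨C, hC, hsub⟩ := hc _ hr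
  exact hf ⟨C, hC⟩ (hsub ⟨⟨C, hC⟩, rfl⟩)

variable {φ : X → Set X} {ψ : Set X → Set X}

theorem covIdeal_le_addIdeal_of_tukey (hdown : ∀ A ∈ J, ∀ B ⊆ A, B ∈ J) (hJ : ⋃₀ J ∉ J)
    (hφ : ∀ x, φ x ∈ J) (hψ : ∀ M ∈ J, ψ M ∈ I) (h : ∀ M ∈ J, ∀ x ∉ ψ M, M ⊆ φ x) :
    covIdeal I ≤ addIdeal J := by
  refine le_csInf ⟨_, J, subset_rfl, hJ, rfl⟩ ?_
  rintro _ ⟨A, hA, hU, rfl⟩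
  refine (show covIdeal I ≤ #(ψ '' A) from csInf_le' ⟨ψ '' A, ?_, ?_, rfl⟩).trans mk_image_le
  · rintro _ ⟨M, hM, rfl⟩
    exact hψ M (hA hM)
  · by_contra hne
    obtain ⟨x, hx⟩ := (ne_univ_iff_exists_notMem _).1 hne
    refine hU (hdown _ (hφ x) _ (sUnion_subset fun M hM => h M (hA hM) x fun hxM => hx ?_))
    exact ⟨ψ M, mem_image_of_mem ψ hM, hxM⟩

theorem cofIdeal_le_nonIdeal_of_tukey (hdown : ∀ A ∈ I, ∀ B ⊆ A, B ∈ I) (hI : Set.univ ∉ I)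
    (hφ : ∀ x, φ x ∈ J) (hψ : ∀ M ∈ J, ψ M ∈ I) (h : ∀ M ∈ J, ∀ x ∉ ψ M, M ⊆ φ x) :
    cofIdeal J ≤ nonIdeal I := by
  refine le_csInf ⟨_, Set.univ, hI, rfl⟩ ?_
  rintro _ ⟨A, hA, rfl⟩
  refine (show cofIdeal J ≤ #(φ '' A) from
    csInf_le' ⟨φ '' A, ?_, fun M hM => ?_, rfl⟩).trans mk_image_le
  · rintro _ ⟨x, -, rfl⟩
    exact hφ x
  · have hA' : ¬ A ⊆ ψ M := fun hs => hA (hdown _ (hψ M hM) _ hs)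
    obtain ⟨x, hxA, hx⟩ := not_subset.1 hA'
    exact ⟨φ x, mem_image_of_mem φ hxA, h M hM x hx⟩

end IdealCardinals

theorem cofIdeal_sigmaG0_le_continuum : cofIdeal sigmaG0 ≤ 𝔠 := by
  borelize HilbertCube
  have h1 : cofIdeal sigmaG0 ≤
      #↥({A | A ∈ sigmaG0 ∧ MeasurableSet A} : Set (Set HilbertCube)) := by
    refine csInf_le' ⟨_, fun A hA => hA.1, ?_, rfl⟩
    rintro A ⟨S, hS, hAS⟩
    exact ⟨⋃ n, S n, ⟨⟨S, hS, subset_rfl⟩, .iUnion fun n => (hS n).1.measurableSet⟩, hAS⟩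
  have h2 : #↥({A | MeasurableSet A} : Set (Set HilbertCube)) ≤ 𝔠 := by
    rw [BorelSpace.measurable_eq (α := HilbertCube),
      (TopologicalSpace.isBasis_countableBasis HilbertCube).borel_eq_generateFrom]
    exact MeasurableSpace.cardinal_measurableSet_le_continuum
      ((TopologicalSpace.countable_countableBasis HilbertCube).le_aleph0.trans aleph0_le_continuum)
  exact h1.trans ((mk_le_mk_of_subset fun A hA => hA.2).trans h2)

theorem sUnion_sigmaG0 : ⋃₀ sigmaG0 = Set.univ := by
  refine eq_univ_of_forall fun x => ?_
  obtain ⟨A, hA, hx⟩ := exists_mem_GdeltaFamily x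
  exact ⟨A, GdeltaFamily_subset_sigmaG0 hA, hx⟩

theorem univ_notMem_meagerIdeal : Set.univ ∉ MeagerIdeal HilbertCube :=
  fun h => not_isMeagre_of_isOpen isOpen_univ univ_nonempty h

theorem sUnion_meagerIdeal : ⋃₀ MeagerIdeal HilbertCube = Set.univ := by
  refine eq_univ_of_forall fun x => ⟨{x}, ?_, rfl⟩
  exact (isClosed_singleton.isNowhereDense_iff.2 (interior_singleton x)).isMeagre

/-- The chain of inequalities for the cardinal characteristics of `σG₀`:
`ω₁ ≤ add(σG₀) ≤ cov(σG₀) ≤ add(M) ≤ cof(M) ≤ non(σG₀) ≤ cof(σG₀) ≤ 𝔠`. -/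
theorem sigmaG0_cardinal_chain :
    Cardinal.aleph 1 ≤ addIdeal sigmaG0 ∧
    addIdeal sigmaG0 ≤ covIdeal sigmaG0 ∧
    covIdeal sigmaG0 ≤ addIdeal (MeagerIdeal HilbertCube) ∧
    addIdeal (MeagerIdeal HilbertCube) ≤ cofIdeal (MeagerIdeal HilbertCube) ∧
    cofIdeal (MeagerIdeal HilbertCube) ≤ nonIdeal sigmaG0 ∧
    nonIdeal sigmaG0 ≤ cofIdeal sigmaG0 ∧
    cofIdeal sigmaG0 ≤ Cardinal.continuum := by
  obtain ⟨φ, ψ, hφ, h⟩ := exists_tukey_connection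
  have hdown : ∀ A ∈ sigmaG0, ∀ B ⊆ A, B ∈ sigmaG0 := fun A hA B hB => subset_mem_sigmaG0 hA hB
  have hempty : ∅ ∈ sigmaG0 := hdown _ (h ∅ IsMeagre.empty).1 _ (empty_subset _)
  have hM : ∀ A ∈ MeagerIdeal HilbertCube, ∀ B ⊆ A, B ∈ MeagerIdeal HilbertCube :=
    fun A hA B hB => IsMeagre.mono hB hA
  exact ⟨aleph_one_le_addIdeal hempty (fun A hA => iUnion_mem_sigmaG0 hA)
      (sUnion_sigmaG0 ▸ univ_notMem_sigmaG0),
    addIdeal_le_covIdeal sUnion_sigmaG0 univ_notMem_sigmaG0,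
    covIdeal_le_addIdeal_of_tukey hM (sUnion_meagerIdeal ▸ univ_notMem_meagerIdeal) hφ
      (fun M hM => (h M hM).1) (fun M hM => (h M hM).2),
    addIdeal_le_cofIdeal sUnion_meagerIdeal univ_notMem_meagerIdeal,
    cofIdeal_le_nonIdeal_of_tukey hdown univ_notMem_sigmaG0 hφ
      (fun M hM => (h M hM).1) (fun M hM => (h M hM).2),
    nonIdeal_le_cofIdeal univ_notMem_sigmaG0, cofIdeal_sigmaG0_le_continuum⟩
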